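/- Let S = {1, 2, 3², 4³, 5⁴, 6⁵, 7⁶, 8⁷} = {1, 2, 9, 64, 625, 7776, 117649, 2097152}. For every 4-element subset A of S, with B := S ∖ A, the set of pairs (E_2, E_3) of subspaces of ℂ^5 with dim E_2 = 2, dim E_3 = 3, E_2 ⊆ E_3, such that E_2 ∩ F_3(a) ≠ {0} for every a ∈ A and E_3 ∩ F_2(b) ≠ {0} for every b ∈ B, has exactly twelve elements, and every one of these twelve flags is real: both E_2 and E_3 are stable under coordinatewise complex conjugation. -/

import Mathlib

/-- The `j`-th coordinatewise derivative at `s` of the rational normal curve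
`γ(s) = (1, s, s², s³, s⁴)` in `ℂ⁵`. -/
noncomputable def oscVec5 (j : ℕ) (s : ℂ) : Fin 5 → ℂ :=
  fun i => iteratedDeriv j (fun t : ℂ => t ^ (i : ℕ)) s

/-- The osculating subspace `F_k(s) = span{γ(s), γ'(s), …, γ^{(k-1)}(s)}`. -/
noncomputable def oscF5 (k : ℕ) (s : ℂ) : Submodule ℂ (Fin 5 → ℂ) :=
  Submodule.span ℂ (Set.range fun j : Fin k => oscVec5 j s)

/-- A subspace of `ℂ⁵` is real if it is stable under coordinatewise complex conjugation. -/
def conjStable5 (H : Submodule ℂ (Fin 5 → ℂ)) : Prop :=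
  ∀ x ∈ H, (fun i => (starRingEnd ℂ) (x i)) ∈ H

open Matrix

/-- The integer `p - n`, represented by the pair of natural numbers `p`, `n`. -/
structure SInt where
  p : ℕ
  n : ℕ

namespace SInt

/-- The integer represented by a pair. -/
def val (a : SInt) : ℤ := a.p - a.n

/-- Sum. -/
def add (a b : SInt) : SInt := ⟨Nat.add a.p b.p, Nat.add a.n b.n⟩

/-- Difference. -/
def sub (a b : SInt) : SInt := ⟨Nat.add a.p b.n, Nat.add a.n b.p⟩

/-- Negation. -/
def neg (a : SInt) : SInt := ⟨a.n, a.p⟩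

/-- Product. -/
def mul (a b : SInt) : SInt :=
  ⟨Nat.add (Nat.mul a.p b.p) (Nat.mul a.n b.n), Nat.add (Nat.mul a.p b.n) (Nat.mul a.n b.p)⟩

/-- Product with a natural number. -/
def scale (k : ℕ) (a : SInt) : SInt := ⟨Nat.mul k a.p, Nat.mul k a.n⟩

/-- Absolute value. -/
def abs (a : SInt) : ℕ := Nat.add (Nat.sub a.p a.n) (Nat.sub a.n a.p)

/-- The pair that represents `m * 2 ^ e`. -/
def dyadic (m : ℤ) (e : ℕ) : SInt := ⟨Nat.mul m.toNat (2 ^ e), Nat.mul (-m).toNat (2 ^ e)⟩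

end SInt

/-- Vectors of length three. -/
structure Triple (R : Type*) where
  x : R
  y : R
  z : R

namespace Triple

/-- Linear combination of two integer vectors. -/
def comb (a b : SInt) (s t : Triple SInt) : Triple SInt :=
  ⟨(a.mul s.x).add (b.mul t.x), (a.mul s.y).add (b.mul t.y), (a.mul s.z).add (b.mul t.z)⟩

/-- Dot product of integer vectors. -/
def dot (s t : Triple SInt) : SInt := ((s.x.mul t.x).add (s.y.mul t.y)).add (s.z.mul t.z)

end Triple

/-- The affine function `c + l₀ u₀ + l₁ u₁`, up to a function that vanishes at the origin and has
Lipschitz constant `e` on the unit cube. -/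
structure Model where
  c : SInt
  l₀ : SInt
  l₁ : SInt
  e : ℕ

namespace Model

/-- A Lipschitz constant for the non-constant part. -/
def lip (f : Model) : ℕ := Nat.add (Nat.add f.l₀.abs f.l₁.abs) f.e

/-- A model of `f * g - h * k`, where the models have no error term. -/
def crossMul (f g h k : Model) : Model :=
  ⟨(f.c.mul g.c).sub (h.c.mul k.c),
    ((f.c.mul g.l₀).add (g.c.mul f.l₀)).sub ((h.c.mul k.l₀).add (k.c.mul h.l₀)),
    ((f.c.mul g.l₁).add (g.c.mul f.l₁)).sub ((h.c.mul k.l₁).add (k.c.mul h.l₁)),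
    Nat.mul 2 (Nat.add (Nat.mul f.lip g.lip) (Nat.mul h.lip k.lip))⟩

/-- A sufficient condition for the function to have no zeros on the unit cube. -/
def nonzero (f : Model) : Bool := Nat.blt f.lip f.c.abs

end Model

/-- The affine function `c + l₀ u₀ + l₁ u₁ + l₂ u₂ + l₃ u₃`, up to a function that vanishes at the
origin and has Lipschitz constant `e` on the unit cube. -/
structure Model₄ where
  c : SInt
  l₀ : SInt
  l₁ : SInt
  l₂ : SInt
  l₃ : SInt
  e : ℕ

/-- A vector of length three whose coordinates are affine functions of two variables, one of the
coordinates being constant. Each coordinate is centered at the dyadic number `mᵢ * 2 ^ eᵢ` and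
varies by `2 ^ eᵢ`, except for the constant coordinate, the one with number `i`. -/
structure Box where
  i : ℕ
  m₀ : ℤ
  e₀ : ℕ
  m₁ : ℤ
  e₁ : ℕ
  m₂ : ℤ
  e₂ : ℕ

namespace Box

/-- The center of the box. -/
def center (v : Box) : Triple SInt := ⟨.dyadic v.m₀ v.e₀, .dyadic v.m₁ v.e₁, .dyadic v.m₂ v.e₂⟩

/-- The coefficients of the two variables in the linear form `t` on the box. -/
def slopes (v : Box) (t : Triple SInt) : SInt × SInt :=
  match v.i with
  | 0 => (t.y.scale (2 ^ v.e₁), t.z.scale (2 ^ v.e₂))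
  | 1 => (t.x.scale (2 ^ v.e₀), t.z.scale (2 ^ v.e₂))
  | _ => (t.x.scale (2 ^ v.e₀), t.y.scale (2 ^ v.e₁))

/-- The linear form `t` on the box. -/
def lin (v : Box) (t : Triple SInt) : Model := ⟨t.dot v.center, (v.slopes t).1, (v.slopes t).2, 0⟩

/-- The constant coordinate does not vanish. -/
def pivot (v : Box) : Bool :=
  match v.i with
  | 0 => !(v.m₀ == 0)
  | 1 => !(v.m₁ == 0)
  | _ => !(v.m₂ == 0)

/-- The radii of the box. -/
def radii (v : Box) : Triple ℕ :=
  match v.i with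
  | 0 => ⟨0, 2 ^ v.e₁, 2 ^ v.e₂⟩
  | 1 => ⟨2 ^ v.e₀, 0, 2 ^ v.e₂⟩
  | _ => ⟨2 ^ v.e₀, 2 ^ v.e₁, 0⟩

/-- A model of the dot product of `v` with a vector of three models in other variables. -/
def pair (v : Box) (f g h : Model) : Model₄ :=
  ⟨Triple.dot ⟨f.c, g.c, h.c⟩ v.center, Triple.dot ⟨f.l₀, g.l₀, h.l₀⟩ v.center,
    Triple.dot ⟨f.l₁, g.l₁, h.l₁⟩ v.center, (v.slopes ⟨f.c, g.c, h.c⟩).1,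
    (v.slopes ⟨f.c, g.c, h.c⟩).2,
    Nat.add (Nat.add
      (Nat.add (Nat.mul v.center.x.abs f.e) (Nat.mul 2 (Nat.mul v.radii.x f.lip)))
      (Nat.add (Nat.mul v.center.y.abs g.e) (Nat.mul 2 (Nat.mul v.radii.y g.lip))))
      (Nat.add (Nat.mul v.center.z.abs h.e) (Nat.mul 2 (Nat.mul v.radii.z h.lip)))⟩

end Box

/-- A point `b` together with the first two derivatives `p`, `q` at `b` of a polynomial with a
simple root there. -/
structure Node where
  b : SInt
  p : SInt
  q : SInt

namespace Node

/-- The node at `b` for the polynomial with roots `b, c, d, e`. -/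
def of (b c d e : ℕ) : Node :=
  ⟨⟨b, 0⟩, ((SInt.mk b c).mul ⟨b, d⟩).mul ⟨b, e⟩,
    (((SInt.mk b c).mul ⟨b, d⟩).add (((SInt.mk b c).mul ⟨b, e⟩).add
      ((SInt.mk b d).mul ⟨b, e⟩))).scale 2⟩

/-- The linear form `z ↦ z b` on quadratic polynomials. -/
def eval (n : Node) : Triple SInt := ⟨⟨1, 0⟩, n.b, n.b.mul n.b⟩

/-- The linear form `z ↦ z' b` on quadratic polynomials. -/
def deriv (n : Node) : Triple SInt := ⟨⟨0, 0⟩, ⟨1, 0⟩, n.b.scale 2⟩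

/-- The linear form `z ↦ p * z' b - q * z b`. -/
def alpha (n : Node) : Triple SInt := Triple.comb n.p n.q.neg n.deriv n.eval

/-- The linear form `z ↦ p * z b`. -/
def beta (n : Node) : Triple SInt := Triple.comb n.p ⟨0, 0⟩ n.eval n.eval

/-- The first linear condition for membership in the osculating space at `a`. -/
def phi (n : Node) (a : ℕ) : Triple SInt :=
  let d := n.b.sub ⟨a, 0⟩
  Triple.comb ((d.mul d).mul d) ((d.mul d).scale 3) n.alpha n.beta

/-- The second linear condition for membership in the osculating space at `a`. -/
def psi (n : Node) (a : ℕ) : Triple SInt :=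
  let d := n.b.sub ⟨a, 0⟩
  Triple.comb n.b ((d.mul d).mul d) (n.phi a) n.beta

/-- A linear form whose non-vanishing shows that the vector at `n` does not lie in the span of the
osculating planes at `m` and `k`. -/
def indep (n m k : Node) : Triple SInt :=
  Triple.comb ((n.b.sub m.b).mul (n.b.sub k.b)) (((n.b.sub m.b).add (n.b.sub k.b)).scale 2)
    n.alpha n.beta

end Node

/-- `a * p + b * q + c * r + d * s` -/
def SInt.dot₄ (a b c d p q r s : SInt) : SInt :=
  ((a.mul p).add (b.mul q)).add ((c.mul r).add (d.mul s))

/-- `a * p - b * q + c * r` -/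
def SInt.alt₃ (a b c p q r : SInt) : SInt := ((a.mul p).add (c.mul r)).sub (b.mul q)

namespace Model₄

/-- One row of the contraction test. -/
def rowTest (f g h k : Model₄) (D a b c d : SInt) : Bool :=
  Nat.blt (Nat.add (SInt.dot₄ a b c d f.c g.c h.c k.c).abs
    (Nat.add (Nat.add (Nat.mul a.abs f.e) (Nat.mul b.abs g.e))
      (Nat.add (Nat.mul c.abs h.e) (Nat.mul d.abs k.e)))) D.abs

/-- `a * d - b * c` -/
def minor (a b c d : SInt) : SInt := (a.mul d).sub (b.mul c)

/-- A test for the simplified Newton iteration to map the unit cube to itself and to be a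
contraction. -/
def newton (f g h k : Model₄) : Bool :=
  let a01 := minor f.l₀ f.l₁ g.l₀ g.l₁
  let a02 := minor f.l₀ f.l₂ g.l₀ g.l₂
  let a03 := minor f.l₀ f.l₃ g.l₀ g.l₃
  let a12 := minor f.l₁ f.l₂ g.l₁ g.l₂
  let a13 := minor f.l₁ f.l₃ g.l₁ g.l₃
  let a23 := minor f.l₂ f.l₃ g.l₂ g.l₃
  let b01 := minor h.l₀ h.l₁ k.l₀ k.l₁
  let b02 := minor h.l₀ h.l₂ k.l₀ k.l₂
  let b03 := minor h.l₀ h.l₃ k.l₀ k.l₃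
  let b12 := minor h.l₁ h.l₂ k.l₁ k.l₂
  let b13 := minor h.l₁ h.l₃ k.l₁ k.l₃
  let b23 := minor h.l₂ h.l₃ k.l₂ k.l₃
  let D := (SInt.alt₃ a01 a02 a03 b23 b13 b12).add (SInt.alt₃ a12 a13 a23 b03 b02 b01)
  rowTest f g h k D (.alt₃ g.l₁ g.l₂ g.l₃ b23 b13 b12) (.neg (.alt₃ f.l₁ f.l₂ f.l₃ b23 b13 b12))
    (.alt₃ k.l₁ k.l₂ k.l₃ a23 a13 a12) (.neg (.alt₃ h.l₁ h.l₂ h.l₃ a23 a13 a12)) &&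
  rowTest f g h k D (.neg (.alt₃ g.l₀ g.l₂ g.l₃ b23 b03 b02)) (.alt₃ f.l₀ f.l₂ f.l₃ b23 b03 b02)
    (.neg (.alt₃ k.l₀ k.l₂ k.l₃ a23 a03 a02)) (.alt₃ h.l₀ h.l₂ h.l₃ a23 a03 a02) &&
  rowTest f g h k D (.alt₃ g.l₀ g.l₁ g.l₃ b13 b03 b01) (.neg (.alt₃ f.l₀ f.l₁ f.l₃ b13 b03 b01))
    (.alt₃ k.l₀ k.l₁ k.l₃ a13 a03 a01) (.neg (.alt₃ h.l₀ h.l₁ h.l₃ a13 a03 a01)) &&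
  rowTest f g h k D (.neg (.alt₃ g.l₀ g.l₁ g.l₂ b12 b02 b01)) (.alt₃ f.l₀ f.l₁ f.l₂ b12 b02 b01)
    (.neg (.alt₃ k.l₀ k.l₁ k.l₂ a12 a02 a01)) (.alt₃ h.l₀ h.l₁ h.l₂ a12 a02 a01)

end Model₄

/-- The incidence condition at `a` for the subspace with parameters `z` and the covector `k`. -/
def incidence (n₁ n₂ n₃ : Node) (z k : Box) (a : ℕ) : Model₄ :=
  let p₁ := z.lin (n₁.phi a)
  let p₂ := z.lin (n₂.phi a)
  let p₃ := z.lin (n₃.phi a)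
  let q₁ := z.lin (n₁.psi a)
  let q₂ := z.lin (n₂.psi a)
  let q₃ := z.lin (n₃.psi a)
  k.pair (.crossMul p₂ q₃ p₃ q₂) (.crossMul p₃ q₁ p₁ q₃) (.crossMul p₁ q₂ p₂ q₁)

/-- A splitting of the eight points into two sets of four points, with approximations of the
corresponding flags. -/
structure Split where
  a₁ : ℕ
  a₂ : ℕ
  a₃ : ℕ
  a₄ : ℕ
  b₁ : ℕ
  b₂ : ℕ
  b₃ : ℕ
  b₄ : ℕ
  sols : List (Box × Box)

namespace Split

/-- The first node. -/
def n₁ (s : Split) : Node := .of s.b₁ s.b₂ s.b₃ s.b₄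

/-- The second node. -/
def n₂ (s : Split) : Node := .of s.b₂ s.b₁ s.b₃ s.b₄

/-- The third node. -/
def n₃ (s : Split) : Node := .of s.b₃ s.b₁ s.b₂ s.b₄

/-- A test for the existence of a flag near an approximation. -/
def existsTest (s : Split) (v : Box × Box) : Bool :=
  Model₄.newton (incidence s.n₁ s.n₂ s.n₃ v.1 v.2 s.a₁) (incidence s.n₁ s.n₂ s.n₃ v.1 v.2 s.a₂)
    (incidence s.n₁ s.n₂ s.n₃ v.1 v.2 s.a₃) (incidence s.n₁ s.n₂ s.n₃ v.1 v.2 s.a₄) &&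
  ((v.1.lin (Node.indep s.n₁ s.n₂ s.n₃)).nonzero && (v.1.lin (Node.indep s.n₂ s.n₁ s.n₃)).nonzero &&
    (v.1.lin (Node.indep s.n₃ s.n₁ s.n₂)).nonzero && v.2.pivot)

/-- A test for two approximations to belong to distinct flags. -/
def sepTest (s : Split) (v w : Box × Box) : Bool :=
  Nat.blt (Nat.add (Nat.add
    (Nat.add (Nat.mul (v.1.lin s.n₁.eval).c.abs (w.1.lin s.n₁.deriv).lip)
      (Nat.mul (v.1.lin s.n₁.eval).lip (w.1.lin s.n₁.deriv).c.abs))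
    (Nat.add (Nat.mul (v.1.lin s.n₁.deriv).c.abs (w.1.lin s.n₁.eval).lip)
      (Nat.mul (v.1.lin s.n₁.deriv).lip (w.1.lin s.n₁.eval).c.abs)))
    (Nat.add (Nat.mul (v.1.lin s.n₁.eval).lip (w.1.lin s.n₁.deriv).lip)
      (Nat.mul (v.1.lin s.n₁.deriv).lip (w.1.lin s.n₁.eval).lip)))
    (((v.1.lin s.n₁.eval).c.mul (w.1.lin s.n₁.deriv).c).sub
      ((v.1.lin s.n₁.deriv).c.mul (w.1.lin s.n₁.eval).c)).abs

/-- A test for all approximations to belong to distinct flags. -/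
def sepTests (s : Split) : List (Box × Box) → Bool
  | [] => true
  | v :: l => l.all (s.sepTest v) && s.sepTests l

/-- A test for the existence of as many flags as there are approximations. -/
def lowerTest (s : Split) : Bool :=
  s.sols.length == 12 && s.sols.all s.existsTest && s.sepTests s.sols

end Split

namespace SInt

@[simp] theorem val_add (a b : SInt) : (a.add b).val = a.val + b.val := by
  simp only [val, add, Nat.add_eq]; push_cast; ring

@[simp] theorem val_sub (a b : SInt) : (a.sub b).val = a.val - b.val := by
  simp only [val, sub, Nat.add_eq]; push_cast; ring

@[simp] theorem val_neg (a : SInt) : a.neg.val = -a.val := by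
  simp only [val, neg]; ring

@[simp] theorem val_mul (a b : SInt) : (a.mul b).val = a.val * b.val := by
  simp only [val, mul, Nat.add_eq, Nat.mul_eq]; push_cast; ring

@[simp] theorem val_scale (k : ℕ) (a : SInt) : (a.scale k).val = k * a.val := by
  simp only [val, scale, Nat.mul_eq]; push_cast; ring

@[simp] theorem val_dyadic (m : ℤ) (e : ℕ) : (dyadic m e).val = m * 2 ^ e := by
  simp only [val, dyadic, Nat.mul_eq]
  push_cast
  rw [← sub_mul]
  congr 1
  omega

@[simp] theorem val_mk (p n : ℕ) : (mk p n).val = p - n := rfl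

theorem cast_abs (a : SInt) : (a.abs : ℝ) = |(a.val : ℝ)| := by
  have h : (a.abs : ℤ) = |a.val| := by
    simp only [val, abs, Nat.add_eq, Nat.sub_eq]
    rcases abs_cases ((a.p : ℤ) - a.n) with h | h <;> omega
  exact_mod_cast congrArg (Int.cast : ℤ → ℝ) h

@[simp] theorem val_dot₄ (a b c d p q r s : SInt) : (dot₄ a b c d p q r s).val =
    a.val * p.val + b.val * q.val + (c.val * r.val + d.val * s.val) := by
  simp [dot₄]

@[simp] theorem val_alt₃ (a b c p q r : SInt) :
    (alt₃ a b c p q r).val = a.val * p.val + c.val * r.val - b.val * q.val := by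
  simp [alt₃]

end SInt

@[simp] theorem Model₄.val_minor (a b c d : SInt) :
    (minor a b c d).val = a.val * d.val - b.val * c.val := by
  simp [minor]

namespace Triple

/-- The linear form with integer coefficients `t` at a vector. -/
def eval {K : Type*} [Ring K] (t : Triple SInt) (z : Triple K) : K :=
  t.x.val * z.x + t.y.val * z.y + t.z.val * z.z

@[simp] theorem eval_comb {K : Type*} [CommRing K] (a b : SInt) (s t : Triple SInt)
    (z : Triple K) : (comb a b s t).eval z = a.val * s.eval z + b.val * t.eval z := by
  simp only [eval, comb, SInt.val_add, SInt.val_mul]; push_cast; ring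

@[simp] theorem val_dot (s t : Triple SInt) :
    (s.dot t).val = s.x.val * t.x.val + s.y.val * t.y.val + s.z.val * t.z.val := by
  simp [dot]

end Triple

/-- Up to a Lipschitz function with constant `e` that vanishes at the origin, `f` is the affine
function with constant term `c` and linear part `l` on the unit cube. -/
structure Approx (f : (Fin 4 → ℝ) → ℝ) (c : ℝ) (l : Fin 4 → ℝ) (e : ℝ) : Prop where
  nonneg : 0 ≤ e
  map_zero : f 0 = c
  le : ∀ u v : Fin 4 → ℝ, ‖u‖ ≤ 1 → ‖v‖ ≤ 1 → |f u - f v - l ⬝ᵥ (u - v)| ≤ e * ‖u - v‖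

theorem abs_dotProduct_le {ι : Type*} [Fintype ι] (l u : ι → ℝ) :
    |l ⬝ᵥ u| ≤ (∑ i, |l i|) * ‖u‖ := by
  rw [dotProduct, Finset.sum_mul]
  refine (Finset.abs_sum_le_sum_abs _ _).trans (Finset.sum_le_sum fun i _ => ?_)
  rw [abs_mul]
  exact mul_le_mul_of_nonneg_left (norm_le_pi_norm u i) (abs_nonneg _)

namespace Approx

variable {f g : (Fin 4 → ℝ) → ℝ} {c c' : ℝ} {l l' : Fin 4 → ℝ} {e e' : ℝ}

theorem lipschitz (hf : Approx f c l e) {u v : Fin 4 → ℝ} (hu : ‖u‖ ≤ 1) (hv : ‖v‖ ≤ 1) :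
    |f u - f v| ≤ (∑ i, |l i| + e) * ‖u - v‖ := by
  have h₁ := hf.le u v hu hv
  have h₂ := abs_dotProduct_le l (u - v)
  have h₃ := abs_add_le (f u - f v - l ⬝ᵥ (u - v)) (l ⬝ᵥ (u - v))
  rw [sub_add_cancel] at h₃
  linarith

theorem abs_sub_le (hf : Approx f c l e) {u : Fin 4 → ℝ} (hu : ‖u‖ ≤ 1) :
    |f u - c| ≤ ∑ i, |l i| + e := by
  have h := hf.lipschitz hu (v := 0) (by simp)
  rw [hf.map_zero, sub_zero] at h
  have h₀ : 0 ≤ ∑ i, |l i| + e := add_nonneg (Finset.sum_nonneg fun _ _ => abs_nonneg _) hf.nonneg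
  nlinarith

theorem add (hf : Approx f c l e) (hg : Approx g c' l' e') :
    Approx (fun u => f u + g u) (c + c') (l + l') (e + e') where
  nonneg := add_nonneg hf.nonneg hg.nonneg
  map_zero := by rw [hf.map_zero, hg.map_zero]
  le u v hu hv := by
    have h := abs_add_le (f u - f v - l ⬝ᵥ (u - v)) (g u - g v - l' ⬝ᵥ (u - v))
    have h₁ := hf.le u v hu hv
    have h₂ := hg.le u v hu hv
    rw [add_dotProduct]
    rw [show f u + g u - (f v + g v) - (l ⬝ᵥ (u - v) + l' ⬝ᵥ (u - v)) =
      f u - f v - l ⬝ᵥ (u - v) + (g u - g v - l' ⬝ᵥ (u - v)) by ring]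
    linarith

theorem neg (hf : Approx f c l e) : Approx (fun u => -f u) (-c) (-l) e where
  nonneg := hf.nonneg
  map_zero := by rw [hf.map_zero]
  le u v hu hv := by
    rw [neg_dotProduct, show -f u - -f v - -(l ⬝ᵥ (u - v)) = -(f u - f v - l ⬝ᵥ (u - v)) by ring,
      abs_neg]
    exact hf.le u v hu hv

theorem mul (hf : Approx f c l e) (hg : Approx g c' l' e') :
    Approx (fun u => f u * g u) (c * c') (c • l' + c' • l)
      (|c| * e' + |c'| * e + 2 * ((∑ i, |l i| + e) * (∑ i, |l' i| + e'))) where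
  nonneg := by
    have := hf.nonneg
    have := hg.nonneg
    positivity
  map_zero := by rw [hf.map_zero, hg.map_zero]
  le u v hu hv := by
    have h₁ := hf.le u v hu hv
    have h₂ := hg.le u v hu hv
    have h₃ := hf.abs_sub_le hu
    have h₄ := hg.abs_sub_le hv
    have h₅ := hf.lipschitz hu hv
    have h₆ := hg.lipschitz hu hv
    have h₇ := (abs_nonneg _).trans h₃
    have h₈ := (abs_nonneg _).trans h₄
    rw [add_dotProduct, smul_dotProduct, smul_dotProduct, smul_eq_mul, smul_eq_mul]
    rw [show f u * g u - f v * g v - (c * l' ⬝ᵥ (u - v) + c' * l ⬝ᵥ (u - v)) =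
      c * (g u - g v - l' ⬝ᵥ (u - v)) + c' * (f u - f v - l ⬝ᵥ (u - v)) +
        ((f u - c) * (g u - g v) + (g v - c') * (f u - f v)) by ring]
    refine (abs_add_le _ _).trans ?_
    rw [show ∀ a b d x y : ℝ, (a + b + 2 * (x * y)) * d = a * d + b * d + (x * (y * d) +
      y * (x * d)) by intros; ring]
    refine add_le_add ((abs_add_le _ _).trans ?_) ((abs_add_le _ _).trans ?_)
    · rw [abs_mul, abs_mul, mul_assoc, mul_assoc]
      gcongr
    · rw [abs_mul, abs_mul]
      gcongr

end Approx

/-- The simplified Newton method. -/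
theorem exists_zero_of_approx {F : (Fin 4 → ℝ) → Fin 4 → ℝ} {c e : Fin 4 → ℝ}
    {J P : Matrix (Fin 4) (Fin 4) ℝ} {D : ℝ} (hF : ∀ j, Approx (fun u => F u j) (c j) (J j) (e j))
    (hP : P * J = D • (1 : Matrix (Fin 4) (Fin 4) ℝ))
    (hlt : ∀ i, |(P *ᵥ c) i| + ∑ j, |P i j| * e j < |D|) : ∃ u, ‖u‖ ≤ 1 ∧ F u = 0 := by
  have hD : 0 < |D| := lt_of_le_of_lt (add_nonneg (abs_nonneg _) (Finset.sum_nonneg fun j _ =>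
    mul_nonneg (abs_nonneg _) (hF j).nonneg)) (hlt 0)
  have hD₀ : D ≠ 0 := abs_pos.mp hD
  let T : (Fin 4 → ℝ) → Fin 4 → ℝ := fun u => u - D⁻¹ • (P *ᵥ F u)
  have hdiff (u v : Fin 4 → ℝ) (hu : ‖u‖ ≤ 1) (hv : ‖v‖ ≤ 1) (i : Fin 4) :
      |D| * |T u i - T v i| ≤ (∑ j, |P i j| * e j) * ‖u - v‖ := by
    have h₁ : D * (T u i - T v i) = -∑ j, P i j * (F u j - F v j - J j ⬝ᵥ (u - v)) := by
      have h₂ : ∑ j, P i j * (J j ⬝ᵥ (u - v)) = D * (u i - v i) := by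
        have h₃ := congrFun (congrArg (· *ᵥ (u - v)) hP) i
        simp only [← Matrix.mulVec_mulVec, Matrix.smul_mulVec, Matrix.one_mulVec, Pi.smul_apply,
          smul_eq_mul, Pi.sub_apply] at h₃
        exact h₃
      simp only [mul_sub, Finset.sum_sub_distrib, h₂]
      simp only [T, Pi.sub_apply, Pi.smul_apply, smul_eq_mul, Matrix.mulVec, dotProduct]
      field_simp
      ring
    rw [← abs_mul, h₁, abs_neg, Finset.sum_mul]
    refine (Finset.abs_sum_le_sum_abs _ _).trans (Finset.sum_le_sum fun j _ => ?_)
    rw [abs_mul, mul_assoc]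
    exact mul_le_mul_of_nonneg_left ((hF j).le u v hu hv) (abs_nonneg _)
  have hmaps : Set.MapsTo T (Metric.closedBall 0 1) (Metric.closedBall 0 1) := by
    intro u hu
    rw [mem_closedBall_zero_iff] at hu ⊢
    refine (pi_norm_le_iff_of_nonneg zero_le_one).2 fun i => ?_
    have h₁ := hdiff u 0 hu (by simp) i
    have h₂ : |D| * |T 0 i| = |(P *ᵥ c) i| := by
      have h₃ : F 0 = c := funext fun j => (hF j).map_zero
      rw [← abs_mul]
      simp only [T, h₃, Pi.sub_apply, Pi.zero_apply, Pi.smul_apply, smul_eq_mul, zero_sub,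
        mul_neg, abs_neg, mul_inv_cancel_left₀ hD₀]
    have h₃ := abs_add_le (T u i - T 0 i) (T 0 i)
    rw [sub_add_cancel] at h₃
    have h₄ : 0 ≤ ∑ j, |P i j| * e j := Finset.sum_nonneg fun j _ =>
      mul_nonneg (abs_nonneg _) (hF j).nonneg
    rw [sub_zero] at h₁
    have h₅ : |D| * |T u i| ≤ |D| * 1 := by nlinarith [hlt i]
    exact le_of_mul_le_mul_left h₅ hD
  obtain ⟨K, hK, hK'⟩ : ∃ K : ℝ, K < 1 ∧ ∀ i, (∑ j, |P i j| * e j) ≤ |D| * K := by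
    refine ⟨(Finset.univ.sup' Finset.univ_nonempty fun i => ∑ j, |P i j| * e j) / |D|, ?_,
      fun i => ?_⟩
    · rw [div_lt_one hD, Finset.sup'_lt_iff]
      intro i _
      linarith [hlt i, abs_nonneg ((P *ᵥ c) i)]
    · rw [mul_div_cancel₀ _ hD.ne']
      exact Finset.le_sup' (fun i => ∑ j, |P i j| * e j) (Finset.mem_univ i)
  have hK₀ : 0 ≤ K := by
    have := (Finset.sum_nonneg fun j _ => mul_nonneg (abs_nonneg (P 0 j)) (hF j).nonneg).trans
      (hK' 0)
    exact nonneg_of_mul_nonneg_right this hD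
  have hlip : LipschitzOnWith ⟨K, hK₀⟩ T (Metric.closedBall 0 1) := by
    refine LipschitzOnWith.of_dist_le_mul fun u hu v hv => ?_
    rw [mem_closedBall_zero_iff] at hu hv
    rw [dist_eq_norm, dist_eq_norm]
    refine (pi_norm_le_iff_of_nonneg (mul_nonneg hK₀ (norm_nonneg _))).2 fun i => ?_
    have h₁ := (hdiff u v hu hv i).trans (mul_le_mul_of_nonneg_right (hK' i) (norm_nonneg _))
    rw [mul_assoc] at h₁
    exact le_of_mul_le_mul_left h₁ hD
  have hc : ContractingWith ⟨K, hK₀⟩ (hmaps.restrict T _ _) :=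
    ⟨hK, hlip.mapsToRestrict hmaps⟩
  obtain ⟨u, hu, hfix, -⟩ := hc.exists_fixedPoint' (Metric.isClosed_closedBall.isComplete) hmaps
    (x := 0) (by simp) (edist_ne_top _ _)
  refine ⟨u, mem_closedBall_zero_iff.1 hu, ?_⟩
  have h₁ : P *ᵥ F u = 0 := by
    have h₂ : u - D⁻¹ • (P *ᵥ F u) = u := hfix
    simpa [hD₀] using h₂
  have h₂ : J * P = D • (1 : Matrix (Fin 4) (Fin 4) ℝ) := by
    have h₃ : (D⁻¹ • P) * J = 1 := by rw [Matrix.smul_mul, hP, smul_smul, inv_mul_cancel₀ hD₀,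
      one_smul]
    rw [mul_eq_one_comm, Matrix.mul_smul] at h₃
    rw [← h₃, smul_smul, mul_inv_cancel₀ hD₀, one_smul]
  have h₃ : D • F u = 0 := by
    rw [← Matrix.one_mulVec (F u), ← Matrix.smul_mulVec, ← h₂, ← Matrix.mulVec_mulVec, h₁,
      Matrix.mulVec_zero]
  exact (smul_eq_zero.1 h₃).resolve_left hD₀

namespace Box

/-- The point of the box with parameters `s` and `t` between `-1` and `1`. -/
noncomputable def point (v : Box) (s t : ℝ) : Triple ℝ :=
  match v.i with
  | 0 => ⟨v.m₀ * 2 ^ v.e₀, v.m₁ * 2 ^ v.e₁ + 2 ^ v.e₁ * s, v.m₂ * 2 ^ v.e₂ + 2 ^ v.e₂ * t⟩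
  | 1 => ⟨v.m₀ * 2 ^ v.e₀ + 2 ^ v.e₀ * s, v.m₁ * 2 ^ v.e₁, v.m₂ * 2 ^ v.e₂ + 2 ^ v.e₂ * t⟩
  | _ => ⟨v.m₀ * 2 ^ v.e₀ + 2 ^ v.e₀ * s, v.m₁ * 2 ^ v.e₁ + 2 ^ v.e₁ * t, v.m₂ * 2 ^ v.e₂⟩

theorem eval_point (v : Box) (s r : ℝ) (t : Triple SInt) : t.eval (v.point s r) =
    (t.dot v.center).val + ((v.slopes t).1.val * s + (v.slopes t).2.val * r) := by
  obtain ⟨i, m₀, e₀, m₁, e₁, m₂, e₂⟩ := v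
  rcases i with _ | _ | i <;> simp [point, slopes, Triple.eval, center] <;> ring

theorem point_ne_zero {v : Box} (h : v.pivot) (s t : ℝ) :
    ¬((v.point s t).x = 0 ∧ (v.point s t).y = 0 ∧ (v.point s t).z = 0) := by
  unfold pivot at h
  unfold point
  split at h <;> simp_all

end Box

namespace Model

theorem cast_lip (f : Model) : (f.lip : ℝ) = |(f.l₀.val : ℝ)| + |(f.l₁.val : ℝ)| + f.e := by
  simp [lip, SInt.cast_abs]

/-- The first two variables are the parameters of the function that is modelled by `f`. -/
def Models (f : Model) (F : (Fin 4 → ℝ) → ℝ) : Prop :=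
  Approx F f.c.val ![f.l₀.val, f.l₁.val, 0, 0] f.e

theorem Models.crossMul {f g h k : Model} {F G H K : (Fin 4 → ℝ) → ℝ} (hf : f.Models F)
    (hg : g.Models G) (hh : h.Models H) (hk : k.Models K) (hf₀ : f.e = 0) (hg₀ : g.e = 0)
    (hh₀ : h.e = 0) (hk₀ : k.e = 0) :
    (f.crossMul g h k).Models fun u => F u * G u - H u * K u := by
  have := (hf.mul hg).add (hh.mul hk).neg
  unfold Models
  convert this using 1
  · ext u; ring
  · simp [Model.crossMul]; ring
  · ext i; fin_cases i <;> simp [Model.crossMul] <;> ring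
  · simp [Model.crossMul, cast_lip, Fin.sum_univ_four, hf₀, hg₀, hh₀, hk₀]; ring

end Model

theorem Box.models_lin (v : Box) (t : Triple SInt) :
    (v.lin t).Models fun u => t.eval (v.point (u 0) (u 1)) where
  nonneg := by simp [lin]
  map_zero := by simp [eval_point, lin]
  le u w _ _ := by
    simp only [eval_point, lin, dotProduct, Fin.sum_univ_four, Pi.sub_apply]
    simp
    ring_nf

/-- The function `F` of four variables is modelled by `f`. -/
def Model₄.Models (f : Model₄) (F : (Fin 4 → ℝ) → ℝ) : Prop :=
  Approx F f.c.val ![f.l₀.val, f.l₁.val, f.l₂.val, f.l₃.val] f.e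

theorem approx_affine (c a b : ℝ) :
    Approx (fun u => c + (a * u 2 + b * u 3)) c ![0, 0, a, b] 0 where
  nonneg := le_rfl
  map_zero := by simp
  le u w _ _ := by
    simp [dotProduct, Fin.sum_univ_four]
    ring_nf

theorem Box.models_pair (v : Box) {f g h : Model} {F G H : (Fin 4 → ℝ) → ℝ} (hf : f.Models F)
    (hg : g.Models G) (hh : h.Models H) : (v.pair f g h).Models fun u =>
      (v.point (u 2) (u 3)).x * F u + (v.point (u 2) (u 3)).y * G u +
        (v.point (u 2) (u 3)).z * H u := by
  have key (x y z x₂ x₃ y₂ y₃ z₂ z₃ : ℝ) := (((approx_affine x x₂ x₃).mul hf).add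
    ((approx_affine y y₂ y₃).mul hg)).add ((approx_affine z z₂ z₃).mul hh)
  unfold Model₄.Models
  obtain ⟨i, m₀, e₀, m₁, e₁, m₂, e₂⟩ := v
  rcases i with _ | _ | i
  · convert key (m₀ * 2 ^ e₀) (m₁ * 2 ^ e₁) (m₂ * 2 ^ e₂) 0 0 (2 ^ e₁) 0 0 (2 ^ e₂) using 1
    · simp [point]
    · simp [pair, center]; ring
    · ext i; fin_cases i <;> simp [pair, center, slopes] <;> ring
    · simp [pair, center, radii, Model.cast_lip, SInt.cast_abs, Fin.sum_univ_four]
  · convert key (m₀ * 2 ^ e₀) (m₁ * 2 ^ e₁) (m₂ * 2 ^ e₂) (2 ^ e₀) 0 0 0 0 (2 ^ e₂) using 1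
    · simp [point]
    · simp [pair, center]; ring
    · ext i; fin_cases i <;> simp [pair, center, slopes] <;> ring
    · simp [pair, center, radii, Model.cast_lip, SInt.cast_abs, Fin.sum_univ_four]
  · convert key (m₀ * 2 ^ e₀) (m₁ * 2 ^ e₁) (m₂ * 2 ^ e₂) (2 ^ e₀) 0 0 (2 ^ e₁) 0 0 using 1
    · simp [point]
    · simp [pair, center]; ring
    · ext i; fin_cases i <;> simp [pair, center, slopes] <;> ring
    · simp [pair, center, radii, Model.cast_lip, SInt.cast_abs, Fin.sum_univ_four]

/-- The value at `d` of the determinant with rows `k`, `(p₁, p₂, p₃)`, `(q₁, q₂, q₃)`. -/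
def Triple.det {K : Type*} [CommRing K] (k p q : Triple K) : K :=
  k.x * (p.y * q.z - p.z * q.y) + k.y * (p.z * q.x - p.x * q.z) + k.z * (p.x * q.y - p.y * q.x)

theorem incidence_models (n₁ n₂ n₃ : Node) (z k : Box) (a : ℕ) :
    (incidence n₁ n₂ n₃ z k a).Models fun u => (k.point (u 2) (u 3)).det
      ⟨(n₁.phi a).eval (z.point (u 0) (u 1)), (n₂.phi a).eval (z.point (u 0) (u 1)),
        (n₃.phi a).eval (z.point (u 0) (u 1))⟩
      ⟨(n₁.psi a).eval (z.point (u 0) (u 1)), (n₂.psi a).eval (z.point (u 0) (u 1)),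
        (n₃.psi a).eval (z.point (u 0) (u 1))⟩ :=
  k.models_pair ((z.models_lin _).crossMul (z.models_lin _) (z.models_lin _) (z.models_lin _)
    rfl rfl rfl rfl) ((z.models_lin _).crossMul (z.models_lin _) (z.models_lin _)
    (z.models_lin _) rfl rfl rfl rfl) ((z.models_lin _).crossMul (z.models_lin _)
    (z.models_lin _) (z.models_lin _) rfl rfl rfl rfl)

theorem Model.Models.ne_zero {f : Model} {F : (Fin 4 → ℝ) → ℝ} (hf : f.Models F)
    (h : f.nonzero) {u : Fin 4 → ℝ} (hu : ‖u‖ ≤ 1) : F u ≠ 0 := by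
  intro h₀
  have h₁ := hf.abs_sub_le hu
  rw [h₀, zero_sub, abs_neg, ← SInt.cast_abs] at h₁
  have h₂ : f.lip < f.c.abs := by simpa [nonzero, Nat.blt_eq] using h
  have h₃ : (f.lip : ℝ) < f.c.abs := by exact_mod_cast h₂
  rw [cast_lip] at h₃
  simp [Fin.sum_univ_four] at h₁
  linarith

namespace Model₄

theorem rowTest_iff (f g h k : Model₄) (D a b c d : SInt) : f.rowTest g h k D a b c d ↔
    |(a.val * f.c.val + b.val * g.c.val + c.val * h.c.val + d.val * k.c.val : ℝ)| +
      (|(a.val : ℝ)| * f.e + |(b.val : ℝ)| * g.e + |(c.val : ℝ)| * h.e + |(d.val : ℝ)| * k.e) <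
        |(D.val : ℝ)| := by
  rw [rowTest, Nat.blt_eq, ← Nat.cast_lt (α := ℝ)]
  simp [SInt.cast_abs, add_assoc]

theorem exists_zero_of_rowTest {f g h k : Model₄} {F G H K : (Fin 4 → ℝ) → ℝ} (hf : f.Models F)
    (hg : g.Models G) (hh : h.Models H) (hk : k.Models K)
    {D a₀ a₁ a₂ a₃ b₀ b₁ b₂ b₃ c₀ c₁ c₂ c₃ d₀ d₁ d₂ d₃ : SInt}
    (h₁ : f.rowTest g h k D a₀ a₁ a₂ a₃) (h₂ : f.rowTest g h k D b₀ b₁ b₂ b₃)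
    (h₃ : f.rowTest g h k D c₀ c₁ c₂ c₃) (h₄ : f.rowTest g h k D d₀ d₁ d₂ d₃)
    (hP : !![(a₀.val : ℝ), a₁.val, a₂.val, a₃.val; b₀.val, b₁.val, b₂.val, b₃.val;
        c₀.val, c₁.val, c₂.val, c₃.val; d₀.val, d₁.val, d₂.val, d₃.val] *
      !![(f.l₀.val : ℝ), f.l₁.val, f.l₂.val, f.l₃.val; g.l₀.val, g.l₁.val, g.l₂.val, g.l₃.val;
        h.l₀.val, h.l₁.val, h.l₂.val, h.l₃.val; k.l₀.val, k.l₁.val, k.l₂.val, k.l₃.val] =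
      (D.val : ℝ) • 1) :
    ∃ u, ‖u‖ ≤ 1 ∧ F u = 0 ∧ G u = 0 ∧ H u = 0 ∧ K u = 0 := by
  rw [rowTest_iff] at h₁ h₂ h₃ h₄
  obtain ⟨u, hu, h₀⟩ := exists_zero_of_approx (F := fun u => ![F u, G u, H u, K u])
    (c := ![(f.c.val : ℝ), g.c.val, h.c.val, k.c.val]) (e := ![(f.e : ℝ), g.e, h.e, k.e])
    (fun j => by fin_cases j <;> assumption) hP (fun i => by
      fin_cases i
      · simpa [Matrix.mulVec, dotProduct, Fin.sum_univ_four] using h₁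
      · simpa [Matrix.mulVec, dotProduct, Fin.sum_univ_four] using h₂
      · simpa [Matrix.mulVec, dotProduct, Fin.sum_univ_four] using h₃
      · simpa [Matrix.mulVec, dotProduct, Fin.sum_univ_four] using h₄)
  exact ⟨u, hu, congrFun h₀ 0, congrFun h₀ 1, congrFun h₀ 2, congrFun h₀ 3⟩

theorem exists_zero {f g h k : Model₄} {F G H K : (Fin 4 → ℝ) → ℝ} (hf : f.Models F)
    (hg : g.Models G) (hh : h.Models H) (hk : k.Models K) (ht : f.newton g h k) :
    ∃ u, ‖u‖ ≤ 1 ∧ F u = 0 ∧ G u = 0 ∧ H u = 0 ∧ K u = 0 := by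
  simp only [newton, Bool.and_eq_true] at ht
  obtain ⟨⟨⟨h₁, h₂⟩, h₃⟩, h₄⟩ := ht
  refine exists_zero_of_rowTest hf hg hh hk h₁ h₂ h₃ h₄ ?_
  ext i j
  fin_cases i <;> fin_cases j <;> simp [Matrix.mul_apply, Fin.sum_univ_four] <;> ring

end Model₄

namespace Split

theorem exists_of_existsTest {s : Split} {v : Box × Box} (h : s.existsTest v) :
    ∃ u : Fin 4 → ℝ, ‖u‖ ≤ 1 ∧
      (∀ a ∈ [s.a₁, s.a₂, s.a₃, s.a₄], (v.2.point (u 2) (u 3)).det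
        ⟨(s.n₁.phi a).eval (v.1.point (u 0) (u 1)), (s.n₂.phi a).eval (v.1.point (u 0) (u 1)),
          (s.n₃.phi a).eval (v.1.point (u 0) (u 1))⟩
        ⟨(s.n₁.psi a).eval (v.1.point (u 0) (u 1)), (s.n₂.psi a).eval (v.1.point (u 0) (u 1)),
          (s.n₃.psi a).eval (v.1.point (u 0) (u 1))⟩ = 0) ∧
      (Node.indep s.n₁ s.n₂ s.n₃).eval (v.1.point (u 0) (u 1)) ≠ 0 ∧
      (Node.indep s.n₂ s.n₁ s.n₃).eval (v.1.point (u 0) (u 1)) ≠ 0 ∧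
      (Node.indep s.n₃ s.n₁ s.n₂).eval (v.1.point (u 0) (u 1)) ≠ 0 ∧
      ¬((v.2.point (u 2) (u 3)).x = 0 ∧ (v.2.point (u 2) (u 3)).y = 0 ∧
        (v.2.point (u 2) (u 3)).z = 0) := by
  simp only [existsTest, Bool.and_eq_true] at h
  obtain ⟨hn, ⟨⟨h₁, h₂⟩, h₃⟩, hp⟩ := h
  obtain ⟨u, hu, h⟩ := Model₄.exists_zero (incidence_models _ _ _ _ _ _)
    (incidence_models _ _ _ _ _ _) (incidence_models _ _ _ _ _ _) (incidence_models _ _ _ _ _ _) hn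
  refine ⟨u, hu, by simpa using h, (v.1.models_lin _).ne_zero h₁ hu,
    (v.1.models_lin _).ne_zero h₂ hu, (v.1.models_lin _).ne_zero h₃ hu,
    Box.point_ne_zero hp _ _⟩

theorem ne_zero_of_sepTest {s : Split} {v w : Box × Box} (h : s.sepTest v w) {t u : Fin 4 → ℝ}
    (ht : ‖t‖ ≤ 1) (hu : ‖u‖ ≤ 1) :
    s.n₁.eval.eval (v.1.point (t 0) (t 1)) * s.n₁.deriv.eval (w.1.point (u 0) (u 1)) -
      s.n₁.deriv.eval (v.1.point (t 0) (t 1)) * s.n₁.eval.eval (w.1.point (u 0) (u 1)) ≠ 0 := by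
  have key (x : Box) (r : Triple SInt) {y : Fin 4 → ℝ} (hy : ‖y‖ ≤ 1) :
      |r.eval (x.point (y 0) (y 1)) - (x.lin r).c.val| ≤ (x.lin r).lip := by
    have h := (x.models_lin r).abs_sub_le hy
    simpa [Fin.sum_univ_four, Model.cast_lip] using h
  have h₁ := key v.1 s.n₁.eval ht
  have h₂ := key v.1 s.n₁.deriv ht
  have h₃ := key w.1 s.n₁.eval hu
  have h₄ := key w.1 s.n₁.deriv hu
  rw [sepTest, Nat.blt_eq, ← Nat.cast_lt (α := ℝ)] at h
  simp only [Nat.add_eq, Nat.mul_eq, Nat.cast_add, Nat.cast_mul, SInt.cast_abs, SInt.val_sub,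
    SInt.val_mul, Int.cast_sub, Int.cast_mul] at h
  generalize s.n₁.eval.eval (v.1.point (t 0) (t 1)) = x at *
  generalize s.n₁.deriv.eval (v.1.point (t 0) (t 1)) = x' at *
  generalize s.n₁.eval.eval (w.1.point (u 0) (u 1)) = y at *
  generalize s.n₁.deriv.eval (w.1.point (u 0) (u 1)) = y' at *
  generalize ((v.1.lin s.n₁.eval).c.val : ℝ) = c at *
  generalize ((v.1.lin s.n₁.deriv).c.val : ℝ) = c' at *
  generalize ((w.1.lin s.n₁.eval).c.val : ℝ) = d at *
  generalize ((w.1.lin s.n₁.deriv).c.val : ℝ) = d' at *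
  generalize ((v.1.lin s.n₁.eval).lip : ℝ) = l at *
  generalize ((v.1.lin s.n₁.deriv).lip : ℝ) = l' at *
  generalize ((w.1.lin s.n₁.eval).lip : ℝ) = m at *
  generalize ((w.1.lin s.n₁.deriv).lip : ℝ) = m' at *
  intro h₀
  have h₅ (a b p q r t : ℝ) (ha : |a - p| ≤ r) (hb : |b - q| ≤ t) :
      |a * b - p * q| ≤ |p| * t + r * |q| + r * t := by
    rw [show a * b - p * q = p * (b - q) + (a - p) * q + (a - p) * (b - q) by ring]
    refine (abs_add_three _ _ _).trans ?_
    rw [abs_mul, abs_mul, abs_mul]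
    have := (abs_nonneg _).trans ha
    gcongr
  have h₆ := h₅ _ _ _ _ _ _ h₁ h₄
  have h₇ := h₅ _ _ _ _ _ _ h₂ h₃
  have h₈ := abs_sub (x * y' - c * d') (x' * y - c' * d)
  rw [show x * y' - c * d' - (x' * y - c' * d) = -(c * d' - c' * d) by linear_combination h₀,
    abs_neg] at h₈
  linarith

theorem pairwise_of_sepTests {s : Split} {l : List (Box × Box)} (h : s.sepTests l) :
    l.Pairwise fun v w => s.sepTest v w := by
  induction l with
  | nil => exact List.Pairwise.nil
  | cons v l ih =>
    simp only [sepTests, Bool.and_eq_true, List.all_eq_true] at h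
    exact List.Pairwise.cons h.1 (ih h.2)

end Split

/-- The vector with coordinates `1, s, s², s³, s⁴` combined with its derivative. -/
def tangent {K : Type*} [CommRing K] (b α β : K) : Fin 5 → K :=
  ![α, α * b + β, α * b ^ 2 + β * (2 * b), α * b ^ 3 + β * (3 * b ^ 2),
    α * b ^ 4 + β * (4 * b ^ 3)]

/-- The functional `(x - a)³`, where `x ^ k` is the `k`-th coordinate. -/
def osc₀ {K : Type*} [CommRing K] (a : K) (v : Fin 5 → K) : K :=
  v 3 - 3 * a * v 2 + 3 * a ^ 2 * v 1 - a ^ 3 * v 0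

/-- The functional `x (x - a)³`, where `x ^ k` is the `k`-th coordinate. -/
def osc₁ {K : Type*} [CommRing K] (a : K) (v : Fin 5 → K) : K :=
  v 4 - 3 * a * v 3 + 3 * a ^ 2 * v 2 - a ^ 3 * v 1

theorem oscVec5_apply (j : ℕ) (s : ℂ) (i : Fin 5) :
    oscVec5 j s i = (i : ℕ).descFactorial j * s ^ ((i : ℕ) - j) :=
  iteratedDeriv_pow _ _

theorem oscVec5_zero (s : ℂ) : oscVec5 0 s = ![1, s, s ^ 2, s ^ 3, s ^ 4] := by
  ext i
  fin_cases i <;> simp [oscVec5_apply]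

theorem oscVec5_one (s : ℂ) : oscVec5 1 s = ![0, 1, 2 * s, 3 * s ^ 2, 4 * s ^ 3] := by
  ext i
  fin_cases i <;> simp [oscVec5_apply]

theorem oscVec5_two (s : ℂ) : oscVec5 2 s = ![0, 0, 2, 6 * s, 12 * s ^ 2] := by
  ext i
  fin_cases i <;> norm_num [oscVec5_apply, Nat.descFactorial]

theorem mem_oscF5_two (b : ℂ) (v : Fin 5 → ℂ) : v ∈ oscF5 2 b ↔ ∃ α β, v = tangent b α β := by
  rw [oscF5, Submodule.mem_span_range_iff_exists_fun]
  simp only [Fin.sum_univ_two]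
  have h (c : Fin 2 → ℂ) : c 0 • oscVec5 (0 : Fin 2) b + c 1 • oscVec5 (1 : Fin 2) b =
      tangent b (c 0) (c 1) := by
    ext i
    fin_cases i <;> simp [oscVec5_zero, oscVec5_one, tangent]
  simp only [h]
  constructor
  · rintro ⟨c, rfl⟩
    exact ⟨_, _, rfl⟩
  · rintro ⟨α, β, rfl⟩
    exact ⟨![α, β], rfl⟩

theorem mem_oscF5_three (a : ℂ) (v : Fin 5 → ℂ) :
    v ∈ oscF5 3 a ↔ osc₀ a v = 0 ∧ osc₁ a v = 0 := by
  rw [oscF5, Submodule.mem_span_range_iff_exists_fun]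
  simp only [Fin.sum_univ_three]
  constructor
  · rintro ⟨c, rfl⟩
    constructor <;> simp [oscVec5_zero, oscVec5_one, oscVec5_two, osc₀, osc₁] <;> ring
  · rintro ⟨h₀, h₁⟩
    refine ⟨![v 0, v 1 - a * v 0, (v 2 - a ^ 2 * v 0 - 2 * a * (v 1 - a * v 0)) / 2], ?_⟩
    simp only [osc₀, osc₁] at h₀ h₁
    ext i
    fin_cases i <;> simp [oscVec5_zero, oscVec5_one, oscVec5_two]
    · ring
    · ring
    · linear_combination -h₀
    · linear_combination -h₁ - 3 * a * h₀

/-- The flag of the image of `κ^⊥` under `e` in the span of `e`. -/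
def flagOf {K : Type*} [Field K] (e : Fin 3 → Fin 5 → K) (κ : Fin 3 → K) :
    Submodule K (Fin 5 → K) × Submodule K (Fin 5 → K) :=
  ((LinearMap.ker (dotProductBilin K K κ)).map (Fintype.linearCombination K e),
    Submodule.span K (Set.range e))

section flagOf

variable {K : Type*} [Field K] {e : Fin 3 → Fin 5 → K} {κ : Fin 3 → K}

theorem mem_flagOf_fst (v : Fin 5 → K) :
    v ∈ (flagOf e κ).1 ↔ ∃ d, κ ⬝ᵥ d = 0 ∧ Fintype.linearCombination K e d = v := by
  simp [flagOf]

theorem mem_flagOf_snd (v : Fin 5 → K) :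
    v ∈ (flagOf e κ).2 ↔ ∃ d, Fintype.linearCombination K e d = v := by
  rw [flagOf, ← Fintype.range_linearCombination]
  rfl

theorem flagOf_le : (flagOf e κ).1 ≤ (flagOf e κ).2 := by
  intro v
  rw [mem_flagOf_fst, mem_flagOf_snd]
  rintro ⟨d, -, h⟩
  exact ⟨d, h⟩

theorem finrank_flagOf_snd (he : LinearIndependent K e) :
    Module.finrank K (flagOf e κ).2 = 3 := by
  exact finrank_span_eq_card he

theorem finrank_flagOf_fst (he : LinearIndependent K e) (hκ : κ ≠ 0) :
    Module.finrank K (flagOf e κ).1 = 2 := by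
  have hi := linearIndependent_iff_injective_fintypeLinearCombination.1 he
  have h₀ : (dotProductBilin K K κ : Module.Dual K (Fin 3 → K)) ≠ 0 := by
    intro h
    refine hκ (funext fun i => ?_)
    simpa using LinearMap.congr_fun h (Pi.single i 1)
  have h := Module.Dual.finrank_ker_add_one_of_ne_zero h₀
  have h' := (Submodule.equivMapOfInjective _ hi (LinearMap.ker (dotProductBilin K K κ))).finrank_eq
  rw [Module.finrank_fin_fun] at h
  rw [flagOf, ← h']
  omega

theorem exists_flagOf {E F : Submodule K (Fin 5 → K)} (B : Module.Basis (Fin 3) K F)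
    (hE : Module.finrank K E = 2) (h : E ≤ F) :
    ∃ κ ≠ 0, (E, F) = flagOf (fun i => (B i : Fin 5 → K)) κ := by
  have he : LinearIndependent K (fun i => (B i : Fin 5 → K)) :=
    B.linearIndependent.map' F.subtype F.ker_subtype
  have hs : Submodule.span K (Set.range fun i => (B i : Fin 5 → K)) = F := by
    have := congrArg (Submodule.map F.subtype) B.span_eq
    rwa [Submodule.map_span, Submodule.map_top, Submodule.range_subtype, ← Set.range_comp] at this
  have hlt : E.comap F.subtype < ⊤ := by
    rw [lt_top_iff_ne_top]
    intro ht
    have : F ≤ E := by simpa [Submodule.comap_subtype_eq_top] using ht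
    have := Submodule.finrank_mono this
    have := Module.finrank_eq_card_basis B
    simp only [Fintype.card_fin] at this
    omega
  obtain ⟨f, hf, hle⟩ := Submodule.exists_le_ker_of_lt_top _ hlt
  have hκ : (fun i => f (B i)) ≠ 0 := fun h => hf (B.ext fun i => congrFun h i)
  refine ⟨fun i => f (B i), hκ, ?_⟩
  have h₃ : E ≤ (flagOf (fun i => (B i : Fin 5 → K)) (fun i => f (B i))).1 := by
    intro v hv
    rw [mem_flagOf_fst]
    refine ⟨B.repr ⟨v, h hv⟩, ?_, ?_⟩
    · have h0 : f (∑ i, B.repr ⟨v, h hv⟩ i • B i) = 0 := by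
        rw [B.sum_repr]
        exact hle hv
      rw [map_sum] at h0
      simpa only [dotProduct, mul_comm, map_smul, smul_eq_mul] using h0
    · have h0 : ((∑ i, B.repr ⟨v, h hv⟩ i • B i : F) : Fin 5 → K) = v := by
        rw [B.sum_repr]
      rwa [Submodule.coe_sum] at h0
  refine Prod.ext ?_ hs.symm
  exact Submodule.eq_of_le_of_finrank_eq h₃ (by rw [hE, finrank_flagOf_fst he hκ])

theorem osc₀_linearCombination (a : K) (d : Fin 3 → K) :
    osc₀ a (Fintype.linearCombination K e d) = (fun i => osc₀ a (e i)) ⬝ᵥ d := by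
  simp [Fintype.linearCombination_apply, osc₀, dotProduct, Fin.sum_univ_three]
  ring

theorem osc₁_linearCombination (a : K) (d : Fin 3 → K) :
    osc₁ a (Fintype.linearCombination K e d) = (fun i => osc₁ a (e i)) ⬝ᵥ d := by
  simp [Fintype.linearCombination_apply, osc₁, dotProduct, Fin.sum_univ_three]
  ring

theorem exists_ne_zero_of_triple {u v w : Fin 3 → K} :
    u ⬝ᵥ (v ⨯₃ w) = 0 ↔ ∃ d ≠ 0, u ⬝ᵥ d = 0 ∧ v ⬝ᵥ d = 0 ∧ w ⬝ᵥ d = 0 := by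
  rw [triple_product_eq_det]
  refine (Matrix.exists_mulVec_eq_zero_iff
    (M := !![u 0, u 1, u 2; v 0, v 1, v 2; w 0, w 1, w 2])).symm.trans ?_
  simp only [funext_iff, Fin.forall_fin_succ (n := 2), Fin.forall_fin_two]
  rfl

end flagOf

theorem flagOf_fst_inf_oscF5_ne_bot {e : Fin 3 → Fin 5 → ℂ} {κ : Fin 3 → ℂ}
    (he : LinearIndependent ℂ e) (a : ℂ) :
    (flagOf e κ).1 ⊓ oscF5 3 a ≠ ⊥ ↔
      κ ⬝ᵥ ((fun i => osc₀ a (e i)) ⨯₃ (fun i => osc₁ a (e i))) = 0 := by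
  rw [exists_ne_zero_of_triple, Submodule.ne_bot_iff]
  have hi := linearIndependent_iff_injective_fintypeLinearCombination.1 he
  simp only [Submodule.mem_inf, mem_flagOf_fst, mem_oscF5_three]
  constructor
  · rintro ⟨_, ⟨⟨d, hd, rfl⟩, h₀, h₁⟩, hv⟩
    rw [osc₀_linearCombination] at h₀
    rw [osc₁_linearCombination] at h₁
    exact ⟨d, fun h => hv (by rw [h, map_zero]), hd, h₀, h₁⟩
  · rintro ⟨d, hd, hκ, h₀, h₁⟩
    refine ⟨_, ⟨⟨d, hκ, rfl⟩, ?_, ?_⟩, ?_⟩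
    · rwa [osc₀_linearCombination]
    · rwa [osc₁_linearCombination]
    · rw [← map_zero (Fintype.linearCombination ℂ e)]
      exact hi.ne hd

/-- The functional `(x - b)² (x - c)²`, where `x ^ k` is the `k`-th coordinate. -/
def square {K : Type*} [CommRing K] (b c : K) (v : Fin 5 → K) : K :=
  v 4 - 2 * (b + c) * v 3 + (b ^ 2 + 4 * b * c + c ^ 2) * v 2 - 2 * b * c * (b + c) * v 1 +
    b ^ 2 * c ^ 2 * v 0

theorem square_comm {K : Type*} [CommRing K] (b c : K) (v : Fin 5 → K) :
    square b c v = square c b v := by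
  simp only [square]
  ring

theorem square_tangent {K : Type*} [CommRing K] (b c d α β : K) :
    square b c (tangent d α β) =
      (d - b) * (d - c) * ((d - b) * (d - c) * α + 2 * ((d - b) + (d - c)) * β) := by
  simp [square, tangent]
  ring

/-- A quadratic polynomial multiplied by `x ^ m`. -/
def Triple.mulPow {K : Type*} [CommRing K] (z : Triple K) (m : ℕ) (x : K) : K :=
  x ^ m * (z.x + z.y * x + z.z * x ^ 2)

/-- The derivative of `Triple.mulPow`. -/
def Triple.mulPowDeriv {K : Type*} [CommRing K] (z : Triple K) (m : ℕ) (x : K) : K :=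
  m * x ^ (m - 1) * (z.x + z.y * x + z.z * x ^ 2) + x ^ m * (z.y + 2 * z.z * x)

/-- The sum of the residues of `H / P ^ 2` vanishes, where `P` has the roots `a, b, c, d`
and `H` has degree at most six. -/
theorem sum_residue_eq_zero {K : Type*} [CommRing K] (a b c d : K) (z : Triple K) (m : Fin 5) :
    ((b - c) * (b - d) * (c - d)) ^ 3 * ((a - b) * (a - c) * (a - d) * z.mulPowDeriv m a -
      2 * ((a - b) * (a - c) + (a - b) * (a - d) + (a - c) * (a - d)) * z.mulPow m a) -
    ((a - c) * (a - d) * (c - d)) ^ 3 * ((b - a) * (b - c) * (b - d) * z.mulPowDeriv m b -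
      2 * ((b - a) * (b - c) + (b - a) * (b - d) + (b - c) * (b - d)) * z.mulPow m b) +
    ((a - b) * (a - d) * (b - d)) ^ 3 * ((c - a) * (c - b) * (c - d) * z.mulPowDeriv m c -
      2 * ((c - a) * (c - b) + (c - a) * (c - d) + (c - b) * (c - d)) * z.mulPow m c) -
    ((a - b) * (a - c) * (b - c)) ^ 3 * ((d - a) * (d - b) * (d - c) * z.mulPowDeriv m d -
      2 * ((d - a) * (d - b) + (d - a) * (d - c) + (d - b) * (d - c)) * z.mulPow m d) = 0 := by
  fin_cases m <;> simp only [Triple.mulPow, Triple.mulPowDeriv] <;> norm_num <;> ring_nf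

/-- The vector in the tangent line at a node that is determined by a quadratic polynomial. -/
def Node.vec {K : Type*} [CommRing K] (n : Node) (z : Triple K) : Fin 5 → K :=
  tangent (n.b.val : K) (n.alpha.eval z) (n.beta.eval z)

namespace Node

variable {K : Type*} [CommRing K]

theorem osc₀_vec (n : Node) (z : Triple K) (a : ℕ) :
    osc₀ (a : K) (n.vec z) = (n.phi a).eval z := by
  simp [osc₀, vec, tangent, phi]
  ring

theorem osc₁_vec (n : Node) (z : Triple K) (a : ℕ) :
    osc₁ (a : K) (n.vec z) = (n.psi a).eval z := by
  simp [osc₁, vec, tangent, psi, phi]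
  ring

theorem square_vec (n m k : Node) (z : Triple K) : square (m.b.val : K) k.b.val (n.vec z) =
    (n.b.val - m.b.val) * (n.b.val - k.b.val) * (n.indep m k).eval z := by
  simp [vec, square_tangent, indep]

theorem square_vec_self (n m : Node) (z : Triple K) :
    square (n.b.val : K) m.b.val (n.vec z) = 0 := by
  simp [vec, square_tangent]

theorem square_vec_self' (n m : Node) (z : Triple K) :
    square (m.b.val : K) n.b.val (n.vec z) = 0 := by
  simp [vec, square_tangent]

theorem val_b_of (b c d e : ℕ) : (Node.of b c d e).b.val = b := by
  simp [of]

theorem vec_of (a b c d : ℕ) (z : Triple K) (i : Fin 5) : (of a b c d).vec z i =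
    ((a : K) - b) * (a - c) * (a - d) * z.mulPowDeriv i a -
      2 * (((a : K) - b) * (a - c) + (a - b) * (a - d) + (a - c) * (a - d)) * z.mulPow i a := by
  fin_cases i <;> simp [vec, tangent, alpha, beta, Triple.mulPow, Triple.mulPowDeriv] <;>
    simp [of, eval, deriv, Triple.eval] <;> ring

theorem sum_vec_eq_zero (a b c d : ℕ) (z : Triple K) :
    (((b : K) - c) * (b - d) * (c - d)) ^ 3 • (of a b c d).vec z -
    (((a : K) - c) * (a - d) * (c - d)) ^ 3 • (of b a c d).vec z +
    (((a : K) - b) * (a - d) * (b - d)) ^ 3 • (of c a b d).vec z -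
    (((a : K) - b) * (a - c) * (b - c)) ^ 3 • (of d a b c).vec z = 0 := by
  ext i
  simpa only [Pi.add_apply, Pi.sub_apply, Pi.smul_apply, Pi.zero_apply, smul_eq_mul, vec_of] using
    sum_residue_eq_zero (a : K) b c d z i

end Node

namespace Split

/-- The flags that satisfy the incidence conditions of a splitting. -/
def IsSol (s : Split) (p : Submodule ℂ (Fin 5 → ℂ) × Submodule ℂ (Fin 5 → ℂ)) : Prop :=
  Module.finrank ℂ p.1 = 2 ∧ Module.finrank ℂ p.2 = 3 ∧ p.1 ≤ p.2 ∧
    (∀ a ∈ [s.a₁, s.a₂, s.a₃, s.a₄], p.1 ⊓ oscF5 3 (a : ℂ) ≠ ⊥) ∧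
    ∀ b ∈ [s.b₁, s.b₂, s.b₃, s.b₄], p.2 ⊓ oscF5 2 (b : ℂ) ≠ ⊥

/-- The fourth node. -/
def n₄ (s : Split) : Node := .of s.b₄ s.b₁ s.b₂ s.b₃

end Split

/-- The complex vector with the given real coordinates. -/
def Triple.toComplex (z : Triple ℝ) : Triple ℂ := ⟨z.x, z.y, z.z⟩

theorem Triple.eval_toComplex (t : Triple SInt) (z : Triple ℝ) :
    t.eval z.toComplex = (t.eval z : ℝ) := by
  simp [Triple.eval, Triple.toComplex]

theorem Node.conj_vec (n : Node) (z : Triple ℝ) (i : Fin 5) :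
    starRingEnd ℂ (n.vec z.toComplex i) = n.vec z.toComplex i := by
  fin_cases i <;> simp [Node.vec, tangent, Triple.eval_toComplex, map_ofNat]

theorem conjStable5_flagOf {e : Fin 3 → Fin 5 → ℂ} {κ : Fin 3 → ℂ}
    (he : ∀ i j, starRingEnd ℂ (e i j) = e i j) (hκ : ∀ i, starRingEnd ℂ (κ i) = κ i) :
    conjStable5 (flagOf e κ).1 ∧ conjStable5 (flagOf e κ).2 := by
  have key (d : Fin 3 → ℂ) : (fun i => starRingEnd ℂ (Fintype.linearCombination ℂ e d i)) =
      Fintype.linearCombination ℂ e fun i => starRingEnd ℂ (d i) := by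
    ext i
    simp [Fintype.linearCombination_apply, he]
  constructor
  · intro v hv
    rw [mem_flagOf_fst] at hv ⊢
    obtain ⟨d, hd, rfl⟩ := hv
    refine ⟨_, ?_, (key d).symm⟩
    have := congrArg (starRingEnd ℂ) hd
    simpa [dotProduct, hκ] using this
  · intro v hv
    rw [mem_flagOf_snd] at hv ⊢
    obtain ⟨d, rfl⟩ := hv
    exact ⟨_, (key d).symm⟩

/-- The three vectors at the first three nodes that are determined by a quadratic polynomial. -/
def Split.vecs (s : Split) (z : Triple ℂ) : Fin 3 → Fin 5 → ℂ :=
  ![s.n₁.vec z, s.n₂.vec z, s.n₃.vec z]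

namespace Split

/-- A quadratic polynomial whose vectors at the first three nodes are linearly independent. -/
def IsIndep (s : Split) (z : Triple ℂ) : Prop :=
  (Node.indep s.n₁ s.n₂ s.n₃).eval z ≠ 0 ∧ (Node.indep s.n₂ s.n₁ s.n₃).eval z ≠ 0 ∧
    (Node.indep s.n₃ s.n₁ s.n₂).eval z ≠ 0

variable {s : Split} {z : Triple ℂ}

theorem linearCombination_vecs (d : Fin 3 → ℂ) : Fintype.linearCombination ℂ (s.vecs z) d =
    d 0 • s.n₁.vec z + d 1 • s.n₂.vec z + d 2 • s.n₃.vec z := by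
  simp [Fintype.linearCombination_apply, vecs, Fin.sum_univ_three]

theorem square_linearCombination {K : Type*} [CommRing K] (b c x y t : K) (u v w : Fin 5 → K) :
    square b c (x • u + y • v + t • w) =
      x * square b c u + y * square b c v + t * square b c w := by
  simp [square]
  ring

theorem b_n₁ : s.n₁.b.val = s.b₁ := Node.val_b_of _ _ _ _

theorem b_n₂ : s.n₂.b.val = s.b₂ := Node.val_b_of _ _ _ _

theorem b_n₃ : s.n₃.b.val = s.b₃ := Node.val_b_of _ _ _ _

theorem cast_sub_ne_zero {m n : ℕ} (h : m ≠ n) : (m : ℂ) - n ≠ 0 :=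
  sub_ne_zero.2 (Nat.cast_injective.ne h)

theorem square₂₃ (d : Fin 3 → ℂ) :
    square (s.b₂ : ℂ) s.b₃ (Fintype.linearCombination ℂ (s.vecs z) d) =
      d 0 * (((s.b₁ : ℂ) - s.b₂) * (s.b₁ - s.b₃) * (Node.indep s.n₁ s.n₂ s.n₃).eval z) := by
  have h₁ := s.n₁.square_vec s.n₂ s.n₃ z
  have h₂ := s.n₂.square_vec_self s.n₃ z
  have h₃ := s.n₃.square_vec_self' s.n₂ z
  simp only [b_n₁, b_n₂, b_n₃, Int.cast_natCast] at h₁ h₂ h₃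
  rw [linearCombination_vecs, square_linearCombination, h₁, h₂, h₃]
  ring

theorem square₁₃ (d : Fin 3 → ℂ) :
    square (s.b₁ : ℂ) s.b₃ (Fintype.linearCombination ℂ (s.vecs z) d) =
      d 1 * (((s.b₂ : ℂ) - s.b₁) * (s.b₂ - s.b₃) * (Node.indep s.n₂ s.n₁ s.n₃).eval z) := by
  have h₁ := s.n₁.square_vec_self s.n₃ z
  have h₂ := s.n₂.square_vec s.n₁ s.n₃ z
  have h₃ := s.n₃.square_vec_self' s.n₁ z
  simp only [b_n₁, b_n₂, b_n₃, Int.cast_natCast] at h₁ h₂ h₃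
  rw [linearCombination_vecs, square_linearCombination, h₁, h₂, h₃]
  ring

theorem square₁₂ (d : Fin 3 → ℂ) :
    square (s.b₁ : ℂ) s.b₂ (Fintype.linearCombination ℂ (s.vecs z) d) =
      d 2 * (((s.b₃ : ℂ) - s.b₁) * (s.b₃ - s.b₂) * (Node.indep s.n₃ s.n₁ s.n₂).eval z) := by
  have h₁ := s.n₁.square_vec_self s.n₂ z
  have h₂ := s.n₂.square_vec_self' s.n₁ z
  have h₃ := s.n₃.square_vec s.n₁ s.n₂ z
  simp only [b_n₁, b_n₂, b_n₃, Int.cast_natCast] at h₁ h₂ h₃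
  rw [linearCombination_vecs, square_linearCombination, h₁, h₂, h₃]
  ring

/-- The second set of points of a splitting has four elements. -/
def DistinctB (s : Split) : Prop := [s.b₁, s.b₂, s.b₃, s.b₄].Nodup

theorem DistinctB.ne (h : s.DistinctB) : (s.b₁ ≠ s.b₂ ∧ s.b₁ ≠ s.b₃ ∧ s.b₁ ≠ s.b₄) ∧
    (s.b₂ ≠ s.b₃ ∧ s.b₂ ≠ s.b₄) ∧ s.b₃ ≠ s.b₄ := by
  simpa [DistinctB] using h

theorem linearIndependent_vecs (hb : s.DistinctB) (hz : s.IsIndep z) :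
    LinearIndependent ℂ (s.vecs z) := by
  obtain ⟨⟨h₁₂, h₁₃, -⟩, ⟨h₂₃, -⟩, -⟩ := hb.ne
  rw [linearIndependent_iff_injective_fintypeLinearCombination,
    injective_iff_map_eq_zero]
  intro d hd
  have h₁ := square₂₃ (s := s) (z := z) d
  have h₂ := square₁₃ (s := s) (z := z) d
  have h₃ := square₁₂ (s := s) (z := z) d
  rw [hd] at h₁ h₂ h₃
  simp [square, hz.1, hz.2.1, hz.2.2, cast_sub_ne_zero h₁₂, cast_sub_ne_zero h₁₂.symm,
    cast_sub_ne_zero h₁₃, cast_sub_ne_zero h₁₃.symm, cast_sub_ne_zero h₂₃,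
    cast_sub_ne_zero h₂₃.symm] at h₁ h₂ h₃
  ext i
  fin_cases i <;> assumption

theorem parallel_of_tangent_mem (hb : s.DistinctB) (hz : s.IsIndep z) {κ : Fin 3 → ℂ} {α β : ℂ}
    (h : tangent (s.b₁ : ℂ) α β ∈ (flagOf (s.vecs z) κ).2) :
    α * s.n₁.beta.eval z = β * s.n₁.alpha.eval z := by
  obtain ⟨⟨h₁₂, h₁₃, -⟩, ⟨h₂₃, -⟩, -⟩ := hb.ne
  obtain ⟨d, hd⟩ := (mem_flagOf_snd _).1 h
  have h₂ := square₁₃ (s := s) (z := z) d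
  have h₃ := square₁₂ (s := s) (z := z) d
  rw [hd] at h₂ h₃
  simp [square_tangent, hz.2.1, hz.2.2, cast_sub_ne_zero h₁₂.symm,
    cast_sub_ne_zero h₁₃.symm, cast_sub_ne_zero h₂₃, cast_sub_ne_zero h₂₃.symm] at h₂ h₃
  rw [linearCombination_vecs, h₂, h₃] at hd
  have e₀ := congrFun hd 0
  have e₁ := congrFun hd 1
  simp [Node.vec, tangent, b_n₁] at e₀ e₁
  rw [← e₀] at e₁ ⊢
  linear_combination s.n₁.alpha.eval z * e₁

theorem vec_mem_flagOf (hb : s.DistinctB) (κ : Fin 3 → ℂ) :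
    s.n₁.vec z ∈ (flagOf (s.vecs z) κ).2 ∧ s.n₂.vec z ∈ (flagOf (s.vecs z) κ).2 ∧
      s.n₃.vec z ∈ (flagOf (s.vecs z) κ).2 ∧ s.n₄.vec z ∈ (flagOf (s.vecs z) κ).2 := by
  have h₁ : s.n₁.vec z ∈ (flagOf (s.vecs z) κ).2 := Submodule.subset_span ⟨0, rfl⟩
  have h₂ : s.n₂.vec z ∈ (flagOf (s.vecs z) κ).2 := Submodule.subset_span ⟨1, rfl⟩
  have h₃ : s.n₃.vec z ∈ (flagOf (s.vecs z) κ).2 := Submodule.subset_span ⟨2, rfl⟩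
  refine ⟨h₁, h₂, h₃, ?_⟩
  obtain ⟨⟨h₁₂, h₁₃, -⟩, ⟨h₂₃, -⟩, -⟩ := hb.ne
  have h₀ : (((s.b₁ : ℂ) - s.b₂) * (s.b₁ - s.b₃) * (s.b₂ - s.b₃)) ^ 3 ≠ 0 := by
    simp [cast_sub_ne_zero h₁₂, cast_sub_ne_zero h₁₃, cast_sub_ne_zero h₂₃]
  rw [← Submodule.smul_mem_iff _ h₀]
  have h := sub_eq_zero.1 (Node.sum_vec_eq_zero s.b₁ s.b₂ s.b₃ s.b₄ z)
  rw [n₄, ← h]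
  exact add_mem (sub_mem (Submodule.smul_mem _ _ h₁) (Submodule.smul_mem _ _ h₂))
    (Submodule.smul_mem _ _ h₃)

end Split

namespace Split

variable {s : Split} {z : Triple ℂ}

theorem vec_ne_zero (hb : s.DistinctB) (hz : s.IsIndep z) :
    s.n₁.vec z ≠ 0 ∧ s.n₂.vec z ≠ 0 ∧ s.n₃.vec z ≠ 0 ∧ s.n₄.vec z ≠ 0 := by
  have hi := linearIndependent_vecs hb hz
  refine ⟨hi.ne_zero 0, hi.ne_zero 1, hi.ne_zero 2, fun h₄ => ?_⟩
  obtain ⟨-, ⟨h₂₃, h₂₄⟩, h₃₄⟩ := hb.ne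
  have h := Node.sum_vec_eq_zero s.b₁ s.b₂ s.b₃ s.b₄ z
  rw [n₄] at h₄
  rw [h₄, smul_zero, sub_zero] at h
  rw [linearIndependent_iff_injective_fintypeLinearCombination,
    injective_iff_map_eq_zero] at hi
  have := hi ![(((s.b₂ : ℂ) - s.b₃) * (s.b₂ - s.b₄) * (s.b₃ - s.b₄)) ^ 3,
    -(((s.b₁ : ℂ) - s.b₃) * (s.b₁ - s.b₄) * (s.b₃ - s.b₄)) ^ 3,
    (((s.b₁ : ℂ) - s.b₂) * (s.b₁ - s.b₄) * (s.b₂ - s.b₄)) ^ 3] (by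
      rw [linearCombination_vecs, ← h]
      simp only [Matrix.cons_val, neg_smul, ← sub_eq_add_neg]
      rfl)
  simpa [cast_sub_ne_zero h₂₃, cast_sub_ne_zero h₂₄, cast_sub_ne_zero h₃₄] using congrFun this 0

theorem isSol_flagOf (hb : s.DistinctB) (hz : s.IsIndep z) {κ : Fin 3 → ℂ} (hκ : κ ≠ 0)
    (h : ∀ a ∈ [s.a₁, s.a₂, s.a₃, s.a₄], κ ⬝ᵥ ((fun i => osc₀ (a : ℂ) (s.vecs z i)) ⨯₃
      (fun i => osc₁ (a : ℂ) (s.vecs z i))) = 0) : s.IsSol (flagOf (s.vecs z) κ) := by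
  have hi := linearIndependent_vecs hb hz
  refine ⟨finrank_flagOf_fst hi hκ, finrank_flagOf_snd hi, flagOf_le,
    fun a ha => (flagOf_fst_inf_oscF5_ne_bot hi _).2 (h a ha), ?_⟩
  have key (n : Node) (h : n.vec z ∈ (flagOf (s.vecs z) κ).2) (h₀ : n.vec z ≠ 0) :
      (flagOf (s.vecs z) κ).2 ⊓ oscF5 2 n.b.val ≠ ⊥ :=
    (Submodule.ne_bot_iff _).2
      ⟨_, ⟨h, (mem_oscF5_two _ _).2 ⟨_, _, rfl⟩⟩, h₀⟩
  obtain ⟨h₁, h₂, h₃, h₄⟩ := vec_mem_flagOf (z := z) hb κ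
  obtain ⟨h₁', h₂', h₃', h₄'⟩ := vec_ne_zero hb hz
  have hb₄ : s.n₄.b.val = s.b₄ := Node.val_b_of _ _ _ _
  have k₁ := key _ h₁ h₁'
  have k₂ := key _ h₂ h₂'
  have k₃ := key _ h₃ h₃'
  have k₄ := key _ h₄ h₄'
  rw [b_n₁] at k₁
  rw [b_n₂] at k₂
  rw [b_n₃] at k₃
  rw [hb₄] at k₄
  simpa using ⟨k₁, k₂, k₃, k₄⟩

/-- The direction in the tangent line at the first node is determined by a point of the box. -/
def Near (s : Split) (v : Box × Box)
    (p : Submodule ℂ (Fin 5 → ℂ) × Submodule ℂ (Fin 5 → ℂ)) : Prop :=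
  ∃ u : Fin 4 → ℝ, ‖u‖ ≤ 1 ∧ s.n₁.vec (v.1.point (u 0) (u 1)).toComplex ∈ p.2 ∧
    ∀ α β, tangent (s.b₁ : ℂ) α β ∈ p.2 →
      α * s.n₁.beta.eval (v.1.point (u 0) (u 1)).toComplex =
        β * s.n₁.alpha.eval (v.1.point (u 0) (u 1)).toComplex

theorem exists_isSol (hb : s.DistinctB) {v : Box × Box} (h : s.existsTest v) :
    ∃ p, s.IsSol p ∧ (conjStable5 p.1 ∧ conjStable5 p.2) ∧ s.Near v p := by
  obtain ⟨u, hu, h₁, h₂, h₃, h₄, hκ⟩ := exists_of_existsTest h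
  set z := v.1.point (u 0) (u 1)
  set k := v.2.point (u 2) (u 3)
  have hz : s.IsIndep z.toComplex := by
    simp only [IsIndep, Triple.eval_toComplex]
    exact ⟨by exact_mod_cast h₂, by exact_mod_cast h₃, by exact_mod_cast h₄⟩
  refine ⟨flagOf (s.vecs z.toComplex) ![(k.x : ℂ), k.y, k.z], isSol_flagOf hb hz ?_ ?_,
    conjStable5_flagOf ?_ ?_, u, hu, (vec_mem_flagOf hb _).1,
    fun α β => parallel_of_tangent_mem hb hz⟩
  · intro h
    have e₀ := congrFun h 0
    have e₁ := congrFun h 1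
    have e₂ := congrFun h 2
    simp at e₀ e₁ e₂
    exact hκ ⟨e₀, e₁, e₂⟩
  · intro a ha
    have := congrArg (Complex.ofReal) (h₁ a ha)
    simp only [Triple.det] at this
    simp [cross_apply, vecs, Node.osc₀_vec, Node.osc₁_vec, Triple.eval_toComplex]
    push_cast at this
    linear_combination this
  · intro i j
    fin_cases i <;> exact Node.conj_vec _ _ _
  · intro i
    fin_cases i <;> simp

theorem not_near_of_sepTest (hb : s.DistinctB) {v w : Box × Box} (h : s.sepTest v w)
    {p : Submodule ℂ (Fin 5 → ℂ) × Submodule ℂ (Fin 5 → ℂ)} (hv : s.Near v p) :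
    ¬s.Near w p := by
  rintro ⟨t, ht, hw, -⟩
  obtain ⟨u, hu, -, hv⟩ := hv
  have h₀ := ne_zero_of_sepTest h hu ht
  rw [Node.vec, b_n₁, Int.cast_natCast] at hw
  have h₁ := hv _ _ hw
  simp only [Triple.eval_toComplex] at h₁
  norm_cast at h₁
  simp only [Node.alpha, Node.beta, Triple.eval_comb] at h₁
  obtain ⟨⟨h₁₂, h₁₃, h₁₄⟩, -, -⟩ := hb.ne
  have hp : ((s.n₁.p.val : ℤ) : ℝ) ≠ 0 := by
    simp [n₁, Node.of, sub_eq_zero, h₁₂, h₁₃, h₁₄]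
  have h₂ := mul_ne_zero (mul_ne_zero hp hp) h₀
  apply h₂
  simp at h₁
  linear_combination h₁

theorem exists_of_lowerTest (hb : s.DistinctB) (h : s.lowerTest) :
    ∃ f : Fin 12 → Submodule ℂ (Fin 5 → ℂ) × Submodule ℂ (Fin 5 → ℂ), Function.Injective f ∧
      ∀ i, s.IsSol (f i) ∧ conjStable5 (f i).1 ∧ conjStable5 (f i).2 := by
  simp only [lowerTest, Bool.and_eq_true, beq_iff_eq, List.all_eq_true] at h
  obtain ⟨⟨hl, he⟩, hs⟩ := h
  have hp := List.pairwise_iff_getElem.1 (pairwise_of_sepTests hs)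
  have he (i : Fin 12) := exists_isSol hb (he (s.sols[i]'(by omega)) (List.getElem_mem _))
  choose f hf using he
  refine ⟨f, ?_, fun i => ⟨(hf i).1, (hf i).2.1⟩⟩
  intro i j hij
  by_contra hne
  wlog hlt : i < j generalizing i j
  · exact this hij.symm (Ne.symm hne) (lt_of_le_of_ne (not_lt.1 hlt) (Ne.symm hne))
  have hj := (hf j).2.2
  rw [← hij] at hj
  exact not_near_of_sepTest hb (hp i j (by omega) (by omega) hlt) (hf i).2.2 hj

end Split

/-- Coordinates of a linear functional with respect to `(x - bⱼ)² (x - bₖ)²`, where `jk` is one of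
`12`, `13`, `14`, `23`, `24`. -/
structure Quint (R : Type*) where
  t₁₂ : R
  t₁₃ : R
  t₁₄ : R
  t₂₃ : R
  t₂₄ : R

/-- A linear form in six variables. -/
structure Form where
  c₀ : SInt
  c₁ : SInt
  c₂ : SInt
  c₃ : SInt
  c₄ : SInt
  c₅ : SInt

namespace Form

/-- The determinant with rows `(a, b, c)`, `(d, e, f)`, `(g, h, i)`. -/
def det₃ (a b c d e f g h i : SInt) : SInt :=
  SInt.alt₃ a b c (Model₄.minor e f h i) (Model₄.minor d f g i) (Model₄.minor d e g h)

/-- The value of an alternating trilinear form at three functionals, as a linear form in the values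
`(12,13,24)`, `(12,14,23)`, `(13,14,23)`, `(13,14,24)`, `(13,23,24)`, `(14,23,24)`. -/
def ofTriple (f g h : Quint SInt) : Form :=
  let m₀ := det₃ f.t₁₂ f.t₁₃ f.t₂₃ g.t₁₂ g.t₁₃ g.t₂₃ h.t₁₂ h.t₁₃ h.t₂₃
  let m₁ := det₃ f.t₁₂ f.t₁₄ f.t₂₄ g.t₁₂ g.t₁₄ g.t₂₄ h.t₁₂ h.t₁₄ h.t₂₄
  ⟨det₃ f.t₁₂ f.t₁₃ f.t₂₄ g.t₁₂ g.t₁₃ g.t₂₄ h.t₁₂ h.t₁₃ h.t₂₄,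
    det₃ f.t₁₂ f.t₁₄ f.t₂₃ g.t₁₂ g.t₁₄ g.t₂₃ h.t₁₂ h.t₁₄ h.t₂₃,
    (det₃ f.t₁₃ f.t₁₄ f.t₂₃ g.t₁₃ g.t₁₄ g.t₂₃ h.t₁₃ h.t₁₄ h.t₂₃).add m₀,
    (det₃ f.t₁₃ f.t₁₄ f.t₂₄ g.t₁₃ g.t₁₄ g.t₂₄ h.t₁₃ h.t₁₄ h.t₂₄).sub m₁,
    (det₃ f.t₁₃ f.t₂₃ f.t₂₄ g.t₁₃ g.t₂₃ g.t₂₄ h.t₁₃ h.t₂₃ h.t₂₄).sub m₀,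
    (det₃ f.t₁₄ f.t₂₃ f.t₂₄ g.t₁₄ g.t₂₃ g.t₂₄ h.t₁₄ h.t₂₃ h.t₂₄).add m₁⟩

/-- `a * b - c * d` as a quadratic form, the monomials being ordered lexicographically. -/
def crossMul (a b c d : Form) : List SInt :=
  let s (p q r s : SInt) := Model₄.minor p r s q
  let m (p q p' q' r s r' s' : SInt) := ((p.mul q).add (p'.mul q')).sub ((r.mul s).add (r'.mul s'))
  [s a.c₀ b.c₀ c.c₀ d.c₀, m a.c₀ b.c₁ a.c₁ b.c₀ c.c₀ d.c₁ c.c₁ d.c₀,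
    m a.c₀ b.c₂ a.c₂ b.c₀ c.c₀ d.c₂ c.c₂ d.c₀, m a.c₀ b.c₃ a.c₃ b.c₀ c.c₀ d.c₃ c.c₃ d.c₀,
    m a.c₀ b.c₄ a.c₄ b.c₀ c.c₀ d.c₄ c.c₄ d.c₀, m a.c₀ b.c₅ a.c₅ b.c₀ c.c₀ d.c₅ c.c₅ d.c₀,
    s a.c₁ b.c₁ c.c₁ d.c₁,
    m a.c₁ b.c₂ a.c₂ b.c₁ c.c₁ d.c₂ c.c₂ d.c₁, m a.c₁ b.c₃ a.c₃ b.c₁ c.c₁ d.c₃ c.c₃ d.c₁,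
    m a.c₁ b.c₄ a.c₄ b.c₁ c.c₁ d.c₄ c.c₄ d.c₁, m a.c₁ b.c₅ a.c₅ b.c₁ c.c₁ d.c₅ c.c₅ d.c₁,
    s a.c₂ b.c₂ c.c₂ d.c₂, m a.c₂ b.c₃ a.c₃ b.c₂ c.c₂ d.c₃ c.c₃ d.c₂,
    m a.c₂ b.c₄ a.c₄ b.c₂ c.c₂ d.c₄ c.c₄ d.c₂, m a.c₂ b.c₅ a.c₅ b.c₂ c.c₂ d.c₅ c.c₅ d.c₂,
    s a.c₃ b.c₃ c.c₃ d.c₃, m a.c₃ b.c₄ a.c₄ b.c₃ c.c₃ d.c₄ c.c₄ d.c₃,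
    m a.c₃ b.c₅ a.c₅ b.c₃ c.c₃ d.c₅ c.c₅ d.c₃,
    s a.c₄ b.c₄ c.c₄ d.c₄, m a.c₄ b.c₅ a.c₅ b.c₄ c.c₄ d.c₅ c.c₅ d.c₄,
    s a.c₅ b.c₅ c.c₅ d.c₅]

end Form

/-- The difference of two natural numbers. -/
def SInt.diff (a b : ℕ) : SInt := ⟨a, b⟩

/-- The residue modulo `p`. -/
def SInt.mod (p : ℕ) (a : SInt) : ℕ := Nat.mod (Nat.add a.p (Nat.mul (Nat.pred p) a.n)) p

/-- The modulus of the rank computations. -/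
def modulus : ℕ := 10007

/-- Extract a row with non-zero head. -/
def findPivot : List (List ℕ) → Option (List ℕ × List (List ℕ))
  | [] => none
  | r :: l =>
    match r.headD 0 % modulus with
    | 0 => (findPivot l).map fun t => (t.1, r :: t.2)
    | _ + 1 => some (r, l)

/-- Eliminate the first entry of a row with a pivot row. -/
def reduceRow (s : List ℕ) : List ℕ → List ℕ
  | [] => []
  | 0 :: r => r
  | (k + 1) :: r => List.zipWith (fun x y => Nat.mod (Nat.add (Nat.mul (s.headD 0) x)
      (Nat.mul (Nat.mul (Nat.pred modulus) (k + 1)) y)) modulus) r s.tail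

/-- Gaussian elimination: do the rows have full column rank `n`? -/
def fullRank : ℕ → List (List ℕ) → Bool
  | 0, _ => true
  | n + 1, l =>
    match findPivot l with
    | none => false
    | some (s, t) => fullRank n (t.map (reduceRow s))

/-- The products of a quadratic form in five variables with the variables. -/
def mulVars {α : Type*} [Zero α] : List α → List (List α)
  | [a, b, c, d, e, f, g, h, i, j, k, l, m, n, o] =>
    [[a, b, c, d, e, f, g, h, i, j, k, l, m, n, o, 0, 0, 0, 0, 0, 0, 0, 0, 0, 0, 0, 0, 0, 0, 0,
        0, 0, 0, 0, 0],
      [0, a, 0, 0, 0, b, c, d, e, 0, 0, 0, 0, 0, 0, f, g, h, i, j, k, l, m, n, o, 0, 0, 0, 0, 0,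
        0, 0, 0, 0, 0],
      [0, 0, a, 0, 0, 0, b, 0, 0, c, d, e, 0, 0, 0, 0, f, 0, 0, g, h, i, 0, 0, 0, j, k, l, m, n,
        o, 0, 0, 0, 0],
      [0, 0, 0, a, 0, 0, 0, b, 0, 0, c, 0, d, e, 0, 0, 0, f, 0, 0, g, 0, h, i, 0, 0, j, 0, k, l,
        0, m, n, o, 0],
      [0, 0, 0, 0, a, 0, 0, 0, b, 0, 0, c, 0, d, e, 0, 0, 0, f, 0, 0, g, 0, h, i, 0, 0, j, 0, k,
        l, 0, m, n, o]]
  | _ => []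

/-- The columns of a matrix with `n` columns. -/
def columns (n : ℕ) (l : List (List ℕ)) : List (List ℕ) :=
  (List.range n).map fun j => l.map fun r => r.getD j 0

/-- A linear form with small coefficients. -/
def Form.ofInt (a b c d e f : ℤ) : Form :=
  ⟨.dyadic a 0, .dyadic b 0, .dyadic c 0, .dyadic d 0, .dyadic e 0, .dyadic f 0⟩

/-- The Plücker relations. -/
def pluckerForms : List (List SInt) :=
  [Form.crossMul (.ofInt 1 0 0 0 0 0) (.ofInt 0 1 0 0 0 0)
      (.ofInt 0 0 1 0 (-1) 0) (.ofInt 0 0 0 (-1) 0 1),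
    Form.crossMul (.ofInt 0 0 1 0 0 0) (.ofInt (-1) 0 0 1 0 0)
      (.ofInt 0 0 0 1 0 0) (.ofInt 0 0 0 0 1 0),
    Form.crossMul (.ofInt 0 0 1 0 0 0) (.ofInt 0 0 0 (-1) 0 1)
      (.ofInt 0 1 0 0 0 0) (.ofInt 0 0 0 1 0 0),
    Form.crossMul (.ofInt 0 1 0 0 0 0) (.ofInt 0 0 0 0 1 0)
      (.ofInt 0 0 0 0 0 1) (.ofInt 0 0 1 0 (-1) 0),
    Form.crossMul (.ofInt 1 0 0 0 0 0) (.ofInt 0 0 0 0 0 1)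
      (.ofInt 0 0 0 0 1 0) (.ofInt 0 0 0 (-1) 0 1)]

namespace Split

/-- The squares `(x - bⱼ)² (x - bₖ)²`, scaled such that the sum of all six vanishes. -/
def scales (s : Split) : Quint SInt :=
  let a := (SInt.diff s.b₁ s.b₂).mul (.diff s.b₃ s.b₄)
  let b := (SInt.diff s.b₁ s.b₃).mul (.diff s.b₄ s.b₂)
  let c := (SInt.diff s.b₁ s.b₄).mul (.diff s.b₂ s.b₃)
  let q (x y : ℕ) := (SInt.diff x y).mul (.diff x y)
  ⟨a.mul (q s.b₃ s.b₄), b.mul (q s.b₂ s.b₄), c.mul (q s.b₂ s.b₃), c.mul (q s.b₁ s.b₄),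
    b.mul (q s.b₁ s.b₃)⟩

/-- A common multiple of the scaling factors. -/
def scale (s : Split) : Quint SInt :=
  let a := (SInt.diff s.b₁ s.b₂).mul (.diff s.b₃ s.b₄)
  let b := (SInt.diff s.b₁ s.b₃).mul (.diff s.b₄ s.b₂)
  let c := (SInt.diff s.b₁ s.b₄).mul (.diff s.b₂ s.b₃)
  let q (x y : ℕ) := (SInt.diff x y).mul (.diff x y)
  let q34 := q s.b₃ s.b₄
  let q24 := q s.b₂ s.b₄
  let q23 := q s.b₂ s.b₃
  let q14 := q s.b₁ s.b₄
  let q13 := q s.b₁ s.b₃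
  ⟨(b.mul c).mul ((q24.mul q23).mul (q14.mul q13)), (a.mul c).mul ((q34.mul q23).mul (q14.mul q13)),
    (a.mul b).mul ((q34.mul q24).mul (q14.mul q13)),
        (a.mul b).mul ((q34.mul q24).mul (q23.mul q13)),
    (a.mul c).mul ((q34.mul q24).mul (q23.mul q14))⟩

/-- The factor by which the coordinates of functionals are scaled. -/
def factor (s : Split) : SInt :=
  (s.scale.t₁₂.mul s.scales.t₁₂).mul (((SInt.diff s.b₁ s.b₂).mul ((SInt.diff s.b₁ s.b₂).mul
    (.diff s.b₁ s.b₂))).mul (((SInt.diff s.b₁ s.b₃).mul (.diff s.b₁ s.b₄)).mul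
      (((SInt.diff s.b₂ s.b₃).mul (.diff s.b₂ s.b₄)).mul ((SInt.diff s.b₃ s.b₄).scale 2))))

/-- Coordinates of a functional, where `u, u'` and `v, v'` are its values and derivatives at
`b₁` and `b₂`, and `w` is its leading coefficient. -/
def coords (s : Split) (u u' v v' w : SInt) : Quint SInt :=
  let d12 := SInt.diff s.b₁ s.b₂
  let d13 := SInt.diff s.b₁ s.b₃
  let d14 := SInt.diff s.b₁ s.b₄
  let d23 := SInt.diff s.b₂ s.b₃
  let d24 := SInt.diff s.b₂ s.b₄
  let d34 := SInt.diff s.b₃ s.b₄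
  let h₀ := d12.mul u
  let h₁ := (d12.mul u').sub (u.scale 2)
  let k₀ := d12.mul v
  let k₁ := (d12.mul v').add (v.scale 2)
  let t₂₃ := ((d14.mul h₁).sub (h₀.scale 2)).mul (d14.mul (d23.mul d24))
  let t₂₄ := ((h₀.scale 2).sub (d13.mul h₁)).mul (d13.mul (d23.mul d24))
  let t₁₃ := ((d24.mul k₁).sub (k₀.scale 2)).mul (d24.mul (d13.mul d14))
  let t₁₄ := ((k₀.scale 2).sub (d23.mul k₁)).mul (d23.mul (d13.mul d14))
  let t₁₂ := (w.mul ((d12.mul (d12.mul d12)).mul ((d13.mul d14).mul ((d23.mul d24).mul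
    (d34.scale 2))))).sub ((t₁₃.add t₁₄).add (t₂₃.add t₂₄))
  ⟨t₁₂.mul s.scale.t₁₂, t₁₃.mul s.scale.t₁₃, t₁₄.mul s.scale.t₁₄, t₂₃.mul s.scale.t₂₃,
    t₂₄.mul s.scale.t₂₄⟩

/-- Coordinates of the monomial `x ^ k`. -/
def monomial (s : Split) (k : ℕ) : Quint SInt :=
  s.coords ⟨s.b₁ ^ k, 0⟩ ⟨k * s.b₁ ^ (k - 1), 0⟩ ⟨s.b₂ ^ k, 0⟩ ⟨k * s.b₂ ^ (k - 1), 0⟩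
    ⟨if k = 4 then 1 else 0, 0⟩

/-- The coefficient of `x ^ k` in `(x - b)² (x - c)²`. -/
def squareCoeff (b c : ℕ) : ℕ → SInt
  | 0 => ⟨b * b * c * c, 0⟩
  | 1 => ⟨0, 2 * b * c * (b + c)⟩
  | 2 => ⟨b * b + 4 * b * c + c * c, 0⟩
  | 3 => ⟨0, 2 * (b + c)⟩
  | _ => ⟨1, 0⟩

/-- The coordinates of `x ^ k` give the correct coefficient of `x ^ l`. -/
def coordTest (s : Split) (k l : ℕ) : Bool :=
  let t := s.monomial k
  let r := s.scales
  let u := (((t.t₁₂.mul (r.t₁₂.mul (squareCoeff s.b₁ s.b₂ l))).add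
    (t.t₁₃.mul (r.t₁₃.mul (squareCoeff s.b₁ s.b₃ l)))).add
    (t.t₁₄.mul (r.t₁₄.mul (squareCoeff s.b₁ s.b₄ l)))).add
    ((t.t₂₃.mul (r.t₂₃.mul (squareCoeff s.b₂ s.b₃ l))).add
    (t.t₂₄.mul (r.t₂₄.mul (squareCoeff s.b₂ s.b₄ l))))
  Nat.beq (u.sub (s.factor.scale (if k = l then 1 else 0))).abs 0

end Split

/-- Linear combination of four vectors. -/
def Quint.comb (a b c d : SInt) (q r s t : Quint SInt) : Quint SInt :=
  ⟨.dot₄ a b c d q.t₁₂ r.t₁₂ s.t₁₂ t.t₁₂, .dot₄ a b c d q.t₁₃ r.t₁₃ s.t₁₃ t.t₁₃,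
    .dot₄ a b c d q.t₁₄ r.t₁₄ s.t₁₄ t.t₁₄, .dot₄ a b c d q.t₂₃ r.t₂₃ s.t₂₃ t.t₂₃,
    .dot₄ a b c d q.t₂₄ r.t₂₄ s.t₂₄ t.t₂₄⟩

namespace Split

/-- The coordinates of `x ^ k * (x - a) ^ 3`. -/
def cube (s : Split) (k a : ℕ) : Quint SInt :=
  .comb ⟨0, a ^ 3⟩ ⟨3 * a ^ 2, 0⟩ ⟨0, 3 * a⟩ ⟨1, 0⟩ (s.monomial k) (s.monomial (k + 1))
    (s.monomial (k + 2)) (s.monomial (k + 3))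

/-- The condition for the incidence conditions at `a`, `b`, `c` to be dependent. -/
def triple (s : Split) (a b c : ℕ) : List SInt :=
  Form.crossMul (.ofTriple (s.cube 0 a) (s.cube 1 a) (s.cube 1 b))
    (.ofTriple (s.cube 0 b) (s.cube 0 c) (s.cube 1 c))
    (.ofTriple (s.cube 0 a) (s.cube 1 a) (s.cube 0 b))
    (.ofTriple (s.cube 1 b) (s.cube 0 c) (s.cube 1 c))

/-- Quadratic equations satisfied by the flags. -/
def quadrics (s : Split) : List (List SInt) :=
  s.triple s.a₁ s.a₂ s.a₃ :: s.triple s.a₁ s.a₂ s.a₄ :: s.triple s.a₁ s.a₃ s.a₄ ::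
    s.triple s.a₂ s.a₃ s.a₄ :: pluckerForms

/-- A test for the quadratic equations to have at most twelve solutions. -/
def upperTest (s : Split) : Bool :=
  let l := s.quadrics.map fun q => q.map (SInt.mod modulus)
  fullRank 35 (l.flatMap fun q => mulVars (q.drop 6)) && fullRank 9 (columns 21 l) &&
    (List.range 5).all fun k => (List.range 5).all fun l => s.coordTest k l

end Split

/-- The value of the linear form with coefficients `r` at a sequence. -/
def lineval {K : Type*} [Ring K] : List K → (ℕ → K) → K
  | [], _ => 0
  | x :: r, c => x * c 0 + lineval r fun k => c (k + 1)

theorem lineval_eq_zero {K : Type*} [Ring K] {r : List K} {c : ℕ → K}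
    (h : ∀ k < r.length, c k = 0) : lineval r c = 0 := by
  induction r generalizing c with
  | nil => rfl
  | cons x r ih =>
    rw [lineval, h 0 (by simp), ih fun k hk => h _ (by simpa using hk)]
    simp

theorem lineval_append {K : Type*} [Ring K] (r s : List K) (c : ℕ → K) :
    lineval (r ++ s) c = lineval r c + lineval s fun k => c (k + r.length) := by
  induction r generalizing c with
  | nil => simp [lineval]
  | cons x r ih =>
    simp only [List.cons_append, lineval, ih, List.length_cons, add_assoc]

theorem lineval_sum {K ι : Type*} [CommRing K] [Fintype ι] (r : List K) (ν : ι → K)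
    (f : ι → ℕ → K) :
    lineval r (fun k => ∑ i, ν i * f i k) = ∑ i, ν i * lineval r (f i) := by
  induction r generalizing f with
  | nil => simp [lineval]
  | cons x r ih =>
    simp only [lineval, ih, mul_add, Finset.sum_add_distrib, Finset.mul_sum, mul_left_comm x]

theorem lineval_smul {K : Type*} [CommRing K] (r : List K) (a : K) (f : ℕ → K) :
    lineval r (fun k => a * f k) = a * lineval r f := by
  simpa using lineval_sum r (fun _ : Unit => a) fun _ => f

theorem lineval_eq_sum {K : Type*} [Ring K] {n : ℕ} {r : List K} (h : r.length = n) (c : ℕ → K) :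
    lineval r c = ∑ k : Fin n, r.getD k 0 * c k := by
  induction r generalizing n c with
  | nil =>
    obtain rfl : n = 0 := by simpa using h.symm
    simp [lineval]
  | cons x r ih =>
    obtain ⟨m, rfl⟩ : ∃ m, n = m + 1 := ⟨r.length, by simpa using h.symm⟩
    rw [lineval, ih (n := m) (by simpa using h), Fin.sum_univ_succ]
    simp

section modulus

instance : Fact (Nat.Prime modulus) := ⟨by norm_num [modulus]⟩

/-- The reduction modulo the modulus of the rank computations. -/
local notation "ν" => (Nat.cast : ℕ → ZMod modulus)

theorem cast_mod_modulus (m : ℕ) : ν (m % modulus) = ν m := by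
  simp

theorem cast_pred_modulus : ν (Nat.pred modulus) = -1 := by
  have h : Nat.pred modulus + 1 = modulus := rfl
  have := congrArg ν h
  push_cast [CharP.cast_eq_zero] at this
  linear_combination this

theorem SInt.cast_mod (a : SInt) : ν (a.mod modulus) = (a.val : ZMod modulus) := by
  simp only [mod, val, Nat.add_eq, Nat.mul_eq]
  change ν ((a.p + Nat.pred modulus * a.n) % modulus) = _
  rw [cast_mod_modulus]
  push_cast [cast_pred_modulus]
  ring

theorem findPivot_eq_some {l : List (List ℕ)} {s : List ℕ} {t : List (List ℕ)}
    (h : findPivot l = some (s, t)) : s ∈ l ∧ t ⊆ l ∧ ν (s.headD 0) ≠ 0 := by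
  induction l generalizing s t with
  | nil => simp [findPivot] at h
  | cons r l ih =>
    rw [findPivot] at h
    split at h
    · obtain ⟨⟨s', t'⟩, h', h''⟩ := Option.map_eq_some_iff.1 h
      simp only [Prod.mk.injEq] at h''
      obtain ⟨rfl, rfl⟩ := h''
      obtain ⟨h₁, h₂, h₃⟩ := ih h'
      exact ⟨List.mem_cons_of_mem _ h₁, List.cons_subset_cons _ h₂, h₃⟩
    · rename_i m hm
      simp only [Option.some.injEq, Prod.mk.injEq] at h
      obtain ⟨rfl, rfl⟩ := h
      refine ⟨List.mem_cons_self, List.subset_cons_self _ _, fun h₀ => ?_⟩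
      rw [← cast_mod_modulus, hm, CharP.cast_eq_zero_iff (ZMod modulus) modulus] at h₀
      have h₁ := Nat.le_of_dvd (Nat.succ_pos _) h₀
      have h₂ := Nat.mod_lt (r.headD 0) (show 0 < modulus by norm_num [modulus])
      omega

theorem lineval_zipWith {a b : ℕ} {r s : List ℕ} (h : r.length = s.length)
    (c : ℕ → ZMod modulus) : lineval ((List.zipWith (fun x y => Nat.mod (Nat.add (Nat.mul a x)
      (Nat.mul (Nat.mul (Nat.pred modulus) b) y)) modulus) r s).map ν) c =
    ν a * lineval (r.map ν) c - ν b * lineval (s.map ν) c := by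
  induction r generalizing s c with
  | nil =>
    obtain rfl : s = [] := by simpa using h.symm
    simp [lineval]
  | cons x r ih =>
    obtain ⟨y, s, rfl⟩ := List.exists_cons_of_length_eq_add_one h.symm
    simp only [List.zipWith_cons_cons, List.map_cons, lineval]
    rw [ih (s := s) (by simpa using h)]
    change ν ((a * x + Nat.pred modulus * b * y) % modulus) * _ + _ = _
    rw [cast_mod_modulus]
    push_cast [cast_pred_modulus]
    ring

theorem lineval_reduceRow {n : ℕ} {r s : List ℕ} (hr : r.length = n + 1) (hs : s.length = n + 1)
    {c : ℕ → ZMod modulus} (hr₀ : lineval (r.map ν) c = 0) (hs₀ : lineval (s.map ν) c = 0) :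
    (reduceRow s r).length = n ∧
      lineval ((reduceRow s r).map ν) (fun k => c (k + 1)) = 0 := by
  obtain ⟨x, r, rfl⟩ := List.exists_cons_of_length_eq_add_one hr
  obtain ⟨y, s, rfl⟩ := List.exists_cons_of_length_eq_add_one hs
  simp only [List.length_cons, add_left_inj] at hr hs
  simp only [List.map_cons, lineval] at hr₀ hs₀
  rcases x with _ | k
  · simpa [reduceRow, hr] using hr₀
  · simp only [reduceRow, List.tail_cons, List.headD_cons]
    refine ⟨by simp [hr, hs], ?_⟩
    rw [lineval_zipWith (hr.trans hs.symm)]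
    linear_combination ν y * hr₀ - ν (k + 1) * hs₀

theorem fullRank_sound {n : ℕ} {l : List (List ℕ)} (h : fullRank n l)
    (hl : ∀ r ∈ l, r.length = n) {c : ℕ → ZMod modulus}
    (hc : ∀ r ∈ l, lineval (r.map ν) c = 0) : ∀ k < n, c k = 0 := by
  induction n generalizing l c with
  | zero => simp
  | succ n ih =>
    rw [fullRank] at h
    split at h
    · simp at h
    · rename_i s t hst
      obtain ⟨hs, ht, h₀⟩ := findPivot_eq_some hst
      have key (r : List ℕ) (hr : r ∈ t) :=
        lineval_reduceRow (hl r (ht hr)) (hl s hs) (hc r (ht hr)) (hc s hs)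
      have h₁ : ∀ k < n, c (k + 1) = 0 := by
        refine ih (c := fun k => c (k + 1)) h ?_ ?_
        · intro r' hr'
          obtain ⟨r, hr, rfl⟩ := List.mem_map.1 hr'
          exact (key r hr).1
        · intro r' hr'
          obtain ⟨r, hr, rfl⟩ := List.mem_map.1 hr'
          exact (key r hr).2
      rintro (_ | k) hk
      · obtain ⟨y, s', rfl⟩ := List.exists_cons_of_length_eq_add_one (hl s hs)
        have h₂ := hc _ hs
        rw [List.map_cons, lineval, lineval_eq_zero (r := s'.map ν), add_zero] at h₂
        · exact (mul_eq_zero.1 h₂).resolve_left h₀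
        · intro k hk
          have := hl _ hs
          simp only [List.length_map, List.length_cons] at hk this
          exact h₁ k (by omega)
      · exact h₁ k (by omega)

theorem mulVec_eq_lineval {n : ℕ} {L : List (List ℤ)} (hL : ∀ r ∈ L, r.length = n)
    {R : Type*} [CommRing R] (i : Fin L.length) (c : ℕ → R) :
    ((Matrix.of fun (i : Fin L.length) (k : Fin n) => (L[i]).getD k 0).map
      (Int.cast : ℤ → R)).mulVec (fun k => c k) i = lineval (L[i].map (Int.cast : ℤ → R)) c := by
  have h : (L[i].map (Int.cast : ℤ → R)).length = n :=
    (List.length_map _).trans (hL _ (List.getElem_mem _))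
  rw [lineval_eq_sum h, Matrix.mulVec, dotProduct]
  refine Finset.sum_congr rfl fun k _ => ?_
  rw [Matrix.map_apply, Matrix.of_apply, ← Int.cast_zero (R := R), List.getD_map]

/-- A matrix of integers that has full column rank modulo a prime has full column rank in
characteristic zero. -/
theorem eq_zero_of_fullRank {n : ℕ} {l : List (List ℕ)} (h : fullRank n l)
    {L : List (List ℤ)} (hL : ∀ r ∈ L, r.length = n)
    (hlL : l.map (List.map ν) = L.map (List.map (Int.cast : ℤ → ZMod modulus)))
    {K : Type*} [Field K] [CharZero K] {c : ℕ → K}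
    (hc : ∀ r ∈ L, lineval (r.map (Int.cast : ℤ → K)) c = 0) : ∀ k < n, c k = 0 := by
  let M : Matrix (Fin L.length) (Fin n) ℤ := Matrix.of fun i k => (L[i]).getD k 0
  have hmem {r : List ℕ} (hr : r ∈ l) :
      r.map ν ∈ L.map (List.map (Int.cast : ℤ → ZMod modulus)) := by
    rw [← hlL]
    exact List.mem_map_of_mem hr
  have hlen : ∀ r ∈ l, r.length = n := by
    intro r hr
    obtain ⟨r', hr', h₂⟩ := List.mem_map.1 (hmem hr)
    have := congrArg List.length h₂
    simp only [List.length_map] at this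
    rw [← this, hL _ hr']
  have hinj : Function.Injective (M.map (Int.cast : ℤ → ZMod modulus)).mulVecLin := by
    rw [← LinearMap.ker_eq_bot, LinearMap.ker_eq_bot']
    intro c hc
    let c' : ℕ → ZMod modulus := fun k => if hk : k < n then c ⟨k, hk⟩ else 0
    have hcc : (fun k : Fin n => c' k) = c := by
      ext k
      simp [c']
    have h₀ := fullRank_sound h hlen (c := c') (by
      intro r hr
      obtain ⟨r', hr', h₂⟩ := List.mem_map.1 (hmem hr)
      obtain ⟨i, hi, rfl⟩ := List.getElem_of_mem hr'
      have h₃ := mulVec_eq_lineval hL (R := ZMod modulus) ⟨i, hi⟩ c'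
      rw [hcc] at h₃
      rw [← h₂]
      exact h₃.symm.trans (congrFun hc _))
    ext k
    rw [← hcc]
    exact h₀ k k.2
  obtain ⟨g, hg⟩ := LinearMap.exists_leftInverse_of_injective _ (LinearMap.ker_eq_bot.2 hinj)
  let N : Matrix (Fin n) (Fin L.length) ℤ := Matrix.of fun i j =>
    (ZMod.val (LinearMap.toMatrix' g i j) : ℤ)
  have hN : N.map (Int.cast : ℤ → ZMod modulus) = LinearMap.toMatrix' g := by
    ext i j
    exact (Int.cast_natCast _).trans (ZMod.natCast_zmod_val _)
  have h₁ : (N * M).map (Int.cast : ℤ → ZMod modulus) = 1 := by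
    have := congrArg LinearMap.toMatrix' hg
    rw [LinearMap.toMatrix'_comp, ← Matrix.toLin'_apply', LinearMap.toMatrix'_toLin',
      LinearMap.toMatrix'_id, ← hN] at this
    rw [← this]
    exact Matrix.map_mul (f := Int.castRingHom (ZMod modulus))
  have hdet : (N * M).det ≠ 0 := by
    intro h₀
    have := congrArg Matrix.det h₁
    rw [Matrix.det_one] at this
    have h₂ := (Int.castRingHom (ZMod modulus)).map_det (N * M)
    rw [h₀, map_zero] at h₂
    exact zero_ne_one (h₂.trans this)
  have hdetK : ((N * M).map (Int.cast : ℤ → K)).det ≠ 0 := by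
    have h₂ := (Int.castRingHom K).map_det (N * M)
    intro h₀
    exact hdet ((Int.cast_eq_zero (α := K)).1 (h₂.trans h₀))
  have h₂ : ((N * M).map (Int.cast : ℤ → K)).mulVec (fun k => c k) = 0 := by
    have h₃ : (N * M).map (Int.cast : ℤ → K) =
        N.map (Int.cast : ℤ → K) * M.map (Int.cast : ℤ → K) :=
      Matrix.map_mul (f := Int.castRingHom K)
    have h₄ : (M.map (Int.cast : ℤ → K)).mulVec (fun k => c k) = 0 := by
      ext i
      exact (mulVec_eq_lineval hL i c).trans (hc _ (List.getElem_mem _))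
    rw [h₃, ← Matrix.mulVec_mulVec, h₄, Matrix.mulVec_zero]
  intro k hk
  exact congrFun (Matrix.eq_zero_of_mulVec_eq_zero hdetK h₂) ⟨k, hk⟩

end modulus

/-- The quadratic monomials in six variables, in the order of `Form.crossMul`. -/
def quadIdx : List (List (Fin 6)) :=
  [[0, 0], [0, 1], [0, 2], [0, 3], [0, 4], [0, 5], [1, 1], [1, 2], [1, 3], [1, 4], [1, 5], [2, 2],
    [2, 3], [2, 4], [2, 5], [3, 3], [3, 4], [3, 5], [4, 4], [4, 5], [5, 5]]

/-- The cubic monomials in the last five variables, in the order of `mulVars`. -/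
def cubicIdx : List (List (Fin 6)) :=
  [[1, 1, 1], [1, 1, 2], [1, 1, 3], [1, 1, 4], [1, 1, 5], [1, 2, 2], [1, 2, 3], [1, 2, 4],
    [1, 2, 5], [1, 3, 3], [1, 3, 4], [1, 3, 5], [1, 4, 4], [1, 4, 5], [1, 5, 5], [2, 2, 2],
    [2, 2, 3], [2, 2, 4], [2, 2, 5], [2, 3, 3], [2, 3, 4], [2, 3, 5], [2, 4, 4], [2, 4, 5],
    [2, 5, 5], [3, 3, 3], [3, 3, 4], [3, 3, 5], [3, 4, 4], [3, 4, 5], [3, 5, 5], [4, 4, 4],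
    [4, 4, 5], [4, 5, 5], [5, 5, 5]]

section points

variable {K : Type*} [Field K]

/-- The values of the quadratic monomials. -/
def quad (y : Fin 6 → K) (k : ℕ) : K := ((quadIdx.getD k []).map y).prod

/-- The values of the cubic monomials. -/
def cubic (y : Fin 6 → K) (k : ℕ) : K := ((cubicIdx.getD k []).map y).prod

theorem exists_quadIdx : ∀ j k : Fin 6, ∃ t < 21, (quadIdx.getD t []).Perm [j, k] := by
  decide +kernel

theorem exists_cubicIdx : ∀ j k m : Fin 5,
    ∃ t < 35, (cubicIdx.getD t []).Perm [j.succ, k.succ, m.succ] := by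
  decide +kernel

theorem mulVars_map {α β : Type*} [Zero α] [Zero β] {f : α → β} (hf : f 0 = 0) (l : List α) :
    mulVars (l.map f) = (mulVars l).map (List.map f) := by
  by_cases h : l.length = 15
  · obtain ⟨a, l, rfl⟩ := List.exists_cons_of_length_eq_add_one h
    iterate 14
      simp only [List.length_cons, Nat.reduceEqDiff] at h
      obtain ⟨_, l, rfl⟩ := List.exists_cons_of_length_eq_add_one h
    obtain rfl : l = [] := by simpa using h
    simp [mulVars, hf]
  · have h' : (l.map f).length ≠ 15 := by simpa using h
    rw [mulVars, mulVars]
    · rfl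
    · rintro _ _ _ _ _ _ _ _ _ _ _ _ _ _ _ rfl
      exact h rfl
    · intro _ _ _ _ _ _ _ _ _ _ _ _ _ _ _ h''
      rw [h''] at h'
      exact h' rfl

theorem length_of_mem_mulVars {α : Type*} [Zero α] {l r : List α} (h : r ∈ mulVars l) :
    r.length = 35 := by
  unfold mulVars at h
  split at h
  · simp only [List.mem_cons, List.not_mem_nil, or_false] at h
    rcases h with rfl | rfl | rfl | rfl | rfl <;> rfl
  · simp at h

theorem lineval_of_mem_mulVars {l r : List K} (h : r ∈ mulVars l) :
    ∃ j : Fin 5, ∀ y : Fin 6 → K,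
      lineval r (cubic y) = y j.succ * lineval l fun k => quad y (k + 6) := by
  unfold mulVars at h
  split at h
  · simp only [List.mem_cons, List.not_mem_nil, or_false] at h
    rcases h with rfl | rfl | rfl | rfl | rfl
    · refine ⟨0, fun y => ?_⟩
      simp [lineval, cubic, quad, cubicIdx, quadIdx]
      ring
    · refine ⟨1, fun y => ?_⟩
      simp [lineval, cubic, quad, cubicIdx, quadIdx]
      ring
    · refine ⟨2, fun y => ?_⟩
      simp [lineval, cubic, quad, cubicIdx, quadIdx]
      ring
    · refine ⟨3, fun y => ?_⟩
      simp [lineval, cubic, quad, cubicIdx, quadIdx]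
      ring
    · refine ⟨4, fun y => ?_⟩
      simp [lineval, cubic, quad, cubicIdx, quadIdx]
      ring
  · simp at h

/-- Sums over points with weights `ν` of products of two coordinates vanish. -/
def QuadSums {ι : Type*} [Fintype ι] (y : ι → Fin 6 → K) (ν : ι → K) : Prop :=
  ∀ j k, ∑ i, ν i * (y i j * y i k) = 0

/-- The sequence of coordinates. -/
def coordSeq (y : Fin 6 → K) (k : ℕ) : K := if hk : k < 6 then y ⟨k, hk⟩ else 0

theorem lineval_drop_six {y : Fin 6 → K} {q : List K} (hq : lineval q (quad y) = 0)
    (h : 6 ≤ q.length) : lineval (q.drop 6) (fun k => quad y (k + 6)) =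
      -(y 0 * lineval (q.take 6) (coordSeq y)) := by
  rw [← List.take_append_drop 6 q, lineval_append, List.length_take, min_eq_left h] at hq
  rw [eq_neg_iff_add_eq_zero, add_comm, ← hq, ← lineval_smul]
  congr 1
  generalize hr : q.take 6 = r
  have hr' : r.length = 6 := by simp [← hr, h]
  rw [lineval_eq_sum hr', lineval_eq_sum hr']
  refine Finset.sum_congr rfl fun k _ => ?_
  congr 1
  fin_cases k <;> simp [quad, quadIdx, coordSeq]

theorem flatMap_mulVars_map {α β : Type*} [Zero α] [Zero β] {f : α → β} (hf : f 0 = 0)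
    (l : List (List α)) : (l.flatMap fun q => mulVars (q.drop 6)).map (List.map f) =
      (l.map (List.map f)).flatMap fun q => mulVars (q.drop 6) := by
  rw [List.map_flatMap, List.flatMap_map]
  simp only [← List.map_drop, mulVars_map hf]

/-- The integers represented by lists of pairs. -/
def intRows (Q : List (List SInt)) : List (List ℤ) := Q.map (List.map SInt.val)

theorem map_mod_eq (Q : List (List SInt)) :
    (Q.map fun q => q.map (SInt.mod modulus)).map (List.map (Nat.cast : ℕ → ZMod modulus)) =
      (intRows Q).map (List.map (Int.cast : ℤ → ZMod modulus)) := by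
  simp only [intRows, List.map_map]
  refine List.map_congr_left fun q _ => ?_
  simp only [Function.comp_apply, List.map_map]
  exact List.map_congr_left fun a _ => SInt.cast_mod a

/-- The equations with coefficients `Q` hold at `y`. -/
def Satisfies (Q : List (List SInt)) (y : Fin 6 → K) : Prop :=
  ∀ q ∈ intRows Q, lineval (q.map (Int.cast : ℤ → K)) (quad y) = 0

variable {Q : List (List SInt)}

theorem length_of_mem_intRows (hQ : ∀ q ∈ Q, q.length = 21) {q : List ℤ} (hq : q ∈ intRows Q) :
    (q.map (Int.cast : ℤ → K)).length = 21 := by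
  obtain ⟨q', hq', rfl⟩ := List.mem_map.1 hq
  simp [hQ q' hq']

variable [CharZero K]

theorem cubic_eq_zero
    (h₁ : fullRank 35
      ((Q.map fun q => q.map (SInt.mod modulus)).flatMap fun q => mulVars (q.drop 6)))
    {c : ℕ → K} (hc : ∀ q ∈ intRows Q, ∀ r ∈ mulVars ((q.map (Int.cast : ℤ → K)).drop 6),
      lineval r c = 0) : ∀ k < 35, c k = 0 := by
  refine eq_zero_of_fullRank h₁ (L := (intRows Q).flatMap fun q => mulVars (q.drop 6)) ?_ ?_ ?_
  · intro r hr
    obtain ⟨q, -, hq⟩ := List.mem_flatMap.1 hr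
    exact length_of_mem_mulVars hq
  · rw [flatMap_mulVars_map Nat.cast_zero, flatMap_mulVars_map Int.cast_zero, map_mod_eq]
  · intro r hr
    obtain ⟨q, hq, hr'⟩ := List.mem_flatMap.1 hr
    refine hc q hq _ ?_
    rw [← List.map_drop, mulVars_map Int.cast_zero]
    exact List.mem_map_of_mem hr'

/-- A solution of the equations at infinity is zero. -/
theorem Satisfies.eq_zero
    (h₁ : fullRank 35
      ((Q.map fun q => q.map (SInt.mod modulus)).flatMap fun q => mulVars (q.drop 6)))
    (hQ : ∀ q ∈ Q, q.length = 21) {y : Fin 6 → K} (hy : Satisfies Q y) (h₀ : y 0 = 0) : y = 0 := by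
  have h := cubic_eq_zero (c := cubic y) h₁ (by
    intro q hq r hr
    obtain ⟨j, hj⟩ := lineval_of_mem_mulVars hr
    rw [hj, lineval_drop_six (hy q hq) (by rw [length_of_mem_intRows hQ hq]; norm_num), h₀]
    simp)
  ext j
  refine Fin.cases h₀ (fun j => ?_) j
  obtain ⟨t, ht, hp⟩ := exists_cubicIdx j j j
  have h₂ := h t ht
  rw [cubic, (hp.map y).prod_eq] at h₂
  simpa using h₂

/-- The space of weights for which the sums of products of two coordinates vanish is stable under
multiplication by coordinates. -/
theorem QuadSums.mul
    (h₁ : fullRank 35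
      ((Q.map fun q => q.map (SInt.mod modulus)).flatMap fun q => mulVars (q.drop 6)))
    (hQ : ∀ q ∈ Q, q.length = 21) {ι : Type*} [Fintype ι] {y : ι → Fin 6 → K}
    (hy : ∀ i, y i 0 = 1) (hq : ∀ i, Satisfies Q (y i)) {ν : ι → K} (hν : QuadSums y ν)
    (m : Fin 6) : QuadSums y fun i => ν i * y i m := by
  have h := cubic_eq_zero (c := fun k => ∑ i, ν i * cubic (y i) k) h₁ (by
    intro q hqQ r hr
    obtain ⟨j, hj⟩ := lineval_of_mem_mulVars hr
    have hterm (i : ι) : ν i * lineval r (cubic (y i)) =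
        -(ν i * y i j.succ * lineval ((q.map (Int.cast : ℤ → K)).take 6) (coordSeq (y i))) := by
      rw [hj, lineval_drop_six (hq i q hqQ) (by rw [length_of_mem_intRows hQ hqQ]; norm_num), hy]
      ring
    simp only [lineval_sum, hterm, Finset.sum_neg_distrib]
    rw [← lineval_sum, neg_eq_zero]
    refine lineval_eq_zero fun k _ => ?_
    by_cases hk : k < 6
    · simpa only [coordSeq, hk, dif_pos, mul_assoc] using hν j.succ ⟨k, hk⟩
    · simp [coordSeq, hk])
  intro j k
  by_cases hm : m = 0
  · simpa [hm, hy] using hν j k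
  by_cases hj : j = 0
  · simpa [hj, hy, mul_assoc] using hν m k
  by_cases hk : k = 0
  · simpa [hk, hy, mul_assoc] using hν m j
  obtain ⟨m, rfl⟩ := Fin.exists_succ_eq.2 hm
  obtain ⟨j, rfl⟩ := Fin.exists_succ_eq.2 hj
  obtain ⟨k, rfl⟩ := Fin.exists_succ_eq.2 hk
  obtain ⟨t, ht, hp⟩ := exists_cubicIdx m j k
  rw [← h t ht]
  refine Finset.sum_congr rfl fun i _ => ?_
  rw [cubic, (hp.map (y i)).prod_eq]
  simp
  ring

theorem QuadSums.eq_zero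
    (h₁ : fullRank 35
      ((Q.map fun q => q.map (SInt.mod modulus)).flatMap fun q => mulVars (q.drop 6)))
    (hQ : ∀ q ∈ Q, q.length = 21) {ι : Type*} [Fintype ι] {y : ι → Fin 6 → K}
    (hy : ∀ i, y i 0 = 1) (hinj : Function.Injective y) (hq : ∀ i, Satisfies Q (y i)) {ν : ι → K}
    (hν : QuadSums y ν) : ν = 0 := by
  classical
  ext i₀
  have hex (i : ι) : ∃ m, i ≠ i₀ → y i m ≠ y i₀ m := by
    by_cases h : i = i₀
    · exact ⟨0, fun h' => absurd h h'⟩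
    · obtain ⟨m, hm⟩ := Function.ne_iff.1 (hinj.ne h)
      exact ⟨m, fun _ => hm⟩
  choose m hm using hex
  have key (s : Finset ι) : QuadSums y fun i => ν i * ∏ k ∈ s, (y i (m k) - y k (m k)) := by
    induction s using Finset.induction_on with
    | empty => simpa using hν
    | insert a s ha ih =>
      intro j k
      have h₂ := QuadSums.mul h₁ hQ hy hq ih (m a) j k
      have h₃ := congrArg (y a (m a) * ·) (ih j k)
      simp only [mul_zero, Finset.mul_sum] at h₃
      rw [← sub_self (0 : K)]
      nth_rewrite 1 [← h₂]
      rw [← h₃, ← Finset.sum_sub_distrib]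
      refine Finset.sum_congr rfl fun i _ => ?_
      beta_reduce
      rw [Finset.prod_insert ha]
      ring
  have h₂ := key (Finset.univ.erase i₀) 0 0
  rw [Finset.sum_eq_single i₀ _ (by simp)] at h₂
  · simp only [hy, mul_one, mul_eq_zero, Finset.prod_eq_zero_iff, Finset.mem_erase,
      Finset.mem_univ, and_true] at h₂
    refine h₂.resolve_right ?_
    rintro ⟨k, hk, h₃⟩
    exact hm k hk (sub_eq_zero.1 h₃).symm
  · intro i _ hi
    beta_reduce
    rw [Finset.prod_eq_zero (i := i) (by simp [hi]) (sub_self _), mul_zero, zero_mul]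

theorem cast_getD_mod (q : List SInt) (j : ℕ) :
    (((q.map (SInt.mod modulus)).getD j 0 : ℕ) : ZMod modulus) =
      (((q.map SInt.val).getD j 0 : ℤ) : ZMod modulus) := by
  rw [← List.getD_map (f := (Nat.cast : ℕ → ZMod modulus)),
    ← List.getD_map (f := (Int.cast : ℤ → ZMod modulus)), Nat.cast_zero, Int.cast_zero,
    List.map_map, List.map_map]
  congr 1
  exact List.map_congr_left fun a _ => SInt.cast_mod a

/-- Nine quadratic equations have at most twelve common zeros. -/
theorem not_satisfies_of_ne
    (h₁ : fullRank 35
      ((Q.map fun q => q.map (SInt.mod modulus)).flatMap fun q => mulVars (q.drop 6)))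
    (h₂ : fullRank 9 (columns 21 (Q.map fun q => q.map (SInt.mod modulus))))
    (hQ : ∀ q ∈ Q, q.length = 21) (hQ₉ : Q.length = 9) {x : Fin 13 → Fin 6 → K}
    (hx : ∀ i, Satisfies Q (x i)) (hx₀ : ∀ i, x i ≠ 0)
    (hne : ∀ i j, i ≠ j → ∀ c : K, x i ≠ c • x j) : False := by
  have hx₁ (i : Fin 13) : x i 0 ≠ 0 := fun h => hx₀ i ((hx i).eq_zero h₁ hQ h)
  let y (i : Fin 13) : Fin 6 → K := (x i 0)⁻¹ • x i
  have hy (i : Fin 13) : y i 0 = 1 := by simp [y, hx₁]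
  have hinj : Function.Injective y := by
    intro i j hij
    by_contra hne'
    refine hne i j hne' (x i 0 * (x j 0)⁻¹) ?_
    rw [← smul_smul]
    change x i = x i 0 • y j
    rw [← hij, smul_inv_smul₀ (hx₁ i)]
  have hquad (i : Fin 13) (k : ℕ) (hk : k < 21) :
      quad (y i) k = (x i 0)⁻¹ * (x i 0)⁻¹ * quad (x i) k := by
    interval_cases k <;> simp [quad, quadIdx, y] <;> ring
  have hyQ (i : Fin 13) : Satisfies Q (y i) := by
    intro q hq
    have hlen := length_of_mem_intRows (K := K) hQ hq
    have h₃ := hx i q hq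
    rw [lineval_eq_sum hlen] at h₃ ⊢
    simp only [hquad i _ (Fin.is_lt _)]
    have h₄ := congrArg ((x i 0)⁻¹ * (x i 0)⁻¹ * ·) h₃
    simp only [mul_zero, Finset.mul_sum] at h₄
    exact (Finset.sum_congr rfl fun k _ => by ring).trans h₄
  have hR : (intRows Q).length = 9 := by simp [intRows, hQ₉]
  let R : Matrix (Fin 9) (Fin 21) K := Matrix.of fun i k => (((intRows Q).getD i []).getD k 0 : ℤ)
  have hmem (i : Fin 9) : (intRows Q).getD i [] ∈ intRows Q := by
    rw [List.getD_eq_getElem _ _ (by rw [hR]; exact i.2)]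
    exact List.getElem_mem _
  have hRy (i : Fin 13) : R.mulVec (fun k => quad (y i) k) = 0 := by
    ext t
    have h₃ := hyQ i _ (hmem t)
    rw [lineval_eq_sum (length_of_mem_intRows (K := K) hQ (hmem t))] at h₃
    rw [Pi.zero_apply, ← h₃, Matrix.mulVec, dotProduct]
    refine Finset.sum_congr rfl fun k _ => ?_
    rw [← Int.cast_zero (R := K), List.getD_map]
    rfl
  have hind : LinearIndependent K R.row := by
    rw [Fintype.linearIndependent_iff]
    intro g hg
    let c : ℕ → K := fun k => if hk : k < 9 then g ⟨k, hk⟩ else 0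
    have h₃ := eq_zero_of_fullRank h₂ (K := K) (c := c) (L := (List.range 21).map fun j =>
      (intRows Q).map fun r => r.getD j 0) ?_ ?_ ?_
    · intro i
      simpa [c] using h₃ i i.2
    · intro r hr
      obtain ⟨j, -, rfl⟩ := List.mem_map.1 hr
      simp [hR]
    · simp only [columns, List.map_map]
      refine List.map_congr_left fun j _ => ?_
      simp only [Function.comp_apply, intRows, List.map_map]
      exact List.map_congr_left fun q _ => cast_getD_mod q j
    · intro r hr
      obtain ⟨j, hj, rfl⟩ := List.mem_map.1 hr
      rw [lineval_eq_sum (n := 9) (by simp [hR])]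
      have h₄ := congrFun hg ⟨j, List.mem_range.1 hj⟩
      rw [Finset.sum_apply] at h₄
      refine Eq.trans (Finset.sum_congr rfl fun i _ => ?_) h₄
      have h₅ := List.getD_map (l := intRows Q) (d := []) (n := i) fun r => r.getD j 0
      rw [List.getD_nil] at h₅
      rw [← Int.cast_zero (R := K), List.getD_map, h₅]
      simp [c, R, mul_comm]
  have hrank : R.rank = 9 := by simpa using hind.rank_matrix
  have hker : Module.finrank K (LinearMap.ker R.mulVecLin) = 12 := by
    have := LinearMap.finrank_range_add_finrank_ker R.mulVecLin
    rw [Matrix.rank] at hrank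
    rw [hrank] at this
    simp at this
    omega
  have hdep : ¬ LinearIndependent K fun i : Fin 13 =>
      (⟨fun k : Fin 21 => quad (y i) k, hRy i⟩ : LinearMap.ker R.mulVecLin) := by
    intro h
    have := h.fintype_card_le_finrank
    rw [hker] at this
    simp at this
  rw [Fintype.not_linearIndependent_iff] at hdep
  obtain ⟨μ, hμ, i, hi⟩ := hdep
  have hμ' : QuadSums y μ := by
    intro j k
    obtain ⟨t, ht, hp⟩ := exists_quadIdx j k
    have h₃ := congrFun (congrArg Subtype.val hμ) ⟨t, ht⟩
    simp only [Submodule.coe_sum, Submodule.coe_smul, Finset.sum_apply, Pi.smul_apply,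
      smul_eq_mul] at h₃
    rw [← (show _ = (0 : K) from h₃)]
    refine Finset.sum_congr rfl fun i _ => ?_
    rw [quad, (hp.map (y i)).prod_eq]
    simp
  exact hi (congrFun (hμ'.eq_zero h₁ hQ hy hinj hyQ) i)

end points

namespace Form

/-- The value of a linear form. -/
def eval {K : Type*} [Ring K] (f : Form) (y : Fin 6 → K) : K :=
  f.c₀.val * y 0 + f.c₁.val * y 1 + f.c₂.val * y 2 + f.c₃.val * y 3 + f.c₄.val * y 4 +
    f.c₅.val * y 5

theorem eval_ofInt {K : Type*} [Ring K] (a b c d e f : ℤ) (y : Fin 6 → K) :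
    (ofInt a b c d e f).eval y = a * y 0 + b * y 1 + c * y 2 + d * y 3 + e * y 4 + f * y 5 := by
  simp [eval, ofInt]

end Form

theorem lineval_crossMul {K : Type*} [Field K] (a b c d : Form) (y : Fin 6 → K) :
    lineval (((Form.crossMul a b c d).map SInt.val).map (Int.cast : ℤ → K)) (quad y) =
      a.eval y * b.eval y - c.eval y * d.eval y := by
  simp only [Form.crossMul, List.map_cons, List.map_nil, lineval, SInt.val_sub, SInt.val_add,
    SInt.val_mul, Model₄.val_minor, Int.cast_sub, Int.cast_add, Int.cast_mul]
  simp only [zero_add, Nat.reduceAdd, quad, quadIdx, List.getD_cons_succ, List.getD_cons_zero,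
    List.map_cons, List.map_nil, List.prod_cons, List.prod_nil, Form.eval]
  ring

namespace Quint

variable {K : Type*} [CommRing K]

/-- The value of a functional given by its coordinates. -/
def eval (t : Quint SInt) (X : Quint K) : K :=
  t.t₁₂.val * X.t₁₂ + t.t₁₃.val * X.t₁₃ + t.t₁₄.val * X.t₁₄ + t.t₂₃.val * X.t₂₃ +
    t.t₂₄.val * X.t₂₄

theorem eval_comb (a b c d : SInt) (q r s t : Quint SInt) (X : Quint K) :
    (comb a b c d q r s t).eval X =
      a.val * q.eval X + b.val * r.eval X + c.val * s.eval X + d.val * t.eval X := by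
  simp only [eval, comb, SInt.val_dot₄, Int.cast_add, Int.cast_mul]
  ring

/-- The Plücker coordinates of a three-dimensional subspace. -/
def plucker (X : Fin 3 → Quint K) : Fin 6 → K :=
  ![(fun i => (X i).t₁₂) ⬝ᵥ (fun i => (X i).t₁₃) ⨯₃ (fun i => (X i).t₂₄),
    (fun i => (X i).t₁₂) ⬝ᵥ (fun i => (X i).t₁₄) ⨯₃ (fun i => (X i).t₂₃),
    (fun i => (X i).t₁₃) ⬝ᵥ (fun i => (X i).t₁₄) ⨯₃ (fun i => (X i).t₂₃),
    (fun i => (X i).t₁₃) ⬝ᵥ (fun i => (X i).t₁₄) ⨯₃ (fun i => (X i).t₂₄),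
    (fun i => (X i).t₁₃) ⬝ᵥ (fun i => (X i).t₂₃) ⨯₃ (fun i => (X i).t₂₄),
    (fun i => (X i).t₁₄) ⬝ᵥ (fun i => (X i).t₂₃) ⨯₃ (fun i => (X i).t₂₄)]

/-- The linear relations between the Plücker coordinates of a subspace that meets the four tangent
lines. -/
structure Relations (X : Fin 3 → Quint K) : Prop where
  h₁ : (fun i => (X i).t₁₂) ⬝ᵥ (fun i => (X i).t₁₃) ⨯₃ (fun i => (X i).t₁₄) = 0
  h₂ : (fun i => (X i).t₁₂) ⬝ᵥ (fun i => (X i).t₂₃) ⨯₃ (fun i => (X i).t₂₄) = 0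
  h₃ : (fun i => (X i).t₁₂) ⬝ᵥ (fun i => (X i).t₁₃) ⨯₃ (fun i => (X i).t₂₃) =
    plucker X 2 - plucker X 4
  h₄ : (fun i => (X i).t₁₂) ⬝ᵥ (fun i => (X i).t₁₄) ⨯₃ (fun i => (X i).t₂₄) =
    plucker X 5 - plucker X 3

theorem dotProduct_cross (u v w : Fin 3 → K) : u ⬝ᵥ v ⨯₃ w = u 0 * (v 1 * w 2 - v 2 * w 1) +
    u 1 * (v 2 * w 0 - v 0 * w 2) + u 2 * (v 0 * w 1 - v 1 * w 0) := by
  simp [cross_apply, dotProduct, Fin.sum_univ_three]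

theorem Relations.eval_ofTriple {X : Fin 3 → Quint K} (h : Relations X) (f g k : Quint SInt) :
    (Form.ofTriple f g k).eval (plucker X) =
      (fun i => f.eval (X i)) ⬝ᵥ (fun i => g.eval (X i)) ⨯₃ (fun i => k.eval (X i)) := by
  obtain ⟨h₁, h₂, h₃, h₄⟩ := h
  rw [plucker] at h₃ h₄
  simp only [Form.eval, Form.ofTriple, Form.det₃, SInt.val_alt₃, Model₄.val_minor, SInt.val_add,
    SInt.val_sub, Int.cast_add, Int.cast_sub, Int.cast_mul, plucker]
  simp only [dotProduct_cross, eval] at h₁ h₂ h₃ h₄ ⊢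
  simp only [Matrix.cons_val] at h₁ h₂ h₃ h₄ ⊢
  generalize (f.t₁₂.val : K) = f₁, (f.t₁₃.val : K) = f₂, (f.t₁₄.val : K) = f₃,
    (f.t₂₃.val : K) = f₄, (f.t₂₄.val : K) = f₅, (g.t₁₂.val : K) = g₁, (g.t₁₃.val : K) = g₂,
    (g.t₁₄.val : K) = g₃, (g.t₂₃.val : K) = g₄, (g.t₂₄.val : K) = g₅, (k.t₁₂.val : K) = k₁,
    (k.t₁₃.val : K) = k₂, (k.t₁₄.val : K) = k₃, (k.t₂₃.val : K) = k₄, (k.t₂₄.val : K) = k₅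
  linear_combination
    -(f₁ * (g₂ * k₃ - g₃ * k₂) - f₂ * (g₁ * k₃ - g₃ * k₁) + f₃ * (g₁ * k₂ - g₂ * k₁)) * h₁ -
    (f₁ * (g₄ * k₅ - g₅ * k₄) - f₄ * (g₁ * k₅ - g₅ * k₁) + f₅ * (g₁ * k₄ - g₄ * k₁)) * h₂ -
    (f₁ * (g₂ * k₄ - g₄ * k₂) - f₂ * (g₁ * k₄ - g₄ * k₁) + f₄ * (g₁ * k₂ - g₂ * k₁)) * h₃ -
    (f₁ * (g₃ * k₅ - g₅ * k₃) - f₃ * (g₁ * k₅ - g₅ * k₁) + f₅ * (g₁ * k₃ - g₃ * k₁)) * h₄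

end Quint

/-- The three-term Plücker relation. -/
theorem dotProduct_cross_plucker {K : Type*} [CommRing K] (u a b c d : Fin 3 → K) :
    (u ⬝ᵥ a ⨯₃ b) * (u ⬝ᵥ c ⨯₃ d) - (u ⬝ᵥ a ⨯₃ c) * (u ⬝ᵥ b ⨯₃ d) +
      (u ⬝ᵥ a ⨯₃ d) * (u ⬝ᵥ b ⨯₃ c) = 0 := by
  simp only [Quint.dotProduct_cross]
  ring

theorem dotProduct_cross_swap {K : Type*} [CommRing K] (u v w : Fin 3 → K) :
    u ⬝ᵥ v ⨯₃ w = -(v ⬝ᵥ u ⨯₃ w) := by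
  simp only [Quint.dotProduct_cross]
  ring

theorem dotProduct_cross_rotate {K : Type*} [CommRing K] (u v w : Fin 3 → K) :
    u ⬝ᵥ v ⨯₃ w = v ⬝ᵥ w ⨯₃ u := by
  simp only [Quint.dotProduct_cross]
  ring

theorem Quint.Relations.satisfies_pluckerForms {K : Type*} [Field K] {X : Fin 3 → Quint K}
    (h : Relations X) : Satisfies pluckerForms (plucker X) := by
  obtain ⟨h₁, h₂, h₃, h₄⟩ := h
  intro q hq
  simp only [intRows, pluckerForms, List.map_cons, List.map_nil, List.mem_cons, List.not_mem_nil,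
    or_false] at hq
  set u := fun i => (X i).t₁₂
  set a := fun i => (X i).t₁₃
  set b := fun i => (X i).t₁₄
  set c := fun i => (X i).t₂₃
  set d := fun i => (X i).t₂₄
  have e₀ : plucker X 0 = u ⬝ᵥ a ⨯₃ d := rfl
  have e₁ : plucker X 1 = u ⬝ᵥ b ⨯₃ c := rfl
  have e₂ : plucker X 2 = a ⬝ᵥ b ⨯₃ c := rfl
  have e₃ : plucker X 3 = a ⬝ᵥ b ⨯₃ d := rfl
  have e₄ : plucker X 4 = a ⬝ᵥ c ⨯₃ d := rfl
  have e₅ : plucker X 5 = b ⬝ᵥ c ⨯₃ d := rfl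
  rw [e₂, e₄] at h₃
  rw [e₅, e₃] at h₄
  rcases hq with rfl | rfl | rfl | rfl | rfl <;> rw [lineval_crossMul] <;>
    simp only [Form.eval_ofInt, e₀, e₁, e₂, e₃, e₄, e₅]
  · have := dotProduct_cross_plucker u a b c d
    linear_combination this - (u ⬝ᵥ c ⨯₃ d) * h₁ + (u ⬝ᵥ a ⨯₃ c) * h₄ +
      (b ⬝ᵥ c ⨯₃ d - a ⬝ᵥ b ⨯₃ d) * h₃
  · have := dotProduct_cross_plucker a u b c d
    rw [dotProduct_cross_swap a u, dotProduct_cross_swap a u, dotProduct_cross_swap a u] at this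
    linear_combination this + (a ⬝ᵥ c ⨯₃ d) * h₁ - (a ⬝ᵥ b ⨯₃ d) * h₃
  · have := dotProduct_cross_plucker b u a c d
    rw [dotProduct_cross_rotate b u a, dotProduct_cross_swap b u, dotProduct_cross_swap b u,
      dotProduct_cross_swap b a, dotProduct_cross_swap b a] at this
    linear_combination this - (b ⬝ᵥ c ⨯₃ d) * h₁ - (a ⬝ᵥ b ⨯₃ c) * h₄
  · have := dotProduct_cross_plucker c u a b d
    rw [dotProduct_cross_rotate c u, dotProduct_cross_rotate c u, dotProduct_cross_rotate c a b,
      dotProduct_cross_swap c b, dotProduct_cross_swap c a, dotProduct_cross_swap c u] at this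
    linear_combination this + (a ⬝ᵥ b ⨯₃ c) * h₂ + (b ⬝ᵥ c ⨯₃ d) * h₃
  · have := dotProduct_cross_plucker d u a b c
    simp only [dotProduct_cross_rotate d] at this
    linear_combination this - (a ⬝ᵥ b ⨯₃ d) * h₂ + (a ⬝ᵥ c ⨯₃ d) * h₄

theorem square_linearCombination_eq {K : Type*} [Field K] (b c : K) (e : Fin 3 → Fin 5 → K)
    (d : Fin 3 → K) : square b c (Fintype.linearCombination K e d) =
      (fun i => square b c (e i)) ⬝ᵥ d := by
  simp [Fintype.linearCombination_apply, square, dotProduct, Fin.sum_univ_three]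
  ring

theorem exists_tangent_of_inf_ne_bot {e : Fin 3 → Fin 5 → ℂ} {κ : Fin 3 → ℂ} {b : ℂ}
    (h : (flagOf e κ).2 ⊓ oscF5 2 b ≠ ⊥) :
    ∃ d ≠ 0, ∃ α β, Fintype.linearCombination ℂ e d = tangent b α β := by
  obtain ⟨v, hv, h₀⟩ := (Submodule.ne_bot_iff _).1 h
  obtain ⟨h₁, h₂⟩ := Submodule.mem_inf.1 hv
  obtain ⟨d, rfl⟩ := (mem_flagOf_snd v).1 h₁
  obtain ⟨α, β, h₃⟩ := (mem_oscF5_two b _).1 h₂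
  exact ⟨d, fun hd => h₀ (by rw [hd, map_zero]), α, β, h₃⟩

theorem triple_square_eq_zero {e : Fin 3 → Fin 5 → ℂ} {κ : Fin 3 → ℂ} {b : ℂ}
    (h : (flagOf e κ).2 ⊓ oscF5 2 b ≠ ⊥) (c c' c'' : ℂ) :
    (fun i => square b c (e i)) ⬝ᵥ
      (fun i => square b c' (e i)) ⨯₃ (fun i => square b c'' (e i)) = 0 := by
  obtain ⟨d, hd, α, β, h⟩ := exists_tangent_of_inf_ne_bot h
  refine exists_ne_zero_of_triple.2 ⟨d, hd, ?_⟩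
  simp only [← square_linearCombination_eq, h, square_tangent, sub_self, zero_mul, and_self]

/-- The six squares are linearly dependent. -/
theorem sum_square_eq_zero {K : Type*} [CommRing K] (b₁ b₂ b₃ b₄ : K) (v : Fin 5 → K) :
    (b₁ - b₂) * (b₃ - b₄) * ((b₃ - b₄) * (b₃ - b₄)) * square b₁ b₂ v +
    (b₁ - b₃) * (b₄ - b₂) * ((b₂ - b₄) * (b₂ - b₄)) * square b₁ b₃ v +
    (b₁ - b₄) * (b₂ - b₃) * ((b₂ - b₃) * (b₂ - b₃)) * square b₁ b₄ v +
    (b₁ - b₄) * (b₂ - b₃) * ((b₁ - b₄) * (b₁ - b₄)) * square b₂ b₃ v +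
    (b₁ - b₃) * (b₄ - b₂) * ((b₁ - b₃) * (b₁ - b₃)) * square b₂ b₄ v +
    (b₁ - b₂) * (b₃ - b₄) * ((b₁ - b₂) * (b₁ - b₂)) * square b₃ b₄ v = 0 := by
  simp only [square]
  ring

namespace Split

/-- The values of the scaled squares. -/
def values {K : Type*} [CommRing K] (s : Split) (v : Fin 5 → K) : Quint K :=
  ⟨s.scales.t₁₂.val * square (s.b₁ : K) s.b₂ v, s.scales.t₁₃.val * square (s.b₁ : K) s.b₃ v,
    s.scales.t₁₄.val * square (s.b₁ : K) s.b₄ v, s.scales.t₂₃.val * square (s.b₂ : K) s.b₃ v,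
    s.scales.t₂₄.val * square (s.b₂ : K) s.b₄ v⟩

theorem sum_values {K : Type*} [CommRing K] (s : Split) (v : Fin 5 → K) :
    (s.values v).t₁₂ + (s.values v).t₁₃ + (s.values v).t₁₄ + (s.values v).t₂₃ + (s.values v).t₂₄ =
      -(((s.b₁ : K) - s.b₂) * (s.b₃ - s.b₄) * ((s.b₁ - s.b₂) * (s.b₁ - s.b₂))) *
        square (s.b₃ : K) s.b₄ v := by
  simp only [values, scales, SInt.val_mul, SInt.diff, SInt.val_mk]
  push_cast
  linear_combination sum_square_eq_zero (s.b₁ : K) s.b₂ s.b₃ s.b₄ v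

end Split

theorem dotProduct_cross_mul {K : Type*} [CommRing K] (a b c : K) (u v w : Fin 3 → K) :
    (fun i => a * u i) ⬝ᵥ (fun i => b * v i) ⨯₃ (fun i => c * w i) =
      a * b * c * (u ⬝ᵥ v ⨯₃ w) := by
  simp only [Quint.dotProduct_cross]
  ring

theorem Split.IsSol.relations {s : Split} {e : Fin 3 → Fin 5 → ℂ} {κ : Fin 3 → ℂ}
    (h : s.IsSol (flagOf e κ)) : Quint.Relations fun i => s.values (e i) := by
  obtain ⟨-, -, -, -, hb⟩ := h
  simp only [List.mem_cons, List.not_mem_nil, or_false, forall_eq_or_imp, forall_eq] at hb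
  obtain ⟨hb₁, hb₂, hb₃, hb₄⟩ := hb
  have h₁ : (fun i => (s.values (e i)).t₁₂) ⬝ᵥ (fun i => (s.values (e i)).t₁₃) ⨯₃
      (fun i => (s.values (e i)).t₁₄) = 0 := by
    simp only [Split.values, dotProduct_cross_mul, triple_square_eq_zero hb₁, mul_zero]
  have h₂ : (fun i => (s.values (e i)).t₁₂) ⬝ᵥ (fun i => (s.values (e i)).t₂₃) ⨯₃
      (fun i => (s.values (e i)).t₂₄) = 0 := by
    simp only [Split.values, square_comm (s.b₁ : ℂ) s.b₂, dotProduct_cross_mul,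
      triple_square_eq_zero hb₂, mul_zero]
  have h₃ : (fun i => (s.values (e i)).t₁₃) ⬝ᵥ (fun i => (s.values (e i)).t₂₃) ⨯₃
      (fun i => (s.values (e i)).t₁₂ + (s.values (e i)).t₁₃ + (s.values (e i)).t₁₄ +
        (s.values (e i)).t₂₃ + (s.values (e i)).t₂₄) = 0 := by
    simp only [Split.sum_values]
    simp only [Split.values, square_comm (s.b₁ : ℂ) s.b₃, square_comm (s.b₂ : ℂ) s.b₃,
      dotProduct_cross_mul, triple_square_eq_zero hb₃, mul_zero]
  have h₄ : (fun i => (s.values (e i)).t₁₄) ⬝ᵥ (fun i => (s.values (e i)).t₂₄) ⨯₃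
      (fun i => (s.values (e i)).t₁₂ + (s.values (e i)).t₁₃ + (s.values (e i)).t₁₄ +
        (s.values (e i)).t₂₃ + (s.values (e i)).t₂₄) = 0 := by
    simp only [Split.sum_values]
    simp only [Split.values, square_comm (s.b₁ : ℂ) s.b₄, square_comm (s.b₂ : ℂ) s.b₄,
      square_comm (s.b₃ : ℂ) s.b₄, dotProduct_cross_mul, triple_square_eq_zero hb₄, mul_zero]
  refine ⟨h₁, h₂, ?_, ?_⟩
  · simp only [Quint.plucker, Quint.dotProduct_cross, Matrix.cons_val] at h₃ ⊢
    linear_combination h₃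
  · simp only [Quint.plucker, Quint.dotProduct_cross, Matrix.cons_val] at h₄ ⊢
    linear_combination h₄

theorem SInt.val_eq_zero_of_abs {a : SInt} (h : Nat.beq a.abs 0) : a.val = 0 := by
  have h := Nat.eq_of_beq_eq_true h
  simp only [SInt.abs, Nat.add_eq, Nat.sub_eq] at h
  simp only [SInt.val]
  omega

theorem square_eq_squareCoeff {K : Type*} [CommRing K] (b c : ℕ) (v : Fin 5 → K) :
    square (b : K) c v = ∑ l : Fin 5, ((Split.squareCoeff b c l).val : K) * v l := by
  simp [square, Split.squareCoeff, Fin.sum_univ_five]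
  ring

namespace Split

variable {K : Type*} [CommRing K] {s : Split}

theorem eval_monomial (h : ∀ k < 5, ∀ l < 5, s.coordTest k l) (v : Fin 5 → K) (k : Fin 5) :
    (s.monomial k).eval (s.values v) = s.factor.val * v k := by
  have key (l : Fin 5) := congrArg (Int.cast : ℤ → K)
    (SInt.val_eq_zero_of_abs (h k k.2 l l.2))
  simp only [SInt.val_sub, SInt.val_add, SInt.val_mul, SInt.val_scale, Int.cast_zero, Int.cast_sub,
    Int.cast_add, Int.cast_mul, sub_eq_zero] at key
  have h₁ : ∑ l : Fin 5, (((if (k : ℕ) = l then 1 else 0 : ℕ) : ℤ) : K) * s.factor.val * v l =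
      s.factor.val * v k := by
    simp [← Fin.ext_iff]
  rw [← h₁]
  simp only [← key, Quint.eval, values, square_eq_squareCoeff, Finset.mul_sum,
    ← Finset.sum_add_distrib]
  exact Finset.sum_congr rfl fun l _ => by ring

theorem eval_cube_zero (h : ∀ k < 5, ∀ l < 5, s.coordTest k l) (v : Fin 5 → K) (a : ℕ) :
    (s.cube 0 a).eval (s.values v) = s.factor.val * osc₀ (a : K) v := by
  have h₀ := eval_monomial h v 0
  have h₁ := eval_monomial h v 1
  have h₂ := eval_monomial h v 2
  have h₃ := eval_monomial h v 3
  simp only [Fin.val_zero, Fin.val_one, Fin.val_two, show ((3 : Fin 5) : ℕ) = 3 from rfl]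
    at h₀ h₁ h₂ h₃
  simp only [cube, Quint.eval_comb, zero_add, h₀, h₁, h₂, h₃, SInt.val_mk, osc₀]
  push_cast
  ring

theorem eval_cube_one (h : ∀ k < 5, ∀ l < 5, s.coordTest k l) (v : Fin 5 → K) (a : ℕ) :
    (s.cube 1 a).eval (s.values v) = s.factor.val * osc₁ (a : K) v := by
  have h₁ := eval_monomial h v 1
  have h₂ := eval_monomial h v 2
  have h₃ := eval_monomial h v 3
  have h₄ := eval_monomial h v 4
  simp only [Fin.val_one, Fin.val_two, show ((3 : Fin 5) : ℕ) = 3 from rfl,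
    show ((4 : Fin 5) : ℕ) = 4 from rfl] at h₁ h₂ h₃ h₄
  simp only [cube, Quint.eval_comb, Nat.reduceAdd, h₁, h₂, h₃, h₄, SInt.val_mk, osc₁]
  push_cast
  ring

end Split

theorem triple_cross {K : Type*} [CommRing K] (u u' v v' w w' : Fin 3 → K) :
    (u ⬝ᵥ u' ⨯₃ v') * (v ⬝ᵥ w ⨯₃ w') - (u ⬝ᵥ u' ⨯₃ v) * (v' ⬝ᵥ w ⨯₃ w') =
      (u ⨯₃ u') ⬝ᵥ (v ⨯₃ v') ⨯₃ (w ⨯₃ w') := by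
  simp only [Quint.dotProduct_cross]
  simp only [cross_apply, Matrix.cons_val]
  ring

namespace Split

variable {s : Split} {e : Fin 3 → Fin 5 → ℂ} {κ : Fin 3 → ℂ}

theorem lineval_triple (h : ∀ k < 5, ∀ l < 5, s.coordTest k l)
    (hX : Quint.Relations fun i => s.values (e i)) (he : LinearIndependent ℂ e) (hκ : κ ≠ 0)
    {a b c : ℕ} (ha : (flagOf e κ).1 ⊓ oscF5 3 a ≠ ⊥) (hb : (flagOf e κ).1 ⊓ oscF5 3 b ≠ ⊥)
    (hc : (flagOf e κ).1 ⊓ oscF5 3 c ≠ ⊥) :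
    lineval (((s.triple a b c).map SInt.val).map (Int.cast : ℤ → ℂ))
      (quad (Quint.plucker fun i => s.values (e i))) = 0 := by
  rw [flagOf_fst_inf_oscF5_ne_bot he, dotProduct_comm] at ha hb hc
  rw [triple, lineval_crossMul]
  simp only [hX.eval_ofTriple, eval_cube_zero h, eval_cube_one h, dotProduct_cross_mul]
  have h₀ := exists_ne_zero_of_triple.2 ⟨κ, hκ, ha, hb, hc⟩
  rw [← triple_cross] at h₀
  linear_combination (s.factor.val : ℂ) ^ 6 * h₀

theorem IsSol.satisfies (h : ∀ k < 5, ∀ l < 5, s.coordTest k l) (hs : s.IsSol (flagOf e κ))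
    (he : LinearIndependent ℂ e) (hκ : κ ≠ 0) :
    Satisfies s.quadrics (Quint.plucker fun i => s.values (e i)) := by
  have hX := hs.relations
  obtain ⟨-, -, -, ha, -⟩ := hs
  simp only [List.mem_cons, List.not_mem_nil, or_false, forall_eq_or_imp, forall_eq] at ha
  obtain ⟨h₁, h₂, h₃, h₄⟩ := ha
  intro q hq
  simp only [intRows, quadrics, List.map_cons, List.mem_cons] at hq
  rcases hq with rfl | rfl | rfl | rfl | hq
  · exact lineval_triple h hX he hκ h₁ h₂ h₃
  · exact lineval_triple h hX he hκ h₁ h₂ h₄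
  · exact lineval_triple h hX he hκ h₁ h₃ h₄
  · exact lineval_triple h hX he hκ h₂ h₃ h₄
  · exact hX.satisfies_pluckerForms q hq

end Split

section minors

variable {K : Type*}

/-- The maximal minors of a matrix with three rows. -/
def minors [CommRing K] (e : Fin 3 → Fin 5 → K) (i j k : Fin 5) : K :=
  (fun r => e r i) ⬝ᵥ (fun r => e r j) ⨯₃ (fun r => e r k)

theorem eq_zero_of_dotProduct_eq_zero [Field K] {e : Fin 3 → Fin 5 → K}
    (he : LinearIndependent K e) {d : Fin 3 → K} (h : ∀ i, (fun r => e r i) ⬝ᵥ d = 0) : d = 0 := by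
  refine linearIndependent_iff_injective_fintypeLinearCombination.1 he ?_
  ext i
  simpa [Fintype.linearCombination_apply, dotProduct, mul_comm] using h i

theorem exists_minors_ne_zero [Field K] {e : Fin 3 → Fin 5 → K} (he : LinearIndependent K e) :
    ∃ i j k, minors e i j k ≠ 0 := by
  by_contra! h
  have h₁ (j k : Fin 5) : (fun r => e r j) ⨯₃ (fun r => e r k) = 0 :=
    eq_zero_of_dotProduct_eq_zero he fun i => h i j k
  refine he.ne_zero 1 (funext fun j => ?_)
  have h₂ := eq_zero_of_dotProduct_eq_zero he (d := ![0, -e 2 j, e 1 j]) fun k => by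
    have := congrFun (h₁ j k) 0
    simp only [cross_apply, Matrix.cons_val, Pi.zero_apply] at this
    simp only [dotProduct, Fin.sum_univ_three, Matrix.cons_val]
    linear_combination this
  exact congrFun h₂ 2

theorem mem_flagOf_snd_of_minors [Field K] {e : Fin 3 → Fin 5 → K} {κ : Fin 3 → K} {w : Fin 5 → K}
    {j k l : Fin 5} (h : minors e j k l ≠ 0) (hw : ∀ i, w i * minors e j k l -
      w j * minors e i k l + w k * minors e i j l - w l * minors e i j k = 0) :
    w ∈ (flagOf e κ).2 := by
  refine (mem_flagOf_snd w).2 ⟨(minors e j k l)⁻¹ • (w j • (fun r => e r k) ⨯₃ (fun r => e r l) -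
    w k • (fun r => e r j) ⨯₃ (fun r => e r l) + w l • (fun r => e r j) ⨯₃ (fun r => e r k)), ?_⟩
  ext i
  rw [map_smul, Pi.smul_apply, smul_eq_mul, inv_mul_eq_iff_eq_mul₀ h]
  have key (d : Fin 3 → K) : Fintype.linearCombination K e d i = (fun r => e r i) ⬝ᵥ d := by
    simp [Fintype.linearCombination_apply, dotProduct, mul_comm]
  rw [key, dotProduct_add, dotProduct_sub, dotProduct_smul, dotProduct_smul, dotProduct_smul]
  simp only [smul_eq_mul]
  have := hw i
  simp only [minors] at this ⊢
  linear_combination -this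

theorem minors_expand [CommRing K] (e : Fin 3 → Fin 5 → K) (r : Fin 3) (i j k l : Fin 5) :
    e r i * minors e j k l - e r j * minors e i k l + e r k * minors e i j l -
      e r l * minors e i j k = 0 := by
  simp only [minors, Quint.dotProduct_cross]
  fin_cases r <;> simp only [Fin.zero_eta, Fin.mk_one, Fin.reduceFinMk] <;> ring

theorem flagOf_snd_eq_of_minors [Field K] {e e' : Fin 3 → Fin 5 → K} (κ κ' : Fin 3 → K)
    (he : LinearIndependent K e) (he' : LinearIndependent K e') {c : K}
    (h : ∀ i j k, minors e i j k = c * minors e' i j k) : (flagOf e κ).2 = (flagOf e' κ').2 := by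
  obtain ⟨j, k, l, h₀⟩ := exists_minors_ne_zero he
  rw [h, mul_ne_zero_iff] at h₀
  refine Submodule.eq_of_le_of_finrank_eq ?_
    ((finrank_flagOf_snd he).trans (finrank_flagOf_snd he').symm)
  rw [flagOf, Submodule.span_le]
  rintro _ ⟨r, rfl⟩
  refine mem_flagOf_snd_of_minors h₀.2 fun i => mul_left_cancel₀ h₀.1 ?_
  have := minors_expand e r i j k l
  rw [h, h, h, h] at this
  linear_combination this

end minors

namespace Split

variable {s : Split}

theorem factor_ne_zero {K : Type*} [Field K] [CharZero K] (hb : s.DistinctB) :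
    (s.factor.val : K) ≠ 0 := by
  obtain ⟨⟨h₁₂, h₁₃, h₁₄⟩, ⟨h₂₃, h₂₄⟩, h₃₄⟩ := hb.ne
  have key {m n : ℕ} (h : m ≠ n) : (m : ℤ) - n ≠ 0 := sub_ne_zero.2 (Nat.cast_injective.ne h)
  rw [Int.cast_ne_zero]
  simp [factor, scale, scales, SInt.diff, key h₁₂, key h₁₃, key h₁₄, key h₂₃, key h₂₄, key h₃₄,
    key h₂₄.symm]

theorem minors_eq (h : ∀ k < 5, ∀ l < 5, s.coordTest k l) {K : Type*} [CommRing K]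
    {e : Fin 3 → Fin 5 → K} (hX : Quint.Relations fun i => s.values (e i)) (i j k : Fin 5) :
    (Form.ofTriple (s.monomial i) (s.monomial j) (s.monomial k)).eval
      (Quint.plucker fun i => s.values (e i)) = s.factor.val ^ 3 * minors e i j k := by
  rw [hX.eval_ofTriple]
  simp only [eval_monomial h, dotProduct_cross_mul, minors]
  ring

variable {e e' : Fin 3 → Fin 5 → ℂ} {κ κ' : Fin 3 → ℂ}

theorem IsSol.plucker_ne_zero (hb : s.DistinctB) (h : ∀ k < 5, ∀ l < 5, s.coordTest k l)
    (hs : s.IsSol (flagOf e κ)) (he : LinearIndependent ℂ e) :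
    Quint.plucker (fun i => s.values (e i)) ≠ 0 := by
  intro h₀
  obtain ⟨i, j, k, hijk⟩ := exists_minors_ne_zero he
  have := minors_eq h hs.relations i j k
  rw [h₀] at this
  simp [Form.eval, hijk, factor_ne_zero hb] at this

theorem IsSol.snd_eq (hb : s.DistinctB) (h : ∀ k < 5, ∀ l < 5, s.coordTest k l)
    (hs : s.IsSol (flagOf e κ)) (hs' : s.IsSol (flagOf e' κ')) (he : LinearIndependent ℂ e)
    (he' : LinearIndependent ℂ e') {c : ℂ} (hc : Quint.plucker (fun i => s.values (e i)) =
      c • Quint.plucker (fun i => s.values (e' i))) : (flagOf e κ).2 = (flagOf e' κ').2 := by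
  refine flagOf_snd_eq_of_minors κ κ' he he' (c := c) fun i j k => ?_
  have h₁ := minors_eq h hs.relations i j k
  have h₂ := minors_eq h hs'.relations i j k
  refine mul_left_cancel₀ (pow_ne_zero 3 (factor_ne_zero (K := ℂ) hb)) ?_
  rw [← h₁, mul_left_comm, ← h₂, hc]
  simp only [Form.eval, Pi.smul_apply, smul_eq_mul]
  ring

end Split

section

variable {K : Type*} [Field K]

theorem eq_zero_of_osc_eq_zero [CharZero K] {a b c : K} (hab : a ≠ b) (hac : a ≠ c) (hbc : b ≠ c)
    {v : Fin 5 → K} (ha : osc₀ a v = 0) (ha' : osc₁ a v = 0) (hb : osc₀ b v = 0)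
    (hb' : osc₁ b v = 0) (hc : osc₀ c v = 0) (hc' : osc₁ c v = 0) : v = 0 := by
  have hab := sub_ne_zero.2 hab
  have hac := sub_ne_zero.2 hac
  have hbc := sub_ne_zero.2 hbc
  have key {x₀ x₁ x₂ x₃ : K} (h₁ : x₀ - x₁ * a + x₂ * a ^ 2 - x₃ * a ^ 3 = 0)
      (h₂ : x₀ - x₁ * b + x₂ * b ^ 2 - x₃ * b ^ 3 = 0)
      (h₃ : x₀ - x₁ * c + x₂ * c ^ 2 - x₃ * c ^ 3 = 0) :
      x₂ = x₃ * (a + b + c) ∧ x₁ = x₃ * (a * b + a * c + b * c) ∧ x₀ = x₃ * (a * b * c) := by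
    have e₁ : -x₁ + x₂ * (a + b) - x₃ * (a ^ 2 + a * b + b ^ 2) = 0 := by
      refine mul_left_cancel₀ hab ?_
      linear_combination h₁ - h₂
    have e₂ : -x₁ + x₂ * (a + c) - x₃ * (a ^ 2 + a * c + c ^ 2) = 0 := by
      refine mul_left_cancel₀ hac ?_
      linear_combination h₁ - h₃
    have e₃ : x₂ = x₃ * (a + b + c) := by
      refine mul_left_cancel₀ hbc ?_
      linear_combination e₁ - e₂
    have e₄ : x₁ = x₃ * (a * b + a * c + b * c) := by
      linear_combination -e₁ + (a + b) * e₃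
    refine ⟨e₃, e₄, ?_⟩
    linear_combination h₁ + a * e₄ - a ^ 2 * e₃
  obtain ⟨h₁, h₂, h₃⟩ := key (x₀ := v 3) (x₁ := 3 * v 2) (x₂ := 3 * v 1) (x₃ := v 0)
    (by rw [← ha, osc₀]; ring) (by rw [← hb, osc₀]; ring) (by rw [← hc, osc₀]; ring)
  obtain ⟨h₄, h₅, h₆⟩ := key (x₀ := v 4) (x₁ := 3 * v 3) (x₂ := 3 * v 2) (x₃ := v 1)
    (by rw [← ha', osc₁]; ring) (by rw [← hb', osc₁]; ring) (by rw [← hc', osc₁]; ring)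
  have h₀ : v 0 = 0 := by
    have e : 3 * ((a - b) * (a - c) * (b - c)) ^ 2 * v 0 = 0 := by
      set p := a + b + c
      set q := a * b + a * c + b * c
      set r := a * b * c
      have e₁ : v 0 * (p ^ 2 - 3 * q) = 0 := by
        linear_combination 3 * h₂ - 3 * h₄ - p * h₁
      have e₂ : v 0 * (p * q - 9 * r) = 0 := by
        linear_combination 9 * h₃ - 3 * h₅ - q * h₁
      have e₃ : 3 * ((a - b) * (a - c) * (b - c)) ^ 2 =
          4 * (p ^ 2 - 3 * q) * (q ^ 2 - 3 * p * r) - (p * q - 9 * r) ^ 2 := by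
        ring
      rw [e₃]
      linear_combination 4 * (q ^ 2 - 3 * p * r) * e₁ - (p * q - 9 * r) * e₂
    simpa [hab, hac, hbc] using e
  have h₁' : v 1 = 0 := by simpa [h₀] using h₁
  rw [h₀, zero_mul, mul_eq_zero, or_iff_right three_ne_zero] at h₂
  rw [h₀, zero_mul] at h₃
  rw [h₁', zero_mul] at h₆
  ext i
  fin_cases i
  exacts [h₀, h₁', h₂, h₃, h₆]

theorem eq_zero_of_three_roots {a b c : K} (hab : a ≠ b) (hac : a ≠ c) (hbc : b ≠ c) {p q r : K}
    (h₁ : p + q * a + r * a ^ 2 = 0) (h₂ : p + q * b + r * b ^ 2 = 0)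
    (h₃ : p + q * c + r * c ^ 2 = 0) : p = 0 ∧ q = 0 ∧ r = 0 := by
  have e₁ : q + r * (a + b) = 0 := by
    refine mul_left_cancel₀ (sub_ne_zero.2 hab) ?_
    linear_combination h₁ - h₂
  have e₂ : q + r * (a + c) = 0 := by
    refine mul_left_cancel₀ (sub_ne_zero.2 hac) ?_
    linear_combination h₁ - h₃
  have e₃ : r = 0 := by
    refine mul_left_cancel₀ (sub_ne_zero.2 hbc) ?_
    linear_combination e₁ - e₂
  rw [e₃, zero_mul, add_zero] at e₁
  rw [e₁, e₃, zero_mul, zero_mul, add_zero, add_zero] at h₁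
  exact ⟨h₁, e₁, e₃⟩

theorem mul_add_mul_eq_zero_of_osc_tangent {a b l m α β : K} (hab : b ≠ a)
    (h : l * osc₀ a (tangent b α β) + m * osc₁ a (tangent b α β) = 0) :
    α * ((l + m * b) * (b - a)) + β * (3 * (l + m * b) + m * (b - a)) = 0 := by
  refine mul_left_cancel₀ (pow_ne_zero 2 (sub_ne_zero.2 hab)) ?_
  rw [mul_zero, ← h]
  simp [osc₀, osc₁, tangent]
  ring

theorem false_of_wronskian [CharZero K] {a a' l m l' m' : K} (ha : a ≠ a') (h₀ : l ≠ 0 ∨ m ≠ 0)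
    (h₀' : l' ≠ 0 ∨ m' ≠ 0) {b : Fin 3 → K} (hb : Function.Injective b)
    (h : ∀ i, 3 * (l + m * b i) * (l' + m' * b i) * (a' - a) +
      (b i - a) * (b i - a') * (l * m' - l' * m) = 0) : False := by
  obtain ⟨e₀, e₁, e₂⟩ := eq_zero_of_three_roots (hb.ne (show (0 : Fin 3) ≠ 1 by decide))
    (hb.ne (show (0 : Fin 3) ≠ 2 by decide)) (hb.ne (show (1 : Fin 3) ≠ 2 by decide))
    (p := 3 * l * l' * (a' - a) + a * a' * (l * m' - l' * m))
    (q := 3 * (l * m' + l' * m) * (a' - a) - (a + a') * (l * m' - l' * m))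
    (r := 3 * m * m' * (a' - a) + (l * m' - l' * m)) (by rw [← h 0]; ring) (by rw [← h 1]; ring)
    (by rw [← h 2]; ring)
  have ha' := sub_ne_zero.2 ha.symm
  have h₁ : (l + m * a) * (l' + m' * a) = 0 := by
    have : 3 * ((l + m * a) * (l' + m' * a)) = 0 := mul_left_cancel₀ ha' (by
      linear_combination e₀ + a * e₁ + a ^ 2 * e₂)
    exact (mul_eq_zero.1 this).resolve_left three_ne_zero
  have h₂ : (l + m * a') * (l' + m' * a') = 0 := by
    have : 3 * ((l + m * a') * (l' + m' * a')) = 0 := mul_left_cancel₀ ha' (by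
      linear_combination e₀ + a' * e₁ + a' ^ 2 * e₂)
    exact (mul_eq_zero.1 this).resolve_left three_ne_zero
  have key {x y : K} (hx : x + y * a = 0) (hy : x + y * a' = 0) : x = 0 ∧ y = 0 := by
    have h : y = 0 := by
      refine mul_left_cancel₀ ha' ?_
      linear_combination hy - hx
    exact ⟨by simpa [h] using hx, h⟩
  rcases mul_eq_zero.1 h₁ with h₃ | h₃ <;> rcases mul_eq_zero.1 h₂ with h₄ | h₄
  · have := key h₃ h₄
    tauto
  · have : 4 * (m * m') = 0 := mul_left_cancel₀ ha' (by
      linear_combination e₂ - m' * h₃ + m * h₄)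
    rcases mul_eq_zero.1 ((mul_eq_zero.1 this).resolve_left (OfNat.ofNat_ne_zero 4)) with rfl | rfl
    · simp [h₀.resolve_right (by simp)] at h₃
    · simp [h₀'.resolve_right (by simp)] at h₄
  · have : 2 * (m * m') = 0 := mul_left_cancel₀ ha' (by
      linear_combination e₂ + m * h₃ - m' * h₄)
    rcases mul_eq_zero.1 ((mul_eq_zero.1 this).resolve_left two_ne_zero) with rfl | rfl
    · simp [h₀.resolve_right (by simp)] at h₄
    · simp [h₀'.resolve_right (by simp)] at h₃
  · have := key h₃ h₄
    tauto

theorem exists_of_cross_eq_zero {u v : Fin 3 → K} (h : u ⨯₃ v = 0) :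
    ∃ l m : K, (l ≠ 0 ∨ m ≠ 0) ∧ ∀ i, l * u i + m * v i = 0 := by
  have h₀ := congrFun h 0
  have h₁ := congrFun h 1
  have h₂ := congrFun h 2
  simp only [cross_apply, Matrix.cons_val, Pi.zero_apply] at h₀ h₁ h₂
  by_cases hv : v = 0
  · exact ⟨0, 1, by simp [hv]⟩
  · obtain ⟨j, hj⟩ := Function.ne_iff.1 hv
    refine ⟨v j, -u j, .inl hj, fun i => ?_⟩
    fin_cases j <;> fin_cases i <;> simp only [Fin.zero_eta, Fin.mk_one, Fin.reduceFinMk] <;> grind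

theorem mul_dotProduct_cross (t u v w : Fin 3 → K) (i : Fin 3) : t i * (u ⬝ᵥ v ⨯₃ w) =
    (u ⬝ᵥ t) * (v ⨯₃ w) i + (v ⬝ᵥ t) * (w ⨯₃ u) i + (w ⬝ᵥ t) * (u ⨯₃ v) i := by
  simp only [dotProduct, Fin.sum_univ_three]
  fin_cases i <;> simp only [cross_apply, Fin.zero_eta, Fin.mk_one, Fin.reduceFinMk,
    Matrix.cons_val] <;> ring

theorem dotProduct_eq_zero_of_cross {κ κ' u v : Fin 3 → K} (h : κ ⬝ᵥ u ⨯₃ v = 0)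
    (h' : κ' ⬝ᵥ u ⨯₃ v = 0) :
    u ⨯₃ v = 0 ∨ u ⬝ᵥ κ ⨯₃ κ' = 0 ∧ v ⬝ᵥ κ ⨯₃ κ' = 0 := by
  rw [or_iff_not_imp_left]
  intro h₀
  obtain ⟨i, hi⟩ := Function.ne_iff.1 h₀
  have key (w : Fin 3 → K) (hw : w ⬝ᵥ u ⨯₃ v = 0) : w ⬝ᵥ κ ⨯₃ κ' = 0 := by
    refine mul_left_cancel₀ hi ?_
    rw [mul_dotProduct_cross, h, h', hw]
    simp
  exact ⟨key u (dot_self_cross u v), key v (dot_cross_self u v)⟩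

theorem flagOf_eq_of_cross_eq_zero {e : Fin 3 → Fin 5 → K} {κ κ' : Fin 3 → K} (hκ : κ ≠ 0)
    (hκ' : κ' ≠ 0) (h : κ ⨯₃ κ' = 0) : flagOf e κ = flagOf e κ' := by
  obtain ⟨l, m, hlm, h⟩ := exists_of_cross_eq_zero h
  have hl : l ≠ 0 := by
    rintro rfl
    refine hκ' (funext fun i => ?_)
    simpa [hlm.resolve_left (by simp)] using h i
  have hm : m ≠ 0 := by
    rintro rfl
    refine hκ (funext fun i => ?_)
    simpa [hl] using h i
  have hd (d : Fin 3 → K) : l * (κ ⬝ᵥ d) + m * (κ' ⬝ᵥ d) = 0 := by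
    simp only [dotProduct, Fin.sum_univ_three]
    linear_combination d 0 * h 0 + d 1 * h 1 + d 2 * h 2
  refine Prod.ext (Submodule.ext fun v => ?_) rfl
  rw [mem_flagOf_fst, mem_flagOf_fst]
  refine exists_congr fun d => and_congr_left fun _ => ⟨fun h₁ => ?_, fun h₁ => ?_⟩
  · simpa [h₁, hm] using hd d
  · simpa [h₁, hl] using hd d

end

theorem false_of_cross_osc_eq_zero {e : Fin 3 → Fin 5 → ℂ} {κ : Fin 3 → ℂ}
    (he : LinearIndependent ℂ e) {a a' : ℂ} (ha : a ≠ a')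
    (h : (fun i => osc₀ a (e i)) ⨯₃ (fun i => osc₁ a (e i)) = 0)
    (h' : (fun i => osc₀ a' (e i)) ⨯₃ (fun i => osc₁ a' (e i)) = 0) {b : Fin 3 → ℂ}
    (hb : Function.Injective b) (hba : ∀ i, b i ≠ a ∧ b i ≠ a')
    (hp : ∀ i, (flagOf e κ).2 ⊓ oscF5 2 (b i) ≠ ⊥) : False := by
  obtain ⟨l, m, h₀, h⟩ := exists_of_cross_eq_zero h
  obtain ⟨l', m', h₀', h'⟩ := exists_of_cross_eq_zero h'
  refine false_of_wronskian ha h₀ h₀' hb fun i => ?_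
  obtain ⟨d, hd, α, β, ht⟩ := exists_tangent_of_inf_ne_bot (hp i)
  have key {x l m : ℂ} (h : ∀ i, l * osc₀ x (e i) + m * osc₁ x (e i) = 0) :
      l * osc₀ x (tangent (b i) α β) + m * osc₁ x (tangent (b i) α β) = 0 := by
    rw [← ht, osc₀_linearCombination, osc₁_linearCombination]
    simp only [dotProduct, Fin.sum_univ_three]
    linear_combination d 0 * h 0 + d 1 * h 1 + d 2 * h 2
  have e₁ := mul_add_mul_eq_zero_of_osc_tangent (hba i).1 (key h)
  have e₂ := mul_add_mul_eq_zero_of_osc_tangent (hba i).2 (key h')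
  by_cases hα : α = 0
  · have hβ : β ≠ 0 := by
      rintro rfl
      refine hd (linearIndependent_iff_injective_fintypeLinearCombination.1 he ?_)
      rw [ht, hα, map_zero]
      ext j
      fin_cases j <;> simp [tangent]
    refine mul_left_cancel₀ hβ ?_
    linear_combination ((l + m * b i) * (b i - a)) * e₂ - ((l' + m' * b i) * (b i - a')) * e₁
  · refine mul_left_cancel₀ hα ?_
    linear_combination (3 * (l' + m' * b i) + m' * (b i - a')) * e₁ -
      (3 * (l + m * b i) + m * (b i - a)) * e₂

namespace Split

variable {s : Split}

/-- The eight points are distinct. -/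
def Distinct (s : Split) : Prop :=
  [s.a₁, s.a₂, s.a₃, s.a₄, s.b₁, s.b₂, s.b₃, s.b₄].Nodup

theorem Distinct.distinctB (h : s.Distinct) : s.DistinctB :=
  ((List.nodup_append (l₁ := [s.a₁, s.a₂, s.a₃, s.a₄])).1 h).2.1

theorem IsSol.flagOf_eq (hd : s.Distinct) {e : Fin 3 → Fin 5 → ℂ} {κ κ' : Fin 3 → ℂ}
    (he : LinearIndependent ℂ e) (hκ : κ ≠ 0) (hκ' : κ' ≠ 0) (hs : s.IsSol (flagOf e κ))
    (hs' : s.IsSol (flagOf e κ')) : flagOf e κ = flagOf e κ' := by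
  by_contra hne
  have h₀ : κ ⨯₃ κ' ≠ 0 := fun h => hne (flagOf_eq_of_cross_eq_zero hκ hκ' h)
  have hv : Fintype.linearCombination ℂ e (κ ⨯₃ κ') ≠ 0 := by
    rw [← map_zero (Fintype.linearCombination ℂ e)]
    exact (linearIndependent_iff_injective_fintypeLinearCombination.1 he).ne h₀
  obtain ⟨-, -, -, ha, hb⟩ := hs
  obtain ⟨-, -, -, ha', -⟩ := hs'
  have key (a : ℕ) (h : a ∈ [s.a₁, s.a₂, s.a₃, s.a₄]) :
      (fun i => osc₀ (a : ℂ) (e i)) ⨯₃ (fun i => osc₁ (a : ℂ) (e i)) = 0 ∨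
      osc₀ (a : ℂ) (Fintype.linearCombination ℂ e (κ ⨯₃ κ')) = 0 ∧
        osc₁ (a : ℂ) (Fintype.linearCombination ℂ e (κ ⨯₃ κ')) = 0 := by
    rw [osc₀_linearCombination, osc₁_linearCombination]
    exact dotProduct_eq_zero_of_cross ((flagOf_fst_inf_oscF5_ne_bot he _).1 (ha a h))
      ((flagOf_fst_inf_oscF5_ne_bot he _).1 (ha' a h))
  have h₃ {a b c : ℕ} (hab : a ≠ b) (hac : a ≠ c) (hbc : b ≠ c)
      (h₁ : osc₀ (a : ℂ) (Fintype.linearCombination ℂ e (κ ⨯₃ κ')) = 0 ∧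
        osc₁ (a : ℂ) (Fintype.linearCombination ℂ e (κ ⨯₃ κ')) = 0)
      (h₂ : osc₀ (b : ℂ) (Fintype.linearCombination ℂ e (κ ⨯₃ κ')) = 0 ∧
        osc₁ (b : ℂ) (Fintype.linearCombination ℂ e (κ ⨯₃ κ')) = 0)
      (h₃ : osc₀ (c : ℂ) (Fintype.linearCombination ℂ e (κ ⨯₃ κ')) = 0 ∧
        osc₁ (c : ℂ) (Fintype.linearCombination ℂ e (κ ⨯₃ κ')) = 0) : False :=
    hv (eq_zero_of_osc_eq_zero (Nat.cast_injective.ne hab) (Nat.cast_injective.ne hac)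
      (Nat.cast_injective.ne hbc) h₁.1 h₁.2 h₂.1 h₂.2 h₃.1 h₃.2)
  obtain ⟨⟨h₁₂, h₁₃, -⟩, ⟨h₂₃, -⟩, -⟩ := hd.distinctB.ne
  have h₂ {a a' : ℕ} (haa : a ≠ a')
      (h : (a ≠ s.b₁ ∧ a ≠ s.b₂ ∧ a ≠ s.b₃) ∧ a' ≠ s.b₁ ∧ a' ≠ s.b₂ ∧ a' ≠ s.b₃)
      (h₁ : (fun i => osc₀ (a : ℂ) (e i)) ⨯₃ (fun i => osc₁ (a : ℂ) (e i)) = 0)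
      (h₂ : (fun i => osc₀ (a' : ℂ) (e i)) ⨯₃ (fun i => osc₁ (a' : ℂ) (e i)) = 0) : False := by
    refine false_of_cross_osc_eq_zero he (Nat.cast_injective.ne haa) h₁ h₂ (κ := κ)
      (b := fun i => (![s.b₁, s.b₂, s.b₃] i : ℕ)) (Nat.cast_injective.comp ?_) ?_ ?_
    · intro i j
      fin_cases i <;> fin_cases j <;> simp [h₁₂, h₁₃, h₂₃, h₁₂.symm, h₁₃.symm, h₂₃.symm]
    · obtain ⟨⟨g₁, g₂, g₃⟩, g₁', g₂', g₃'⟩ := h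
      intro i
      fin_cases i <;> simp [g₁.symm, g₂.symm, g₃.symm, g₁'.symm, g₂'.symm, g₃'.symm]
    · intro i
      refine hb _ ?_
      fin_cases i <;> simp
  simp only [Distinct, List.nodup_cons, List.mem_cons, not_or, List.not_mem_nil] at hd
  simp only [List.mem_cons, List.not_mem_nil, or_false, forall_eq_or_imp, forall_eq] at key
  obtain ⟨k₁, k₂, k₃, k₄⟩ := key
  rcases k₁ with k₁ | k₁ <;> rcases k₂ with k₂ | k₂
  · exact h₂ (by tauto) (by tauto) k₁ k₂
  · rcases k₃ with k₃ | k₃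
    · exact h₂ (by tauto) (by tauto) k₁ k₃
    rcases k₄ with k₄ | k₄
    · exact h₂ (by tauto) (by tauto) k₁ k₄
    · exact h₃ (by tauto) (by tauto) (by tauto) k₂ k₃ k₄
  · rcases k₃ with k₃ | k₃
    · exact h₂ (by tauto) (by tauto) k₂ k₃
    rcases k₄ with k₄ | k₄
    · exact h₂ (by tauto) (by tauto) k₂ k₄
    · exact h₃ (by tauto) (by tauto) (by tauto) k₁ k₃ k₄
  · rcases k₃ with k₃ | k₃
    · rcases k₄ with k₄ | k₄
      · exact h₂ (by tauto) (by tauto) k₃ k₄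
      · exact h₃ (by tauto) (by tauto) (by tauto) k₁ k₂ k₄
    · exact h₃ (by tauto) (by tauto) (by tauto) k₁ k₂ k₃

theorem IsSol.eq_of_snd_eq (hd : s.Distinct)
    {p p' : Submodule ℂ (Fin 5 → ℂ) × Submodule ℂ (Fin 5 → ℂ)} (hs : s.IsSol p) (hs' : s.IsSol p')
    (h : p.2 = p'.2) : p = p' := by
  obtain ⟨E, F⟩ := p
  obtain ⟨E', F'⟩ := p'
  obtain rfl : F = F' := h
  let B := Module.finBasisOfFinrankEq ℂ F hs.2.1
  obtain ⟨κ, hκ, h⟩ := exists_flagOf B hs.1 hs.2.2.1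
  obtain ⟨κ', hκ', h'⟩ := exists_flagOf B hs'.1 hs'.2.2.1
  rw [h] at hs ⊢
  rw [h'] at hs' ⊢
  exact hs.flagOf_eq hd (B.linearIndependent.map' F.subtype F.ker_subtype) hκ hκ' hs'

theorem not_isSol_of_upperTest (hd : s.Distinct) (h : s.upperTest)
    {f : Fin 13 → Submodule ℂ (Fin 5 → ℂ) × Submodule ℂ (Fin 5 → ℂ)} (hf : Function.Injective f)
    (hs : ∀ i, s.IsSol (f i)) : False := by
  simp only [upperTest, Bool.and_eq_true, List.all_eq_true, List.mem_range] at h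
  obtain ⟨⟨h₁, h₂⟩, h₃⟩ := h
  have hB (i) : ∃ e κ, LinearIndependent ℂ e ∧ κ ≠ 0 ∧ f i = flagOf e κ := by
    let B := Module.finBasisOfFinrankEq ℂ (f i).2 (hs i).2.1
    obtain ⟨κ, hκ, h⟩ := exists_flagOf B (hs i).1 (hs i).2.2.1
    exact ⟨_, κ, B.linearIndependent.map' (f i).2.subtype (f i).2.ker_subtype, hκ, h⟩
  choose e κ he hκ hf' using hB
  refine not_satisfies_of_ne (K := ℂ) (x := fun i => Quint.plucker fun j => s.values (e i j)) h₁ h₂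
    ?_ rfl ?_ ?_ ?_
  · simp only [quadrics, pluckerForms, List.mem_cons, List.not_mem_nil, or_false]
    rintro q (rfl | rfl | rfl | rfl | rfl | rfl | rfl | rfl | rfl) <;> rfl
  · exact fun i => ((hf' i) ▸ hs i).satisfies h₃ (he i) (hκ i)
  · exact fun i => ((hf' i) ▸ hs i).plucker_ne_zero hd.distinctB h₃ (he i)
  · intro i j hij c hc
    have h₂ := IsSol.snd_eq hd.distinctB h₃ ((hf' i) ▸ hs i) ((hf' j) ▸ hs j) (he i) (he j) hc
    rw [← hf' i, ← hf' j] at h₂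
    exact hij (hf (IsSol.eq_of_snd_eq hd (hs i) (hs j) h₂))

end Split

set_option maxRecDepth 100000 in
/-- The splittings of the eight points. -/
def splits : List Split := [
  ⟨1, 2, 9, 64, 625, 7776, 117649, 2097152, [
    (⟨0, 1, 67, -51255127737, 18, 56494912649, 0⟩, ⟨2, 43653937050, 0, 49961729793, 4, 1, 55⟩),
    (⟨0, 1, 67, -51255738881, 18, 56495726416, 0⟩, ⟨2, 43672224929, 0, 49963926731, 4, 1, 55⟩),
    (⟨0, 1, 58, -30661965803, 13, 20223206768, 0⟩, ⟨2, 32926463283, 0, 31448340771, 11, 1, 72⟩),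
    (⟨0, 1, 57, -15586848663, 13, 10298131911, 0⟩, ⟨2, 9563294982, 0, 15671366338, 10, 1, 70⟩),
    (⟨0, 1, 58, -31236800716, 13, 20642103592, 0⟩, ⟨2, 19432084495, 0, 31332707721, 10, 1, 71⟩),
    (⟨0, 1, 63, -61286948744, 17, 35462781976, 0⟩, ⟨2, 38202830849, 0, 64728248384, 14, 1, 64⟩),
    (⟨0, 1, 64, -124211678486, 17, 71879919108, 0⟩, ⟨2, 87576516567, 0, 129526731939, 14, 1, 65⟩),
    (⟨0, 1, 64, -124417683569, 17, 71999831026, 0⟩, ⟨2, 88831044671, 0, 129539807002, 14, 1, 65⟩),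
    (⟨0, 1, 64, -86231743264, 18, 99534942923, 0⟩, ⟨2, 92655115769, 0, 70238109363, 18, 1, 68⟩),
    (⟨0, 1, 65, -172489673328, 18, 199099962399, 0⟩, ⟨2, 185266367221, 0, 140479329806, 18, 1, 69⟩),
    (⟨0, 1, 58, -23003441795, 14, 30484682506, 0⟩, ⟨2, 29106890961, 0, 22422078631, 15, 1, 75⟩),
    (⟨0, 1, 58, -23006756809, 14, 30489183302, 0⟩, ⟨2, 29103055026, 0, 22423848002, 15, 1, 75⟩)]⟩,
  ⟨1, 2, 9, 625, 64, 7776, 117649, 2097152, [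
    (⟨0, 1, 61, -804582752, 18, 887549603, 0⟩, ⟨2, -923521421, 0, 662377397, 9, 1, 54⟩),
    (⟨0, 1, 62, -1609967691, 18, 1776154534, 0⟩, ⟨2, -2049545445, 0, 1326864005, 9, 1, 55⟩),
    (⟨0, 1, 46, -34938060, 14, 49557453, 0⟩, ⟨2, 38431409, 0, 48511654, 18, 1, 69⟩),
    (⟨0, 1, 52, -139659348, 18, 161918591, 0⟩, ⟨2, 136543047, 0, 165922745, 21, 1, 62⟩),
    (⟨0, 1, 48, -178765759, 14, 256612107, 0⟩, ⟨2, 169072106, 0, 178417034, 26, 1, 79⟩),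
    (⟨0, 1, 56, -2843756236, 18, 3302111593, 0⟩, ⟨2, 3843083605, 0, 2568653294, 30, 1, 75⟩),
    (⟨0, 1, 48, -183876153, 14, 263967231, 0⟩, ⟨2, 171033182, 0, 178686450, 26, 1, 79⟩),
    (⟨0, 1, 55, -1462479780, 18, 1698186840, 0⟩, ⟨2, 1939526009, 0, 1284922951, 30, 1, 74⟩),
    (⟨0, 1, 48, 81921856, 14, -118752817, 0⟩, ⟨2, -81619793, 0, 105329314, 22, 1, 74⟩),
    (⟨0, 1, 49, 162740587, 14, -235968255, 0⟩, ⟨2, -213049552, 0, 210380546, 22, 1, 75⟩),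
    (⟨0, 1, 57, 2453008201, 18, -2845359968, 0⟩, ⟨2, -4006378396, 0, 2696913463, 26, 1, 71⟩),
    (⟨0, 1, 58, 4870194969, 18, -5649309876, 0⟩, ⟨2, -5220879323, 0, 5391993631, 25, 1, 71⟩)]⟩,
  ⟨1, 2, 9, 7776, 64, 625, 117649, 2097152, [
    (⟨0, 1, 39, -134049, 11, -165301, 0⟩, ⟨2, -158885, 0, 187458, 7, 1, 69⟩),
    (⟨0, 1, 40, -270172, 11, -332536, 0⟩, ⟨2, -409864, 0, 363155, 7, 1, 70⟩),
    (⟨0, 1, 54, -71419830, 18, 83547935, 0⟩, ⟨2, -118628457, 0, -109035377, 2, 1, 54⟩),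
    (⟨0, 1, 55, -143457206, 18, 167831133, 0⟩, ⟨2, -258794556, 0, -223477993, 2, 1, 55⟩),
    (⟨0, 1, 54, -187973400, 18, 220724256, 0⟩, ⟨2, 252199105, 0, 136882130, 11, 1, 67⟩),
    (⟨0, 1, 55, -375951916, 18, 441465535, 0⟩, ⟨2, 316545185, 0, 272281849, 10, 1, 67⟩),
    (⟨0, 1, 37, -1193167, 10, 1188086, 0⟩, ⟨2, -1303329, 0, 1059831, 5, 1, 61⟩),
    (⟨0, 1, 51, -75766460, 18, 89028260, 0⟩, ⟨2, -99618984, 0, -71423902, 7, 1, 59⟩),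
    (⟨0, 1, 35, -172573, 11, -197395, 0⟩, ⟨2, -186893, 0, -247271, 15, 1, 76⟩),
    (⟨0, 1, 50, -46561740, 18, 54479210, 0⟩, ⟨2, -34582629, 0, -67005517, 14, 1, 66⟩),
    (⟨0, 1, 35, -176749, 11, -201838, 0⟩, ⟨2, -189641, 0, -253485, 15, 1, 76⟩),
    (⟨0, 1, 49, -23807232, 18, 27853083, 0⟩, ⟨2, -17045720, 0, -33466003, 14, 1, 65⟩)]⟩,
  ⟨1, 2, 9, 117649, 64, 625, 7776, 2097152, [
    (⟨0, 1, 41, -266690, 13, 396561, 0⟩, ⟨2, 326709, 0, -311542, 7, 1, 45⟩),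
    (⟨0, 1, 42, -536148, 13, 798195, 0⟩, ⟨2, 840055, 0, -603383, 7, 1, 46⟩),
    (⟨0, 1, 46, -4818758, 14, 4682664, 0⟩, ⟨2, 5401963, 0, 4401992, 2, 1, 35⟩),
    (⟨0, 1, 47, -9672891, 14, 9410792, 0⟩, ⟨2, 11738916, 0, 8990174, 2, 1, 36⟩),
    (⟨0, 1, 45, -6372243, 14, 6542291, 0⟩, ⟨2, 5307988, 0, 5977283, 10, 1, 46⟩),
    (⟨0, 1, 47, -25489115, 14, 26180525, 0⟩, ⟨2, 26674267, 0, 23800340, 10, 1, 48⟩),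
    (⟨0, 1, 37, -1200860, 10, 1213263, 0⟩, ⟨2, -1142886, 0, 1630922, 4, 1, 36⟩),
    (⟨0, 1, 43, -4767647, 14, 4929154, 0⟩, ⟨2, 7988088, 0, 6707671, 7, 1, 41⟩),
    (⟨0, 1, 38, -737780, 12, 651253, 0⟩, ⟨2, 1023119, 0, 782349, 15, 1, 53⟩),
    (⟨0, 1, 43, -5864880, 14, 5710636, 0⟩, ⟨2, 7219466, 0, 6659967, 15, 1, 49⟩),
    (⟨0, 1, 38, -754752, 12, 666551, 0⟩, ⟨2, 1034530, 0, 799537, 15, 1, 53⟩),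
    (⟨0, 1, 43, -5994689, 14, 5830259, 0⟩, ⟨2, 7121603, 0, 6660000, 15, 1, 49⟩)]⟩,
  ⟨1, 2, 9, 2097152, 64, 625, 7776, 117649, [
    (⟨0, 1, 41, -275685, 13, 466247, 0⟩, ⟨2, 266453, 0, -496349, 6, 1, 45⟩),
    (⟨0, 1, 42, -554172, 13, 938374, 0⟩, ⟨2, 685276, 0, -961407, 6, 1, 46⟩),
    (⟨0, 1, 46, -4842392, 14, 5002896, 0⟩, ⟨2, 6550022, 0, 5266817, 2, 1, 35⟩),
    (⟨0, 1, 48, -19439989, 14, 20104812, 0⟩, ⟨2, 28469508, 0, 21513119, 2, 1, 37⟩),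
    (⟨0, 1, 46, -12857643, 14, 14021747, 0⟩, ⟨2, 11944127, 0, 13570687, 10, 1, 47⟩),
    (⟨0, 1, 47, -25715424, 14, 28053543, 0⟩, ⟨2, 30010808, 0, 27017471, 10, 1, 48⟩),
    (⟨0, 1, 38, -2402745, 10, 2429534, 0⟩, ⟨2, -2762709, 0, 3911015, 4, 1, 37⟩),
    (⟨0, 1, 43, -4769805, 14, 5249197, 0⟩, ⟨2, 4867540, 0, 8025145, 6, 1, 40⟩),
    (⟨0, 1, 38, -739717, 12, 738155, 0⟩, ⟨2, 880543, 0, 654031, 15, 1, 53⟩),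
    (⟨0, 1, 42, -2933576, 14, 3072716, 0⟩, ⟨2, 2170965, 0, 3983729, 14, 1, 47⟩),
    (⟨0, 1, 38, -756692, 12, 755505, 0⟩, ⟨2, 890343, 0, 668388, 15, 1, 53⟩),
    (⟨0, 1, 42, -2998500, 14, 3137812, 0⟩, ⟨2, 2141670, 0, 3983746, 14, 1, 47⟩)]⟩,
  ⟨1, 2, 64, 625, 9, 7776, 117649, 2097152, [
    (⟨0, 1, 57, -50411380, 18, 55635897, 0⟩, ⟨2, 42721285, 0, 41048392, 9, 1, 50⟩),
    (⟨0, 1, 59, -202235556, 18, 223316730, 0⟩, ⟨2, -163834363, 0, 165693055, 11, 1, 54⟩),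
    (⟨0, 1, 39, -2629418, 14, 3807368, 0⟩, ⟨2, -3238145, 0, 2811031, 35, 1, 82⟩),
    (⟨0, 1, 46, -21016158, 18, 24416472, 0⟩, ⟨2, -18820876, 0, 20397557, 38, 1, 76⟩),
    (⟨0, 1, 42, 7819982, 17, -4534069, 0⟩, ⟨2, -6315856, 0, 5335378, 25, 1, 61⟩),
    (⟨0, 1, 35, 960649, 13, -687141, 0⟩, ⟨2, -865185, 0, 790557, 22, 1, 67⟩),
    (⟨0, 1, 38, 3081542, 13, -2232467, 0⟩, ⟨2, -3511187, 0, 2847935, 35, 1, 82⟩),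
    (⟨0, 1, 47, 49117324, 18, -57060120, 0⟩, ⟨2, -40171449, 0, 40960227, 38, 1, 77⟩),
    (⟨0, 1, 42, 1745797, 13, -1274410, 0⟩, ⟨2, -1299667, 0, 1697419, 25, 1, 71⟩),
    (⟨0, 1, 45, 13678625, 13, -9998326, 0⟩, ⟨2, -13004805, 0, 13486846, 31, 1, 80⟩),
    (⟨0, 1, 52, 52825007, 18, -61289646, 0⟩, ⟨2, -65626039, 0, 43147047, 29, 1, 68⟩),
    (⟨0, 1, 56, 824512662, 18, -956755042, 0⟩, ⟨2, -648556449, 0, 689071209, 34, 1, 77⟩)]⟩,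
  ⟨1, 2, 64, 7776, 9, 625, 117649, 2097152, [
    (⟨0, 1, 34, -4372, 11, -5150, 0⟩, ⟨2, -5050, 0, 7290, 10, 1, 67⟩),
    (⟨0, 1, 36, -18232, 11, -21272, 0⟩, ⟨2, -23804, 0, 25714, 16, 1, 75⟩),
    (⟨0, 1, 49, -2295970, 18, 2686988, 0⟩, ⟨2, 2238683, 0, -2778674, 2, 1, 49⟩),
    (⟨0, 1, 52, -19323055, 18, 22628145, 0⟩, ⟨2, -31955162, 0, -27729296, 5, 1, 55⟩),
    (⟨0, 1, 49, -6269754, 18, 7363235, 0⟩, ⟨2, 6079182, 0, 5636617, 13, 1, 64⟩),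
    (⟨0, 1, 51, -25083385, 18, 29462474, 0⟩, ⟨2, 21939767, 0, 21270881, 19, 1, 72⟩),
    (⟨0, 1, 26, -2560, 11, -2805, 0⟩, ⟨2, 2299, 0, -4037, 23, 1, 78⟩),
    (⟨0, 1, 42, -1320011, 18, 1546352, 0⟩, ⟨2, 1207457, 0, -1399004, 23, 1, 69⟩),
    (⟨0, 1, 42, 7712903, 17, -4532376, 0⟩, ⟨2, 4841808, 0, -5815380, 10, 1, 58⟩),
    (⟨0, 1, 27, 23284, 10, -25563, 0⟩, ⟨2, 24436, 0, 23040, 9, 1, 59⟩),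
    (⟨0, 1, 27, 5206, 11, 5619, 0⟩, ⟨2, 5280, 0, -5198, 24, 1, 79⟩),
    (⟨0, 1, 43, 2652089, 18, -3104312, 0⟩, ⟨2, 4043942, 0, -2766474, 24, 1, 71⟩)]⟩,
  ⟨1, 2, 64, 117649, 9, 625, 7776, 2097152, [
    (⟨0, 1, 38, -34015, 13, 50989, 0⟩, ⟨2, 41747, 0, -45945, 10, 1, 45⟩),
    (⟨0, 1, 38, -35008, 13, 52817, 0⟩, ⟨2, 48079, 0, -40166, 16, 1, 51⟩),
    (⟨0, 1, 42, -308555, 14, 301786, 0⟩, ⟨2, -412203, 0, 458420, 2, 1, 32⟩),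
    (⟨0, 1, 44, -1290180, 14, 1274339, 0⟩, ⟨2, 1426118, 0, 1112285, 5, 1, 36⟩),
    (⟨0, 1, 41, -432073, 14, 444604, 0⟩, ⟨2, 502619, 0, 485195, 13, 1, 45⟩),
    (⟨0, 1, 43, -1728333, 14, 1783036, 0⟩, ⟨2, 1834140, 0, 1850118, 19, 1, 53⟩),
    (⟨0, 1, 29, -10331, 12, 9281, 0⟩, ⟨2, -13051, 0, 12849, 23, 1, 55⟩),
    (⟨0, 1, 34, -82592, 14, 81775, 0⟩, ⟨2, -126744, 0, 67425, 24, 1, 51⟩),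
    (⟨0, 1, 34, 238173, 14, -246617, 0⟩, ⟨2, -187795, 0, 134752, 11, 1, 39⟩),
    (⟨0, 1, 28, 46270, 10, -51833, 0⟩, ⟨2, 42600, 0, 34245, 9, 1, 35⟩),
    (⟨0, 1, 29, 10508, 12, -9491, 0⟩, ⟨2, -14488, 0, 16081, 23, 1, 55⟩),
    (⟨0, 1, 35, 163997, 14, -160546, 0⟩, ⟨2, -212571, 0, 134858, 24, 1, 52⟩)]⟩,
  ⟨1, 2, 64, 2097152, 9, 625, 7776, 117649, [
    (⟨0, 1, 37, -17586, 13, 30051, 0⟩, ⟨2, 17007, 0, -18236, 10, 1, 44⟩),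
    (⟨0, 1, 37, -18088, 13, 31114, 0⟩, ⟨2, 19612, 0, -31905, 15, 1, 50⟩),
    (⟨0, 1, 43, -619991, 14, 644168, 0⟩, ⟨2, -1001296, 0, 548521, 3, 1, 33⟩),
    (⟨0, 1, 44, -1295600, 14, 1357831, 0⟩, ⟨2, 1733008, 0, 1330946, 5, 1, 36⟩),
    (⟨0, 1, 41, -436889, 14, 477531, 0⟩, ⟨2, 282670, 0, 275556, 13, 1, 44⟩),
    (⟨0, 1, 44, -3495198, 14, 3828447, 0⟩, ⟨2, 4125759, 0, 2101424, 20, 1, 54⟩),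
    (⟨0, 1, 28, -5167, 12, 5260, 0⟩, ⟨2, -5628, 0, 5370, 23, 1, 54⟩),
    (⟨0, 1, 33, -41298, 14, 43909, 0⟩, ⟨2, -38082, 0, 40331, 23, 1, 49⟩),
    (⟨0, 1, 34, 475627, 13, -262513, 0⟩, ⟨2, -458755, 0, 322424, 11, 1, 40⟩),
    (⟨0, 1, 28, 46252, 10, -51870, 0⟩, ⟨2, 51579, 0, 41054, 9, 1, 35⟩),
    (⟨0, 1, 29, 10507, 12, -10762, 0⟩, ⟨2, -12494, 0, 13442, 23, 1, 55⟩),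
    (⟨0, 1, 36, 327958, 14, -345584, 0⟩, ⟨2, -511496, 0, 322667, 24, 1, 53⟩)]⟩,
  ⟨1, 2, 625, 7776, 9, 64, 117649, 2097152, [
    (⟨0, 1, 28, -969, 11, -756, 0⟩, ⟨2, -593, 0, -745, 1, 1, 63⟩),
    (⟨0, 1, 42, -252067, 17, 149147, 0⟩, ⟨2, -224311, 0, -138201, 2, 1, 54⟩),
    (⟨0, 1, 46, -2691685, 18, 3165146, 0⟩, ⟨2, -4182197, 0, -2106954, 1, 1, 51⟩),
    (⟨0, 1, 26, -11043, 7, 9303, 0⟩, ⟨2, 8928, 0, 11493, 0, 1, 57⟩),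
    (⟨0, 1, 45, -3325969, 18, 3912488, 0⟩, ⟨2, -3136047, 0, -2839533, 3, 1, 60⟩),
    (⟨0, 1, 45, -3330768, 18, 3916836, 0⟩, ⟨2, -2616417, 0, -2443765, 9, 1, 66⟩),
    (⟨0, 1, 28, -3318, 11, -2397, 0⟩, ⟨2, -3607, 0, -3691, 9, 1, 81⟩),
    (⟨0, 1, 43, -1829434, 17, 1075580, 0⟩, ⟨2, -1454131, 0, -1640747, 9, 1, 70⟩),
    (⟨0, 1, 44, -3658885, 17, 2152078, 0⟩, ⟨2, -2358835, 0, -4029510, 2, 1, 64⟩),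
    (⟨0, 1, 38, -84565, 18, 100078, 0⟩, ⟨2, -89421, 0, -80596, 11, 1, 63⟩),
    (⟨0, 1, 27, -5264, 11, -4097, 0⟩, ⟨2, -5512, 0, -5473, 11, 1, 77⟩),
    (⟨0, 1, 30, 541, 12, 791, 0⟩, ⟨2, 961, 0, -526, 9, 1, 75⟩)]⟩,
  ⟨1, 2, 625, 117649, 9, 64, 7776, 2097152, [
    (⟨0, 1, 33, -8012, 13, 4778, 0⟩, ⟨2, 4235, 0, 5140, 1, 1, 34⟩),
    (⟨0, 1, 31, -2065, 13, 3823, 0⟩, ⟨2, 2489, 0, 3036, 1, 1, 40⟩),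
    (⟨0, 1, 37, -84811, 14, 88880, 0⟩, ⟨2, 109908, 0, 108349, 0, 1, 31⟩),
    (⟨0, 1, 26, -11117, 7, 9387, 0⟩, ⟨2, 11347, 0, 14228, 0, 1, 33⟩),
    (⟨0, 1, 37, -209866, 14, 221221, 0⟩, ⟨2, 247066, 0, 226706, 3, 1, 42⟩),
    (⟨0, 1, 37, -210058, 14, 220148, 0⟩, ⟨2, 209561, 0, 196884, 9, 1, 48⟩),
    (⟨0, 1, 30, -6776, 12, 6471, 0⟩, ⟨2, 5395, 0, 5269, 9, 1, 57⟩),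
    (⟨0, 1, 38, -460717, 14, 482110, 0⟩, ⟨2, -296126, 0, -335080, 9, 1, 52⟩),
    (⟨0, 1, 39, -921445, 14, 971421, 0⟩, ⟨2, -957991, 0, -820664, 3, 1, 47⟩),
    (⟨0, 1, 31, -10581, 14, 12578, 0⟩, ⟨2, 13632, 0, 12279, 11, 1, 46⟩),
    (⟨0, 1, 28, -5302, 12, 5008, 0⟩, ⟨2, 5904, 0, 5511, 11, 1, 52⟩),
    (⟨0, 1, 31, 889, 12, -935, 0⟩, ⟨2, -793, 0, 839, 8, 1, 50⟩)]⟩,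
  ⟨1, 2, 625, 2097152, 9, 64, 7776, 117649, [
    (⟨0, 1, 33, -8017, 13, 4968, 0⟩, ⟨2, 5143, 0, 6235, 1, 1, 34⟩),
    (⟨0, 1, 30, -2074, 12, 2242, 0⟩, ⟨2, 2049, 0, 2495, 1, 1, 40⟩),
    (⟨0, 1, 38, -169714, 14, 188920, 0⟩, ⟨2, 133465, 0, 131397, 0, 1, 31⟩),
    (⟨0, 1, 26, -11122, 7, 9393, 0⟩, ⟨2, 13847, 0, 8665, 1, 1, 33⟩),
    (⟨0, 1, 38, -419809, 14, 469998, 0⟩, ⟨2, 300169, 0, 274986, 3, 1, 42⟩),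
    (⟨0, 1, 36, -105049, 14, 117047, 0⟩, ⟨2, 127146, 0, 119400, 9, 1, 47⟩),
    (⟨0, 1, 29, -3393, 12, 3821, 0⟩, ⟨2, 2200, 0, 2141, 9, 1, 56⟩),
    (⟨0, 1, 38, -461104, 14, 513153, 0⟩, ⟨2, -337432, 0, -382155, 9, 1, 52⟩),
    (⟨0, 1, 39, -922219, 14, 1032633, 0⟩, ⟨2, -545519, 0, -935453, 2, 1, 46⟩),
    (⟨0, 1, 30, -5291, 14, 6550, 0⟩, ⟨2, 4137, 0, 7448, 10, 1, 44⟩),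
    (⟨0, 1, 29, -10609, 12, 11699, 0⟩, ⟨2, 9764, 0, 9086, 11, 1, 53⟩),
    (⟨0, 1, 30, 877, 11, -543, 0⟩, ⟨2, -663, 0, 700, 8, 1, 50⟩)]⟩,
  ⟨1, 2, 7776, 117649, 9, 64, 625, 2097152, [
    (⟨0, 1, 39, -141654, 15, -208916, 0⟩, ⟨2, 148831, 0, 151815, 1, 1, 28⟩),
    (⟨0, 1, 28, -5510, 9, 6452, 0⟩, ⟨2, 6637, 0, 6093, 1, 1, 23⟩),
    (⟨0, 1, 37, -1493138, 10, 1100316, 0⟩, ⟨2, 1305445, 1, 1983924, 0, 1, 24⟩),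
    (⟨0, 1, 30, -215478, 7, 198528, 0⟩, ⟨2, -168243, 1, -206339, 0, 1, 26⟩),
    (⟨0, 1, 30, -29691, 10, 21862, 0⟩, ⟨2, 23531, 0, 24678, 9, 1, 34⟩),
    (⟨0, 1, 31, -59456, 10, 46936, 0⟩, ⟨2, 56173, 0, 54648, 3, 1, 29⟩),
    (⟨0, 1, 30, -30758, 10, 24292, 0⟩, ⟨2, 25414, 0, 26302, 3, 1, 28⟩),
    (⟨0, 1, 30, -30768, 10, 22674, 0⟩, ⟨2, 21200, 0, 23934, 9, 1, 34⟩),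
    (⟨0, 1, 25, -3937, 8, 2113, 0⟩, ⟨2, 2386, 0, 2248, 9, 1, 37⟩),
    (⟨0, 1, 37, -338901, 15, -500673, 0⟩, ⟨2, 396107, 0, 382587, 11, 1, 40⟩),
    (⟨0, 1, 25, -5474, 9, 7811, 0⟩, ⟨2, 5297, 0, 7013, 10, 1, 33⟩),
    (⟨0, 1, 31, -3107, 11, 4009, 0⟩, ⟨2, -2086, 0, 2970, 7, 1, 30⟩)]⟩,
  ⟨1, 2, 7776, 2097152, 9, 64, 625, 117649, [
    (⟨0, 1, 40, -283674, 15, -315621, 0⟩, ⟨2, 302124, 0, 307773, 1, 1, 29⟩),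
    (⟨0, 1, 28, -5527, 9, 6535, 0⟩, ⟨2, 6537, 0, 5989, 1, 1, 23⟩),
    (⟨0, 1, 37, -1493883, 10, 1106532, 0⟩, ⟨2, 1325126, 1, 2011168, 0, 1, 24⟩),
    (⟨0, 1, 30, -215524, 7, 198585, 0⟩, ⟨2, -170380, 1, -208575, 0, 1, 26⟩),
    (⟨0, 1, 30, -29715, 10, 22016, 0⟩, ⟨2, 23697, 0, 24872, 9, 1, 34⟩),
    (⟨0, 1, 31, -59505, 10, 47210, 0⟩, ⟨2, 56509, 0, 55047, 3, 1, 29⟩),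
    (⟨0, 1, 30, -30763, 10, 24417, 0⟩, ⟨2, 25804, 0, 26662, 3, 1, 28⟩),
    (⟨0, 1, 30, -30773, 10, 22815, 0⟩, ⟨2, 21501, 0, 24260, 9, 1, 34⟩),
    (⟨0, 1, 25, -3940, 8, 2119, 0⟩, ⟨2, 2382, 0, 2246, 9, 1, 37⟩),
    (⟨0, 1, 38, -677895, 15, -757149, 0⟩, ⟨2, 804101, 0, 775609, 11, 1, 41⟩),
    (⟨0, 1, 25, -5476, 9, 7883, 0⟩, ⟨2, 5240, 0, 6919, 10, 1, 33⟩),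
    (⟨0, 1, 31, -6263, 10, 4145, 0⟩, ⟨2, -4585, 0, 6513, 7, 1, 31⟩)]⟩,
  ⟨1, 2, 117649, 2097152, 9, 64, 625, 7776, [
    (⟨0, 1, 35, -111544, 10, 100679, 0⟩, ⟨2, 126942, 0, -87635, 8, 1, 35⟩),
    (⟨0, 1, 38, -291100, 13, 436192, 0⟩, ⟨2, 380976, 0, 380471, 1, 1, 29⟩),
    (⟨0, 1, 30, -22297, 9, 26673, 0⟩, ⟨2, 20195, 0, 18193, 1, 1, 25⟩),
    (⟨0, 1, 40, -12040319, 10, 9596580, 0⟩, ⟨2, 10716572, 1, 15967743, 0, 1, 27⟩),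
    (⟨0, 1, 32, -873077, 7, 808905, 0⟩, ⟨2, -711681, 1, -812547, 0, 1, 28⟩),
    (⟨0, 1, 32, -119134, 10, 96304, 0⟩, ⟨2, 108682, 0, 113065, 9, 1, 36⟩),
    (⟨0, 1, 33, -238525, 10, 203293, 0⟩, ⟨2, 254564, 0, 248810, 3, 1, 31⟩),
    (⟨0, 1, 33, -248919, 10, 212318, 0⟩, ⟨2, 257735, 0, 131694, 4, 1, 31⟩),
    (⟨0, 1, 33, -249108, 10, 201206, 0⟩, ⟨2, 210225, 0, 239878, 9, 1, 37⟩),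
    (⟨0, 1, 30, -127396, 8, 71677, 0⟩, ⟨2, 72830, 0, 68793, 9, 1, 42⟩),
    (⟨0, 1, 36, -679747, 13, 1036658, 0⟩, ⟨2, 1013864, 0, 958893, 11, 1, 41⟩),
    (⟨0, 1, 26, -10956, 9, 15925, 0⟩, ⟨2, 8498, 0, 11194, 10, 1, 34⟩)]⟩,
  ⟨1, 9, 64, 625, 2, 7776, 117649, 2097152, [
    (⟨0, 1, 56, -25218634, 18, 27834928, 0⟩, ⟨2, 27041083, 0, 20514778, 9, 1, 49⟩),
    (⟨0, 1, 57, -50572070, 18, 55846431, 0⟩, ⟨2, 64712339, 0, 41370946, 13, 1, 54⟩),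
    (⟨1, 23593, 12, 1, 28, -23751, 0⟩, ⟨2, 16797, 0, 22017, 39, 1, 79⟩),
    (⟨1, 378158, 16, 1, 36, -304575, 0⟩, ⟨2, 390592, 0, 319521, 43, 1, 75⟩),
    (⟨0, 1, 34, 101287, 13, -72531, 0⟩, ⟨2, 105191, 0, 99306, 23, 1, 65⟩),
    (⟨0, 1, 41, 404846, 18, -469479, 0⟩, ⟨2, 385225, 0, 334625, 26, 1, 58⟩),
    (⟨0, 1, 34, 99703, 13, -72309, 0⟩, ⟨2, 72002, 0, 89077, 39, 1, 81⟩),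
    (⟨0, 1, 45, 6370686, 18, -7401392, 0⟩, ⟨2, 6606018, 0, 5130374, 43, 1, 79⟩),
    (⟨0, 1, 39, 209597, 13, -153134, 0⟩, ⟨2, 195710, 0, 213128, 26, 1, 69⟩),
    (⟨0, 1, 41, 817308, 13, -598134, 0⟩, ⟨2, 879046, 0, 845174, 36, 1, 81⟩),
    (⟨0, 1, 50, 12698285, 18, -14733396, 0⟩, ⟨2, 9903091, 0, 10821180, 29, 1, 66⟩),
    (⟨0, 1, 53, 98534584, 18, -114345038, 0⟩, ⟨2, 88060093, 0, 86365537, 39, 1, 79⟩)]⟩,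
  ⟨1, 9, 64, 7776, 2, 625, 117649, 2097152, [
    (⟨0, 1, 31, -548, 11, -642, 0⟩, ⟨2, 761, 0, 937, 11, 1, 65⟩),
    (⟨0, 1, 33, -2311, 11, -2676, 0⟩, ⟨2, 3181, 0, 3206, 21, 1, 77⟩),
    (⟨0, 1, 47, -578265, 18, 676817, 0⟩, ⟨2, 699772, 0, -690156, 2, 1, 47⟩),
    (⟨0, 1, 49, -2432055, 18, 2848252, 0⟩, ⟨2, 3053564, 0, -3415496, 6, 1, 53⟩),
    (⟨0, 1, 46, -790412, 18, 928274, 0⟩, ⟨2, -944316, 0, 734304, 14, 1, 62⟩),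
    (⟨0, 1, 48, -3162398, 18, 3714662, 0⟩, ⟨2, -3066943, 0, 2719723, 24, 1, 74⟩),
    (⟨1, 391, 9, 1, 19, 279, 0⟩, ⟨2, -394, 0, -261, 29, 1, 80⟩),
    (⟨1, 24988, 16, 1, 32, -19194, 0⟩, ⟨2, -26061, 0, -22609, 28, 1, 68⟩),
    (⟨0, 1, 41, 383439, 18, -450661, 0⟩, ⟨2, -300192, 0, -376119, 11, 1, 55⟩),
    (⟨0, 1, 27, 5979, 10, -6652, 0⟩, ⟨2, -5821, 0, 5948, 10, 1, 58⟩),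
    (⟨0, 1, 25, 707, 11, 760, 0⟩, ⟨2, -891, 0, -654, 29, 1, 81⟩),
    (⟨0, 1, 40, 178753, 18, -209265, 0⟩, ⟨2, -177407, 0, -179050, 28, 1, 71⟩)]⟩,
  ⟨1, 9, 64, 117649, 2, 625, 7776, 2097152, [
    (⟨0, 1, 34, -2127, 13, 3190, 0⟩, ⟨2, -3144, 0, -2935, 11, 1, 42⟩),
    (⟨0, 1, 35, -4413, 13, 6674, 0⟩, ⟨2, -6421, 0, -4966, 21, 1, 53⟩),
    (⟨0, 1, 40, -77636, 14, 76056, 0⟩, ⟨2, -128805, 0, 113919, 2, 1, 30⟩),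
    (⟨0, 1, 41, -162271, 14, 160463, 0⟩, ⟨2, -136155, 0, 137304, 6, 1, 34⟩),
    (⟨0, 1, 38, -54600, 14, 56191, 0⟩, ⟨2, -38882, 0, 62987, 13, 1, 42⟩),
    (⟨0, 1, 40, -218406, 14, 225487, 0⟩, ⟨2, -256310, 0, 236568, 24, 1, 55⟩),
    (⟨1, 194, 11, 1, 20, -231, 0⟩, ⟨2, 140, 0, 207, 27, 1, 53⟩),
    (⟨1, 784, 13, 1, 24, -1015, 0⟩, ⟨2, 685, 0, 543, 28, 1, 48⟩),
    (⟨0, 1, 33, 23880, 14, -24734, 0⟩, ⟨2, 23192, 0, 17391, 12, 1, 37⟩),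
    (⟨0, 1, 26, 2976, 10, -3381, 0⟩, ⟨2, -2535, 0, 2202, 10, 1, 32⟩),
    (⟨0, 1, 26, 705, 12, -638, 0⟩, ⟨2, 614, 0, 1012, 27, 1, 55⟩),
    (⟨0, 1, 32, 11071, 14, -10861, 0⟩, ⟨2, 9331, 0, 8696, 28, 1, 52⟩)]⟩,
  ⟨1, 9, 64, 2097152, 2, 625, 7776, 117649, [
    (⟨0, 1, 34, -2200, 13, 3762, 0⟩, ⟨2, -2561, 0, -2329, 11, 1, 42⟩),
    (⟨0, 1, 35, -4560, 13, 7865, 0⟩, ⟨2, -5239, 0, -7886, 20, 1, 53⟩),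
    (⟨0, 1, 40, -77993, 14, 81149, 0⟩, ⟨2, -78233, 0, 68155, 2, 1, 29⟩),
    (⟨0, 1, 41, -162940, 14, 170942, 0⟩, ⟨2, -165508, 0, 164292, 6, 1, 34⟩),
    (⟨0, 1, 39, -110453, 14, 120748, 0⟩, ⟨2, -87464, 0, 71549, 14, 1, 43⟩),
    (⟨0, 1, 40, -220913, 14, 242138, 0⟩, ⟨2, -144131, 0, 134361, 24, 1, 54⟩),
    (⟨1, 194, 10, 1, 19, -131, 0⟩, ⟨2, 241, 0, 173, 28, 1, 54⟩),
    (⟨1, 1568, 12, 1, 24, -1090, 0⟩, ⟨2, 1646, 0, 1300, 28, 1, 49⟩),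
    (⟨0, 1, 33, 23871, 14, -26364, 0⟩, ⟨2, 28334, 0, 20807, 12, 1, 37⟩),
    (⟨0, 1, 27, 5949, 10, -6767, 0⟩, ⟨2, -6140, 0, 5280, 10, 1, 33⟩),
    (⟨0, 1, 26, 704, 12, -723, 0⟩, ⟨2, 529, 0, 846, 27, 1, 55⟩),
    (⟨0, 1, 33, 22140, 14, -23374, 0⟩, ⟨2, 22451, 0, 20806, 28, 1, 53⟩)]⟩,
  ⟨1, 9, 625, 7776, 2, 64, 117649, 2097152, [
    (⟨0, 1, 25, -122, 11, -95, 0⟩, ⟨2, 122, 0, -66, 3, 1, 62⟩),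
    (⟨0, 1, 37, -7943, 17, 4700, 0⟩, ⟨2, 5619, 0, -5965, 2, 1, 50⟩),
    (⟨0, 1, 44, -735423, 18, 864876, 0⟩, ⟨2, -957789, 0, -969781, 0, 1, 49⟩),
    (⟨0, 1, 41, -221729, 18, 260777, 0⟩, ⟨2, 204523, 0, -218745, 13, 1, 66⟩),
    (⟨0, 1, 42, -444133, 18, 522459, 0⟩, ⟨2, 350339, 0, -416892, 4, 1, 58⟩),
    (⟨0, 1, 24, -224, 11, -161, 0⟩, ⟨2, 164, 0, -221, 13, 1, 81⟩),
    (⟨0, 1, 41, -504808, 17, 296839, 0⟩, ⟨2, 438450, 0, -299992, 14, 1, 72⟩),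
    (⟨0, 1, 42, -1009622, 17, 593844, 0⟩, ⟨2, 555191, 0, -599978, 4, 1, 63⟩),
    (⟨0, 1, 36, -16803677, 7, 16812366, 0⟩, ⟨2, -30496418, 6, -17493432, 0, 1, 76⟩),
    (⟨1, 1172, 17, 1, 28, -1212, 0⟩, ⟨2, 1104, 0, -1803, 15, 1, 61⟩),
    (⟨1, 296, 11, 1, 20, 397, 0⟩, ⟨2, 271, 0, -490, 15, 1, 77⟩),
    (⟨0, 1, 26, 33, 12, 47, 0⟩, ⟨2, -40, 0, -36, 13, 1, 75⟩)]⟩,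
  ⟨1, 9, 625, 117649, 2, 64, 7776, 2097152, [
    (⟨0, 1, 29, -505, 13, 301, 0⟩, ⟨2, -425, 0, 444, 2, 1, 32⟩),
    (⟨0, 1, 27, -130, 13, 241, 0⟩, ⟨2, -254, 0, 134, 3, 1, 38⟩),
    (⟨0, 1, 35, -23141, 14, 24294, 0⟩, ⟨2, 25274, 0, 24946, 0, 1, 29⟩),
    (⟨0, 1, 35, -56074, 14, 58898, 0⟩, ⟨2, -65189, 0, 35083, 14, 1, 50⟩),
    (⟨0, 1, 34, -28075, 14, 29598, 0⟩, ⟨2, -27618, 0, 16700, 5, 1, 40⟩),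
    (⟨0, 1, 27, -913, 12, 872, 0⟩, ⟨2, -985, 0, 629, 14, 1, 59⟩),
    (⟨0, 1, 37, -509465, 13, 267291, 0⟩, ⟨2, 356306, 0, -489119, 13, 1, 56⟩),
    (⟨0, 1, 37, -509468, 13, 268587, 0⟩, ⟨2, 451307, 0, -489343, 4, 1, 47⟩),
    (⟨0, 1, 33, -2111071, 7, 2115677, 0⟩, ⟨2, -2431101, 5, -2891029, 0, 1, 47⟩),
    (⟨1, 294, 13, 1, 22, -305, 0⟩, ⟨2, -336, 0, 274, 16, 1, 45⟩),
    (⟨1, 590, 12, 1, 22, -970, 0⟩, ⟨2, -581, 0, 984, 15, 1, 53⟩),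
    (⟨0, 1, 27, 53, 12, -56, 0⟩, ⟨2, 33, 0, 57, 12, 1, 50⟩)]⟩,
  ⟨1, 9, 625, 2097152, 2, 64, 7776, 117649, [
    (⟨0, 1, 29, -505, 13, 313, 0⟩, ⟨2, -258, 0, 269, 2, 1, 31⟩),
    (⟨0, 1, 26, -131, 12, 141, 0⟩, ⟨2, -209, 0, 219, 2, 1, 38⟩),
    (⟨0, 1, 36, -46303, 14, 51625, 0⟩, ⟨2, 61395, 0, 60508, 0, 1, 30⟩),
    (⟨0, 1, 33, -14021, 14, 15652, 0⟩, ⟨2, -9887, 0, 10638, 13, 1, 47⟩),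
    (⟨0, 1, 34, -28080, 14, 31441, 0⟩, ⟨2, -16782, 0, 20255, 4, 1, 39⟩),
    (⟨0, 1, 26, -914, 11, 515, 0⟩, ⟨2, -803, 0, 1021, 13, 1, 59⟩),
    (⟨0, 1, 37, -510029, 13, 284456, 0⟩, ⟨2, 405926, 0, -278895, 14, 1, 56⟩),
    (⟨0, 1, 37, -510032, 13, 285597, 0⟩, ⟨2, 514000, 0, -278933, 5, 1, 47⟩),
    (⟨0, 1, 33, -2111893, 7, 2116774, 0⟩, ⟨2, -2967223, 5, -3733311, 0, 1, 47⟩),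
    (⟨1, 294, 13, 1, 22, -317, 0⟩, ⟨2, -408, 0, 332, 16, 1, 45⟩),
    (⟨1, 590, 11, 1, 21, -567, 0⟩, ⟨2, -962, 0, 811, 16, 1, 54⟩),
    (⟨0, 1, 28, 211, 11, -131, 0⟩, ⟨2, 221, 0, 191, 13, 1, 53⟩)]⟩,
  ⟨1, 9, 7776, 117649, 2, 64, 625, 2097152, [
    (⟨0, 1, 38, -71249, 15, -105016, 0⟩, ⟨2, -124424, 0, 109684, 2, 1, 29⟩),
    (⟨0, 1, 25, -694, 9, 821, 0⟩, ⟨2, -660, 0, 1002, 1, 1, 21⟩),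
    (⟨0, 1, 36, -803144, 10, 603967, 0⟩, ⟨2, 623806, 1, 919164, 0, 1, 23⟩),
    (⟨0, 1, 30, -16424, 11, 24820, 0⟩, ⟨2, -27863, 0, 17069, 14, 1, 38⟩),
    (⟨0, 1, 30, -16433, 11, 25986, 0⟩, ⟨2, -25759, 0, 16516, 5, 1, 29⟩),
    (⟨0, 1, 31, -34512, 11, 52185, 0⟩, ⟨2, -49775, 0, 33096, 14, 1, 39⟩),
    (⟨0, 1, 30, -17269, 11, 27321, 0⟩, ⟨2, -23333, 0, 32034, 4, 1, 29⟩),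
    (⟨0, 1, 25, -2173, 9, 2355, 0⟩, ⟨2, -3533, 0, 2190, 14, 1, 42⟩),
    (⟨0, 1, 26, -20687, 7, 22260, 0⟩, ⟨2, 17390, 0, 20971, 0, 1, 23⟩),
    (⟨1, 293, 8, 1, 17, -379, 0⟩, ⟨2, -262, 0, 303, 15, 1, 33⟩),
    (⟨1, 1222, 14, 1, 25, 1512, 0⟩, ⟨2, -1203, 0, 1034, 16, 1, 36⟩),
    (⟨0, 1, 29, -1565, 10, 1036, 0⟩, ⟨2, 1571, 0, 1759, 12, 1, 34⟩)]⟩,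
  ⟨1, 9, 7776, 2097152, 2, 64, 625, 117649, [
    (⟨0, 1, 38, -71340, 15, -79319, 0⟩, ⟨2, -126310, 0, 111179, 2, 1, 29⟩),
    (⟨0, 1, 25, -697, 9, 831, 0⟩, ⟨2, -650, 0, 984, 1, 1, 21⟩),
    (⟨0, 1, 36, -803483, 10, 607204, 0⟩, ⟨2, 633331, 1, 931806, 0, 1, 23⟩),
    (⟨0, 1, 29, -8221, 11, 12496, 0⟩, ⟨2, -14027, 0, 8600, 14, 1, 37⟩),
    (⟨0, 1, 30, -16450, 11, 26145, 0⟩, ⟨2, -25911, 0, 16639, 5, 1, 29⟩),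
    (⟨0, 1, 30, -17258, 11, 26245, 0⟩, ⟨2, -25238, 0, 16774, 14, 1, 38⟩),
    (⟨0, 1, 30, -17271, 11, 27463, 0⟩, ⟨2, -23699, 0, 32470, 4, 1, 29⟩),
    (⟨0, 1, 25, -2175, 9, 2362, 0⟩, ⟨2, -3527, 0, 2188, 14, 1, 42⟩),
    (⟨0, 1, 26, -20689, 7, 22262, 0⟩, ⟨2, 17616, 0, 21230, 0, 1, 23⟩),
    (⟨1, 293, 8, 1, 17, -383, 0⟩, ⟨2, -259, 0, 299, 15, 1, 33⟩),
    (⟨1, 2443, 14, 1, 26, 2286, 0⟩, ⟨2, -2442, 0, 2097, 16, 1, 37⟩),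
    (⟨0, 1, 29, -1578, 10, 1071, 0⟩, ⟨2, 1748, 0, 1952, 12, 1, 34⟩)]⟩,
  ⟨1, 9, 117649, 2097152, 2, 64, 625, 7776, [
    (⟨0, 1, 33, -28129, 10, 25937, 0⟩, ⟨2, -17576, 0, -19007, 12, 1, 37⟩),
    (⟨0, 1, 37, -146394, 13, 219422, 0⟩, ⟨2, -159683, 0, 137448, 2, 1, 29⟩),
    (⟨0, 1, 29, -11241, 9, 13577, 0⟩, ⟨2, -16077, 0, 11954, 2, 1, 26⟩),
    (⟨0, 1, 40, -12937113, 10, 10490821, 0⟩, ⟨2, 10265956, 1, 14801821, 0, 1, 27⟩),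
    (⟨0, 1, 33, -131795, 11, 217463, 0⟩, ⟨2, -257597, 0, 156188, 14, 1, 41⟩),
    (⟨0, 1, 33, -131857, 11, 225221, 0⟩, ⟨2, -232977, 0, 150436, 5, 1, 32⟩),
    (⟨0, 1, 32, -281994, 9, 320703, 0⟩, ⟨2, -431252, 0, 267961, 14, 1, 49⟩),
    (⟨0, 1, 35, -560894, 11, 925147, 0⟩, ⟨2, -982768, 0, 663437, 14, 1, 43⟩),
    (⟨0, 1, 33, -140347, 11, 239952, 0⟩, ⟨2, -238041, 0, 160563, 5, 1, 32⟩),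
    (⟨0, 1, 29, -168051, 7, 181653, 0⟩, ⟨2, 147580, 0, 188251, 0, 1, 26⟩),
    (⟨1, 1175, 8, 1, 19, -1546, 0⟩, ⟨2, -1683, 0, 1936, 15, 1, 36⟩),
    (⟨1, 4887, 12, 1, 25, -6262, 0⟩, ⟨2, -6174, 0, 5185, 16, 1, 38⟩)]⟩,
  ⟨1, 64, 625, 7776, 2, 9, 117649, 2097152, [
    (⟨0, 1, 25, -40566, 5, -33677, 0⟩, ⟨2, -41908, 0, -41858, 0, 1, 60⟩),
    (⟨0, 1, 48, -53961918, 18, 63514611, 0⟩, ⟨2, -38552422, 0, -38547677, 0, 1, 56⟩),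
    (⟨0, 1, 27, -3435, 11, -2588, 0⟩, ⟨2, -2239, 0, -2267, 0, 1, 67⟩),
    (⟨0, 1, 40, -220307, 18, 260817, 0⟩, ⟨2, -202918, 0, -205581, 0, 1, 56⟩),
    (⟨0, 1, 36, -42094, 18, 49837, 0⟩, ⟨2, -57294, 0, -44127, 6, 1, 66⟩),
    (⟨0, 1, 29, -21049, 12, -31552, 0⟩, ⟨2, -19020, 0, -29692, 5, 1, 82⟩),
    (⟨0, 1, 39, -377625, 18, 444545, 0⟩, ⟨2, -360705, 0, -333483, 6, 1, 69⟩),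
    (⟨0, 1, 41, -1511791, 18, 1778708, 0⟩, ⟨2, 1793604, 0, 1467137, 0, 1, 63⟩),
    (⟨0, 1, 32, -377953, 11, -265233, 0⟩, ⟨2, -336419, 0, -340001, 6, 1, 94⟩),
    (⟨0, 1, 45, -24390382, 18, 28696683, 0⟩, ⟨2, 26254528, 0, 21489837, 0, 1, 71⟩),
    (⟨0, 1, 46, -48780769, 18, 57423455, 0⟩, ⟨2, -40874584, 0, -38312954, 6, 1, 80⟩),
    (⟨0, 1, 25, 26, 11, 18, 0⟩, ⟨2, -26, 0, 21, 4, 1, 74⟩)]⟩,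
  ⟨1, 64, 625, 117649, 2, 9, 7776, 2097152, [
    (⟨0, 1, 25, -40762, 5, -33352, 0⟩, ⟨2, -53688, 0, -53491, 0, 1, 36⟩),
    (⟨0, 1, 40, -3379615, 14, 3598078, 0⟩, ⟨2, 3988925, 0, 3978322, 0, 1, 38⟩),
    (⟨0, 1, 32, -27605, 13, 16561, 0⟩, ⟨2, 30792, 0, 31113, 0, 1, 39⟩),
    (⟨0, 1, 29, -6932, 12, 6577, 0⟩, ⟨2, 4407, 0, 4453, 0, 1, 43⟩),
    (⟨0, 1, 32, -42138, 14, 50611, 0⟩, ⟨2, 34215, 0, 52738, 5, 1, 51⟩),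
    (⟨0, 1, 31, -84410, 12, 80340, 0⟩, ⟨2, 77198, 0, 119445, 5, 1, 59⟩),
    (⟨0, 1, 36, -755982, 14, 807033, 0⟩, ⟨2, 909357, 0, 841441, 6, 1, 56⟩),
    (⟨0, 1, 36, -756475, 14, 799528, 0⟩, ⟨2, -580370, 1, -950769, 0, 1, 48⟩),
    (⟨0, 1, 34, -758168, 12, 732258, 0⟩, ⟨2, 990531, 0, 993845, 6, 1, 71⟩),
    (⟨0, 1, 39, -6102955, 14, 6450298, 0⟩, ⟨2, 5399423, 0, 4421135, 0, 1, 53⟩),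
    (⟨0, 1, 39, -6102971, 14, 6510822, 0⟩, ⟨2, -8324104, 0, -7805123, 6, 1, 62⟩),
    (⟨0, 1, 27, 41, 12, -45, 0⟩, ⟨2, 41, 0, -33, 4, 1, 50⟩)]⟩,
  ⟨1, 64, 625, 2097152, 2, 9, 7776, 117649, [
    (⟨0, 1, 25, -40776, 5, -33330, 0⟩, ⟨2, -32783, 1, -65315, 0, 1, 36⟩),
    (⟨0, 1, 41, -6760144, 14, 7633222, 0⟩, ⟨2, 4842188, 0, 4828503, 0, 1, 38⟩),
    (⟨0, 1, 32, -27607, 13, 17222, 0⟩, ⟨2, 18714, 0, 18906, 0, 1, 38⟩),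
    (⟨0, 1, 29, -6937, 12, 7711, 0⟩, ⟨2, 7245, 0, 7319, 0, 1, 44⟩),
    (⟨0, 1, 33, -84279, 14, 105254, 0⟩, ⟨2, 83126, 0, 128121, 5, 1, 52⟩),
    (⟨0, 1, 30, -42213, 12, 47104, 0⟩, ⟨2, 63549, 0, 49139, 6, 1, 59⟩),
    (⟨0, 1, 36, -756000, 14, 855739, 0⟩, ⟨2, 552281, 0, 1021966, 5, 1, 55⟩),
    (⟨0, 1, 36, -756494, 14, 849242, 0⟩, ⟨2, -705003, 0, -577375, 0, 1, 47⟩),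
    (⟨0, 1, 34, -758331, 12, 866881, 0⟩, ⟨2, 805217, 0, 807552, 6, 1, 71⟩),
    (⟨0, 1, 38, -3051773, 14, 3425933, 0⟩, ⟨2, 3077978, 0, 2520579, 0, 1, 52⟩),
    (⟨0, 1, 39, -6103560, 14, 6905093, 0⟩, ⟨2, -4741508, 0, -4446394, 6, 1, 61⟩),
    (⟨0, 1, 27, 40, 12, -52, 0⟩, ⟨2, 34, 0, -55, 3, 1, 50⟩)]⟩,
  ⟨1, 64, 7776, 117649, 2, 9, 625, 2097152, [
    (⟨0, 1, 35, -108116, 10, 90343, 0⟩, ⟨2, -126615, 0, 96427, 4, 1, 37⟩),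
    (⟨0, 1, 32, -2842450, 6, -3395286, 0⟩, ⟨2, 2651345, 0, 2564473, 0, 1, 30⟩),
    (⟨0, 1, 41, -110952594, 10, 98900512, 0⟩, ⟨2, 128908172, 0, 124616443, 0, 1, 32⟩),
    (⟨0, 1, 41, -7177720, 14, -5272576, 0⟩, ⟨2, 4856529, 0, 4743393, 0, 1, 35⟩),
    (⟨0, 1, 28, -58260, 8, 44802, 0⟩, ⟨2, 34068, 0, 33387, 0, 1, 28⟩),
    (⟨0, 1, 26, -42847, 8, 34353, 0⟩, ⟨2, 40308, 0, 59510, 5, 1, 40⟩),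
    (⟨0, 1, 43, -43566882, 15, -63949161, 0⟩, ⟨2, 64654950, 0, 50929714, 6, 1, 51⟩),
    (⟨0, 1, 33, -1532758, 10, 1248791, 0⟩, ⟨2, -1447861, 0, -1194392, 0, 1, 37⟩),
    (⟨0, 1, 33, -1533505, 10, 1427175, 0⟩, ⟨2, 1780818, 0, 1661690, 6, 1, 46⟩),
    (⟨0, 1, 31, -384870, 10, 358691, 0⟩, ⟨2, 421347, 0, 396625, 6, 1, 44⟩),
    (⟨0, 1, 30, -386679, 9, 453289, 0⟩, ⟨2, 517435, 0, 508558, 6, 1, 51⟩),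
    (⟨0, 1, 33, -1540433, 10, 1255059, 0⟩, ⟨2, -1450931, 0, -1207426, 0, 1, 37⟩)]⟩,
  ⟨1, 64, 7776, 2097152, 2, 9, 625, 117649, [
    (⟨0, 1, 33, -27231, 10, 23249, 0⟩, ⟨2, -29879, 0, 22749, 4, 1, 36⟩),
    (⟨0, 1, 31, -1421602, 6, -1696402, 0⟩, ⟨2, 1344218, 0, 1299956, 0, 1, 29⟩),
    (⟨0, 1, 41, -110966187, 10, 99262220, 0⟩, ⟨2, 130807466, 0, 126431202, 0, 1, 32⟩),
    (⟨0, 1, 43, -14358362, 15, -15932684, 0⟩, ⟨2, 9860047, 0, 9628731, 0, 1, 36⟩),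
    (⟨0, 1, 27, -29148, 8, 22686, 0⟩, ⟨2, 16755, 0, 16418, 0, 1, 27⟩),
    (⟨0, 1, 26, -42855, 8, 34795, 0⟩, ⟨2, 39709, 0, 58596, 5, 1, 40⟩),
    (⟨0, 1, 42, -21784896, 15, -24154022, 0⟩, ⟨2, 32817404, 0, 25846324, 6, 1, 50⟩),
    (⟨0, 1, 32, -766453, 10, 627585, 0⟩, ⟨2, -729393, 0, -601789, 0, 1, 36⟩),
    (⟨0, 1, 33, -1533650, 10, 1431989, 0⟩, ⟨2, 1791509, 0, 1671909, 6, 1, 46⟩),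
    (⟨0, 1, 31, -384878, 10, 359816, 0⟩, ⟨2, 427694, 0, 402566, 6, 1, 44⟩),
    (⟨0, 1, 30, -386713, 9, 454470, 0⟩, ⟨2, 516756, 0, 507917, 6, 1, 51⟩),
    (⟨0, 1, 33, -1540470, 10, 1261380, 0⟩, ⟨2, -1472930, 0, -1225529, 0, 1, 37⟩)]⟩,
  ⟨1, 64, 117649, 2097152, 2, 9, 625, 7776, [
    (⟨0, 1, 31, -15317, 9, 8615, 0⟩, ⟨2, -12500, 0, 9471, 4, 1, 38⟩),
    (⟨0, 1, 34, -11449016, 6, -13279627, 0⟩, ⟨2, 11451518, 0, 11047770, 0, 1, 32⟩),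
    (⟨0, 1, 44, -889321403, 10, 837757991, 0⟩, ⟨2, 1027566917, 0, 990699125, 0, 1, 35⟩),
    (⟨0, 1, 40, -14417820, 12, 11000113, 0⟩, ⟨2, 12468488, 0, 12145262, 0, 1, 36⟩),
    (⟨0, 1, 31, -467120, 8, 368271, 0⟩, ⟨2, 425635, 0, 415976, 0, 1, 32⟩),
    (⟨0, 1, 30, -686129, 8, 564660, 0⟩, ⟨2, 998450, 0, 736502, 6, 1, 45⟩),
    (⟨0, 1, 41, -43629362, 13, 66734307, 0⟩, ⟨2, 41489963, 0, 65191200, 5, 1, 50⟩),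
    (⟨0, 1, 37, -24534677, 10, 21588317, 0⟩, ⟨2, -26148563, 0, -21579518, 0, 1, 41⟩),
    (⟨0, 1, 36, -12272591, 10, 12021418, 0⟩, ⟨2, 15926761, 0, 14858320, 6, 1, 49⟩),
    (⟨0, 1, 34, -3083363, 10, 3019223, 0⟩, ⟨2, 2154025, 0, 4059553, 5, 1, 46⟩),
    (⟨0, 1, 34, -6196541, 9, 7689299, 0⟩, ⟨2, 7881421, 0, 7748396, 6, 1, 55⟩),
    (⟨0, 1, 36, -12345358, 10, 10863030, 0⟩, ⟨2, -15083803, 0, -12544176, 0, 1, 40⟩)]⟩,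
  ⟨1, 625, 7776, 117649, 2, 9, 64, 2097152, [
    (⟨0, 1, 43, -518891832, 10, -347420331, 0⟩, ⟨2, 425841549, 0, 300364721, 0, 1, 31⟩),
    (⟨0, 1, 54, -67069488463, 14, -46417706323, 0⟩, ⟨2, 66575403184, 0, 46870960736, 0, 1, 38⟩),
    (⟨0, 1, 40, -1361194334, 6, 1694050463, 0⟩, ⟨2, -1500677567, 1, -2089020890, 0, 1, 32⟩),
    (⟨0, 1, 37, -171967493, 6, 220111238, 0⟩, ⟨2, -161240992, 1, -224347551, 0, 1, 29⟩),
    (⟨0, 1, 39, -49636447, 11, -62501061, 0⟩, ⟨2, 49640724, 0, 49985602, 6, 1, 41⟩),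
    (⟨0, 1, 38, -408679228, 7, 386504814, 0⟩, ⟨2, 340240689, 0, 336425485, 0, 1, 36⟩),
    (⟨0, 1, 35, -51213973, 7, 48438751, 0⟩, ⟨2, 39515170, 0, 39949033, 0, 1, 33⟩),
    (⟨0, 1, 51, -26452250352, 14, -18316765802, 0⟩, ⟨2, 23404926133, 0, 25575835187, 6, 1, 50⟩),
    (⟨0, 1, 28, -1723706, 5, 1059949, 0⟩, ⟨2, 1123601, 0, 1586123, 5, 1, 35⟩),
    (⟨0, 1, 40, -208053925, 10, -141561083, 0⟩, ⟨2, 178704022, 0, 199765979, 6, 1, 43⟩),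
    (⟨0, 1, 26, -435413, 5, 278086, 0⟩, ⟨2, 335760, 0, 474817, 5, 1, 33⟩),
    (⟨0, 1, 35, -367798, 11, -467272, 0⟩, ⟨2, -519325, 0, 363994, 4, 1, 32⟩)]⟩,
  ⟨1, 625, 7776, 2097152, 2, 9, 64, 117649, [
    (⟨0, 1, 44, -1037985468, 10, -682119928, 0⟩, ⟨2, 853174488, 0, 601678407, 0, 1, 32⟩),
    (⟨0, 1, 54, -67081180251, 14, -34719821702, 0⟩, ⟨2, 66673786670, 0, 46932323461, 0, 1, 38⟩),
    (⟨0, 1, 41, -2722613468, 6, 3388732295, 0⟩, ⟨2, -3003947523, 1, -4180938215, 0, 1, 33⟩),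
    (⟨0, 1, 37, -172034571, 6, 220395588, 0⟩, ⟨2, -160685106, 1, -223532575, 0, 1, 29⟩),
    (⟨0, 1, 38, -24821794, 11, -30205756, 0⟩, ⟨2, 24856926, 0, 25026873, 6, 1, 40⟩),
    (⟨0, 1, 38, -408688884, 7, 386712412, 0⟩, ⟨2, 340757234, 0, 336877065, 0, 1, 36⟩),
    (⟨0, 1, 36, -102437424, 7, 96936419, 0⟩, ⟨2, 79002175, 0, 79901707, 0, 1, 34⟩),
    (⟨0, 1, 53, -52907467808, 15, -54814067907, 0⟩, ⟨2, 46879707008, 0, 51219451173, 6, 1, 51⟩),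
    (⟨0, 1, 27, -861889, 5, 530011, 0⟩, ⟨2, 561434, 0, 792603, 5, 1, 34⟩),
    (⟨0, 1, 40, -208063928, 10, -138984313, 0⟩, ⟨2, 178977623, 0, 200030763, 6, 1, 43⟩),
    (⟨0, 1, 26, -435447, 5, 278177, 0⟩, ⟨2, 335688, 0, 474729, 5, 1, 33⟩),
    (⟨0, 1, 35, -368180, 11, -453304, 0⟩, ⟨2, -520077, 0, 364423, 4, 1, 32⟩)]⟩,
  ⟨1, 625, 117649, 2097152, 2, 9, 64, 7776, [
    (⟨0, 1, 47, -4164500546, 11, -3876686188, 0⟩, ⟨2, 3439720920, 0, 2420020792, 0, 1, 34⟩),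
    (⟨0, 1, 53, -134650390006, 12, 104634404449, 0⟩, ⟨2, 136398785017, 0, 95770244086, 0, 1, 39⟩),
    (⟨0, 1, 44, -21834655088, 6, 27308653149, 0⟩, ⟨2, -23898311502, 1, -33175381975, 0, 1, 36⟩),
    (⟨0, 1, 41, -2755585673, 6, 3534397476, 0⟩, ⟨2, -2602050256, 1, -3610503808, 0, 1, 33⟩),
    (⟨0, 1, 44, -795250934, 12, -945785383, 0⟩, ⟨2, 814801980, 0, 817378527, 6, 1, 45⟩),
    (⟨0, 1, 41, -3271489253, 7, 3119365645, 0⟩, ⟨2, 2769539783, 0, 2736430556, 0, 1, 39⟩),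
    (⟨0, 1, 38, -409879342, 7, 390846640, 0⟩, ⟨2, 324580511, 0, 327001312, 0, 1, 36⟩),
    (⟨0, 1, 50, -52967931614, 12, 41204080799, 0⟩, ⟨2, 47944456480, 0, 52249794081, 6, 1, 51⟩),
    (⟨0, 1, 31, -13802041, 5, 8516240, 0⟩, ⟨2, 8909958, 0, 12579554, 5, 1, 38⟩),
    (⟨0, 1, 44, -1667359599, 11, -1583757218, 0⟩, ⟨2, 1461982078, 0, 1632411372, 6, 1, 46⟩),
    (⟨0, 1, 30, -6975194, 5, 4472473, 0⟩, ⟨2, 5349480, 0, 7568216, 5, 1, 37⟩),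
    (⟨0, 1, 41, -11906522, 12, -15454454, 0⟩, ⟨2, -8484897, 0, 11874947, 3, 1, 36⟩)]⟩,
  ⟨1, 7776, 117649, 2097152, 2, 9, 64, 625, [
    (⟨0, 1, 46, -8707900806, 9, 9876424597, 0⟩, ⟨2, 9130830545, 1, 12454350229, 0, 1, 36⟩),
    (⟨0, 1, 46, -8712863828, 9, 10026560169, 0⟩, ⟨2, 9254557835, 1, 12621338671, 0, 1, 36⟩),
    (⟨0, 1, 40, -1398306785, 6, 1826000609, 0⟩, ⟨2, -1587197105, 1, -2133907969, 0, 1, 32⟩),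
    (⟨0, 1, 44, -22397188528, 6, 29329327882, 0⟩, ⟨2, -24888029819, 1, -33458266347, 0, 1, 36⟩),
    (⟨0, 1, 39, -402241875, 8, 291165763, 0⟩, ⟨2, 273159962, 0, 525976964, 5, 1, 43⟩),
    (⟨0, 1, 41, -3292493664, 7, 3431203627, 0⟩, ⟨2, 3506090308, 0, 3412671009, 0, 1, 39⟩),
    (⟨0, 1, 42, -6586551606, 7, 6864092690, 0⟩, ⟨2, 6985165607, 0, 6807328587, 0, 1, 40⟩),
    (⟨0, 1, 43, -3381357480, 9, 3955021276, 0⟩, ⟨2, 3910550675, 0, 4231017400, 6, 1, 47⟩),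
    (⟨0, 1, 35, -224619860, 5, 146933406, 0⟩, ⟨2, 140579459, 0, 199266967, 5, 1, 42⟩),
    (⟨0, 1, 42, -1691551772, 9, 1950933660, 0⟩, ⟨2, 1952362202, 0, 2115478437, 6, 1, 46⟩),
    (⟨0, 1, 34, -112395312, 5, 73671233, 0⟩, ⟨2, 71162375, 0, 100914902, 5, 1, 41⟩),
    (⟨0, 1, 38, -26798778, 8, 19335687, 0⟩, ⟨2, -23129600, 0, 31893980, 3, 1, 37⟩)]⟩,
  ⟨2, 9, 64, 625, 1, 7776, 117649, 2097152, [
    (⟨0, 1, 55, -12610290, 18, 13918741, 0⟩, ⟨2, 13928660, 0, 10256855, 9, 1, 48⟩),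
    (⟨0, 1, 56, -25287554, 18, 27925221, 0⟩, ⟨2, 24749603, 0, 20683490, 12, 1, 52⟩),
    (⟨0, 1, 31, 78834, 14, -114297, 0⟩, ⟨2, 115539, 0, 88101, 40, 1, 82⟩),
    (⟨0, 1, 39, 1260922, 18, -1465027, 0⟩, ⟨2, 1343115, 0, 1278541, 43, 1, 77⟩),
    (⟨0, 1, 35, 186932, 13, -135587, 0⟩, ⟨2, 247819, 0, 178226, 40, 1, 83⟩),
    (⟨0, 1, 45, 5973433, 18, -6939907, 0⟩, ⟨2, 5681987, 0, 5132298, 43, 1, 79⟩),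
    (⟨0, 1, 35, 91013, 14, -130383, 0⟩, ⟨2, 82468, 0, 99296, 22, 1, 64⟩),
    (⟨0, 1, 42, 727159, 18, -843264, 0⟩, ⟨2, 604673, 0, 669368, 25, 1, 58⟩),
    (⟨0, 1, 39, 207962, 13, -151981, 0⟩, ⟨2, 141464, 0, 213090, 25, 1, 68⟩),
    (⟨0, 1, 41, 812728, 13, -594860, 0⟩, ⟨2, 824166, 0, 845674, 36, 1, 81⟩),
    (⟨0, 1, 51, 25191295, 18, -29229160, 0⟩, ⟨2, 28655791, 0, 21647321, 29, 1, 67⟩),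
    (⟨0, 1, 52, 48997143, 18, -56859268, 0⟩, ⟨2, 41295403, 0, 43201766, 39, 1, 78⟩)]⟩,
  ⟨2, 9, 64, 7776, 1, 625, 117649, 2097152, [
    (⟨0, 1, 31, -551, 11, -644, 0⟩, ⟨2, 547, 0, 928, 10, 1, 64⟩),
    (⟨0, 1, 34, -4625, 11, -5351, 0⟩, ⟨2, 5963, 0, 6435, 21, 1, 78⟩),
    (⟨0, 1, 48, -1157753, 18, 1355088, 0⟩, ⟨2, 1438227, 0, -1379498, 2, 1, 48⟩),
    (⟨0, 1, 48, -1216103, 18, 1424227, 0⟩, ⟨2, 1173483, 0, -1703884, 5, 1, 51⟩),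
    (⟨0, 1, 46, -791394, 18, 929443, 0⟩, ⟨2, -681855, 0, 733469, 13, 1, 61⟩),
    (⟨0, 1, 49, -6332542, 18, 7438442, 0⟩, ⟨2, -5769445, 0, 5465211, 24, 1, 75⟩),
    (⟨0, 1, 23, 2426, 11, 2639, 0⟩, ⟨2, -2712, 0, -2099, 29, 1, 83⟩),
    (⟨0, 1, 34, 38818, 18, -45477, 0⟩, ⟨2, -44726, 0, -45434, 28, 1, 69⟩),
    (⟨0, 1, 27, 5399, 10, -6027, 0⟩, ⟨2, -4561, 0, 5972, 9, 1, 57⟩),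
    (⟨0, 1, 42, 686489, 18, -806854, 0⟩, ⟨2, -956644, 0, -756064, 11, 1, 56⟩),
    (⟨0, 1, 25, 666, 11, 714, 0⟩, ⟨2, -766, 0, -658, 29, 1, 81⟩),
    (⟨0, 1, 40, 168076, 18, -196767, 0⟩, ⟨2, -152189, 0, -179898, 28, 1, 71⟩)]⟩,
  ⟨2, 9, 64, 117649, 1, 625, 7776, 2097152, [
    (⟨0, 1, 35, -4269, 13, 6408, 0⟩, ⟨2, -4517, 0, -5803, 10, 1, 42⟩),
    (⟨0, 1, 36, -8829, 13, 13354, 0⟩, ⟨2, -12037, 0, -9959, 21, 1, 54⟩),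
    (⟨0, 1, 39, -38854, 14, 38072, 0⟩, ⟨2, -33087, 0, 56928, 1, 1, 28⟩),
    (⟨0, 1, 41, -162277, 14, 160494, 0⟩, ⟨2, -209441, 0, 137030, 6, 1, 34⟩),
    (⟨0, 1, 39, -109371, 14, 112592, 0⟩, ⟨2, -112391, 0, 125934, 13, 1, 43⟩),
    (⟨0, 1, 40, -218748, 14, 225849, 0⟩, ⟨2, -241005, 0, 237628, 24, 1, 55⟩),
    (⟨0, 1, 24, 2428, 12, -2188, 0⟩, ⟨2, 3852, 0, 3330, 28, 1, 58⟩),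
    (⟨0, 1, 27, 4847, 14, -4803, 0⟩, ⟨2, 4698, 0, 4367, 28, 1, 51⟩),
    (⟨0, 1, 28, 10748, 10, -12251, 0⟩, ⟨2, -15893, 0, 8843, 10, 1, 34⟩),
    (⟨0, 1, 33, 21378, 14, -22149, 0⟩, ⟨2, 18479, 0, 17471, 11, 1, 36⟩),
    (⟨0, 1, 25, 331, 12, -300, 0⟩, ⟨2, 264, 0, 509, 27, 1, 54⟩),
    (⟨0, 1, 33, 20822, 14, -20426, 0⟩, ⟨2, 32003, 0, 17468, 29, 1, 54⟩)]⟩,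
  ⟨2, 9, 64, 2097152, 1, 625, 7776, 117649, [
    (⟨0, 1, 34, -2207, 13, 3778, 0⟩, ⟨2, -3680, 0, -2302, 11, 1, 42⟩),
    (⟨0, 1, 34, -2281, 13, 3934, 0⟩, ⟨2, -2455, 0, -3954, 20, 1, 52⟩),
    (⟨0, 1, 40, -78064, 14, 81240, 0⟩, ⟨2, -80388, 0, 68117, 2, 1, 29⟩),
    (⟨0, 1, 42, -325894, 14, 341942, 0⟩, ⟨2, -509175, 0, 327928, 6, 1, 35⟩),
    (⟨0, 1, 39, -110632, 14, 120974, 0⟩, ⟨2, -126409, 0, 71527, 14, 1, 43⟩),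
    (⟨0, 1, 41, -442539, 14, 485077, 0⟩, ⟨2, -271047, 0, 269927, 24, 1, 55⟩),
    (⟨0, 1, 24, 2428, 12, -2481, 0⟩, ⟨2, 3323, 0, 2784, 28, 1, 58⟩),
    (⟨0, 1, 27, 4847, 14, -5158, 0⟩, ⟨2, 5647, 0, 5224, 28, 1, 51⟩),
    (⟨0, 1, 27, 5372, 10, -6130, 0⟩, ⟨2, -4812, 0, 5301, 9, 1, 32⟩),
    (⟨0, 1, 34, 42741, 14, -47219, 0⟩, ⟨2, 45149, 0, 41804, 11, 1, 37⟩),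
    (⟨0, 1, 26, 662, 12, -680, 0⟩, ⟨2, 911, 0, 851, 28, 1, 56⟩),
    (⟨0, 1, 32, 10410, 14, -10990, 0⟩, ⟨2, 9626, 0, 10449, 28, 1, 52⟩)]⟩,
  ⟨2, 9, 625, 7776, 1, 64, 117649, 2097152, [
    (⟨0, 1, 25, -127, 11, -99, 0⟩, ⟨2, 89, 0, -126, 1, 1, 61⟩),
    (⟨0, 1, 39, -16585, 18, 19628, 0⟩, ⟨2, 16455, 0, -22694, 1, 1, 51⟩),
    (⟨0, 1, 44, -740347, 18, 870679, 0⟩, ⟨2, -955591, 0, -968233, 0, 1, 49⟩),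
    (⟨0, 1, 41, -447478, 17, 263142, 0⟩, ⟨2, 361131, 0, -459046, 13, 1, 67⟩),
    (⟨0, 1, 42, -896955, 17, 527579, 0⟩, ⟨2, 575521, 0, -849150, 3, 1, 58⟩),
    (⟨0, 1, 24, -226, 11, -163, 0⟩, ⟨2, 154, 0, -232, 13, 1, 81⟩),
    (⟨0, 1, 41, -512394, 17, 301301, 0⟩, ⟨2, 391599, 0, -314676, 14, 1, 72⟩),
    (⟨0, 1, 42, -1024796, 17, 602780, 0⟩, ⟨2, 903637, 0, -614337, 4, 1, 63⟩),
    (⟨0, 1, 27, -35255, 7, 36117, 0⟩, ⟨2, -42710, 2, -46927, 0, 1, 62⟩),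
    (⟨0, 1, 32, 8423, 18, -9968, 0⟩, ⟨2, 16256, 0, -15130, 16, 1, 65⟩),
    (⟨0, 1, 23, 1049, 12, 1624, 0⟩, ⟨2, 1994, 0, -1028, 17, 1, 80⟩),
    (⟨0, 1, 26, 33, 12, 47, 0⟩, ⟨2, -35, 0, -38, 13, 1, 75⟩)]⟩,
  ⟨2, 9, 625, 117649, 1, 64, 7776, 2097152, [
    (⟨0, 1, 31, -1053, 14, 1257, 0⟩, ⟨2, -1245, 0, 1691, 1, 1, 33⟩),
    (⟨0, 1, 27, -135, 13, 251, 0⟩, ⟨2, -185, 0, 253, 1, 1, 37⟩),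
    (⟨0, 1, 36, -46588, 14, 48922, 0⟩, ⟨2, 50461, 0, 49815, 0, 1, 30⟩),
    (⟨0, 1, 34, -28303, 14, 29729, 0⟩, ⟨2, -28739, 0, 18397, 14, 1, 49⟩),
    (⟨0, 1, 34, -28357, 14, 29904, 0⟩, ⟨2, -22700, 0, 17014, 4, 1, 39⟩),
    (⟨0, 1, 25, -231, 12, 221, 0⟩, ⟨2, -231, 0, 165, 14, 1, 57⟩),
    (⟨0, 1, 37, -517286, 13, 271402, 0⟩, ⟨2, 318133, 0, -512933, 13, 1, 56⟩),
    (⟨0, 1, 38, -1034577, 13, 545588, 0⟩, ⟨2, 734664, 0, -1002299, 3, 1, 47⟩),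
    (⟨0, 1, 26, -17713, 7, 18178, 0⟩, ⟨2, -27244, 2, -31523, 0, 1, 37⟩),
    (⟨0, 1, 26, 2103, 14, -2503, 0⟩, ⟨2, -2476, 0, 2298, 16, 1, 48⟩),
    (⟨0, 1, 25, 2099, 13, -3979, 0⟩, ⟨2, -2141, 0, 2064, 16, 1, 55⟩),
    (⟨0, 1, 27, 53, 12, -56, 0⟩, ⟨2, 57, 0, 60, 13, 1, 51⟩)]⟩,
  ⟨2, 9, 625, 2097152, 1, 64, 7776, 117649, [
    (⟨0, 1, 31, -1053, 14, 1307, 0⟩, ⟨2, -1512, 0, 1025, 2, 1, 33⟩),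
    (⟨0, 1, 26, -136, 12, 147, 0⟩, ⟨2, -152, 0, 208, 1, 1, 37⟩),
    (⟨0, 1, 36, -46609, 14, 51978, 0⟩, ⟨2, 61289, 0, 60413, 0, 1, 30⟩),
    (⟨0, 1, 34, -28308, 14, 31602, 0⟩, ⟨2, -17437, 0, 22314, 13, 1, 48⟩),
    (⟨0, 1, 34, -28362, 14, 31766, 0⟩, ⟨2, -27586, 0, 20636, 4, 1, 39⟩),
    (⟨0, 1, 25, -462, 11, 261, 0⟩, ⟨2, -377, 0, 268, 14, 1, 58⟩),
    (⟨0, 1, 37, -517882, 13, 288846, 0⟩, ⟨2, 362437, 0, -292477, 14, 1, 56⟩),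
    (⟨0, 1, 37, -517885, 13, 290069, 0⟩, ⟨2, 418353, 0, -285663, 4, 1, 46⟩),
    (⟨0, 1, 26, -17720, 7, 18187, 0⟩, ⟨2, -16627, 2, -19316, 0, 1, 36⟩),
    (⟨0, 1, 26, 2103, 14, -2607, 0⟩, ⟨2, -3006, 0, 2788, 16, 1, 48⟩),
    (⟨0, 1, 24, 2099, 12, -2324, 0⟩, ⟨2, -3542, 0, 3403, 16, 1, 56⟩),
    (⟨0, 1, 27, 105, 11, -65, 0⟩, ⟨2, 96, 0, 100, 13, 1, 52⟩)]⟩,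
  ⟨2, 9, 7776, 117649, 1, 64, 625, 2097152, [
    (⟨0, 1, 38, -73427, 15, -108215, 0⟩, ⟨2, -91356, 0, 105048, 1, 1, 28⟩),
    (⟨0, 1, 25, -717, 9, 856, 0⟩, ⟨2, -966, 0, 947, 1, 1, 21⟩),
    (⟨0, 1, 36, -807804, 10, 609269, 0⟩, ⟨2, 625766, 1, 918004, 0, 1, 23⟩),
    (⟨0, 1, 29, -8339, 11, 12606, 0⟩, ⟨2, -12239, 0, 8911, 14, 1, 37⟩),
    (⟨0, 1, 30, -16686, 11, 26485, 0⟩, ⟨2, -21193, 0, 16901, 4, 1, 28⟩),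
    (⟨0, 1, 30, -17563, 11, 26566, 0⟩, ⟨2, -21862, 0, 17279, 14, 1, 38⟩),
    (⟨0, 1, 30, -17582, 11, 27921, 0⟩, ⟨2, -19180, 0, 16409, 4, 1, 28⟩),
    (⟨0, 1, 24, -1103, 9, 1197, 0⟩, ⟨2, -1659, 0, 1145, 14, 1, 41⟩),
    (⟨0, 1, 26, -22484, 7, 24813, 0⟩, ⟨2, 24788, 0, 26651, 0, 1, 23⟩),
    (⟨0, 1, 20, 1047, 9, -1557, 0⟩, ⟨2, -1927, 0, 1267, 16, 1, 36⟩),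
    (⟨0, 1, 33, 132566, 15, 195717, 0⟩, ⟨2, -141854, 0, 138236, 16, 1, 43⟩),
    (⟨0, 1, 29, -1566, 10, 1036, 0⟩, ⟨2, 1355, 0, 1830, 12, 1, 34⟩)]⟩,
  ⟨2, 9, 7776, 2097152, 1, 64, 625, 117649, [
    (⟨0, 1, 38, -73519, 15, -81736, 0⟩, ⟨2, -92744, 0, 106480, 1, 1, 28⟩),
    (⟨0, 1, 25, -720, 9, 868, 0⟩, ⟨2, -951, 0, 930, 1, 1, 21⟩),
    (⟨0, 1, 37, -1616281, 10, 1225016, 0⟩, ⟨2, 1270666, 1, 1861249, 0, 1, 24⟩),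
    (⟨0, 1, 30, -16696, 11, 25387, 0⟩, ⟨2, -24645, 0, 17960, 14, 1, 38⟩),
    (⟨0, 1, 30, -16705, 11, 26648, 0⟩, ⟨2, -21319, 0, 17028, 4, 1, 28⟩),
    (⟨0, 1, 31, -35131, 11, 53444, 0⟩, ⟨2, -44343, 0, 35029, 14, 1, 39⟩),
    (⟨0, 1, 30, -17585, 11, 28065, 0⟩, ⟨2, -19480, 0, 16632, 4, 1, 28⟩),
    (⟨0, 1, 25, -2208, 9, 2401, 0⟩, ⟨2, -3313, 0, 2287, 14, 1, 42⟩),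
    (⟨0, 1, 27, -44969, 7, 49630, 0⟩, ⟨2, 50222, 0, 53951, 0, 1, 24⟩),
    (⟨0, 1, 20, 1047, 9, -1572, 0⟩, ⟨2, -1907, 0, 1250, 16, 1, 36⟩),
    (⟨0, 1, 34, 265127, 15, 295975, 0⟩, ⟨2, -288020, 0, 280243, 16, 1, 44⟩),
    (⟨0, 1, 28, -789, 10, 536, 0⟩, ⟨2, 754, 0, 1016, 12, 1, 33⟩)]⟩,
  ⟨2, 9, 117649, 2097152, 1, 64, 625, 7776, [
    (⟨0, 1, 34, -56268, 10, 51911, 0⟩, ⟨2, -60323, 0, -39342, 13, 1, 39⟩),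
    (⟨0, 1, 37, -150750, 13, 226092, 0⟩, ⟨2, -234580, 0, 131640, 2, 1, 29⟩),
    (⟨0, 1, 28, -5802, 9, 7079, 0⟩, ⟨2, -5891, 0, 5655, 1, 1, 24⟩),
    (⟨0, 1, 39, -6505469, 10, 5288071, 0⟩, ⟨2, 5149954, 1, 7390712, 0, 1, 26⟩),
    (⟨0, 1, 32, -66914, 11, 110454, 0⟩, ⟨2, -113083, 0, 81548, 14, 1, 40⟩),
    (⟨0, 1, 32, -66945, 11, 114696, 0⟩, ⟨2, -95873, 0, 76949, 4, 1, 30⟩),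
    (⟨0, 1, 32, -286416, 9, 326230, 0⟩, ⟨2, -404988, 0, 280172, 14, 1, 49⟩),
    (⟨0, 1, 34, -285618, 11, 471302, 0⟩, ⟨2, -432321, 0, 346362, 14, 1, 42⟩),
    (⟨0, 1, 33, -143001, 11, 245237, 0⟩, ⟨2, -195417, 0, 164525, 4, 1, 31⟩),
    (⟨0, 1, 29, -182803, 7, 202674, 0⟩, ⟨2, 210393, 0, 235914, 0, 1, 26⟩),
    (⟨0, 1, 24, 16744, 9, -25374, 0⟩, ⟨2, -24792, 0, 32349, 15, 1, 40⟩),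
    (⟨0, 1, 33, 530016, 13, -810475, 0⟩, ⟨2, -728400, 0, 692933, 16, 1, 45⟩)]⟩,
  ⟨2, 64, 625, 7776, 1, 9, 117649, 2097152, [
    (⟨0, 1, 24, -28825, 5, -22199, 0⟩, ⟨2, -29497, 0, -29428, 0, 1, 60⟩),
    (⟨0, 1, 47, -37818981, 18, 44514815, 0⟩, ⟨2, -49179756, 0, -49176688, 0, 1, 57⟩),
    (⟨0, 1, 27, -2333, 12, -3512, 0⟩, ⟨2, -2923, 0, -3006, 0, 1, 68⟩),
    (⟨0, 1, 40, -299722, 18, 354840, 0⟩, ⟨2, -264767, 0, -272772, 0, 1, 57⟩),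
    (⟨0, 1, 34, -10991, 18, 13013, 0⟩, ⟨2, -14794, 0, -8299, 6, 1, 63⟩),
    (⟨0, 1, 26, -5503, 11, -4123, 0⟩, ⟨2, -4905, 0, -5592, 5, 1, 79⟩),
    (⟨0, 1, 38, -206819, 18, 243470, 0⟩, ⟨2, -179079, 0, -250301, 5, 1, 67⟩),
    (⟨0, 1, 41, -1656642, 18, 1949168, 0⟩, ⟨2, 1205640, 1, 1923796, 0, 1, 63⟩),
    (⟨0, 1, 30, -103643, 11, -72699, 0⟩, ⟨2, -82739, 0, -127164, 5, 1, 91⟩),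
    (⟨0, 1, 46, -53645819, 18, 63118479, 0⟩, ⟨2, 35394334, 1, 56492568, 0, 1, 72⟩),
    (⟨0, 1, 46, -53645823, 18, 63150641, 0⟩, ⟨2, -40464895, 0, -57485078, 5, 1, 79⟩),
    (⟨0, 1, 25, 26, 11, 18, 0⟩, ⟨2, -25, 0, 16, 5, 1, 74⟩)]⟩,
  ⟨2, 64, 625, 117649, 1, 9, 7776, 2097152, [
    (⟨0, 1, 24, -28921, 5, -21982, 0⟩, ⟨2, -18899, 0, -18802, 0, 1, 35⟩),
    (⟨0, 1, 39, -2366307, 14, 2519931, 0⟩, ⟨2, 2544974, 0, 2537399, 0, 1, 38⟩),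
    (⟨0, 1, 31, -9378, 14, 11255, 0⟩, ⟨2, 10057, 0, 10327, 0, 1, 38⟩),
    (⟨0, 1, 27, -2351, 12, 2233, 0⟩, ⟨2, 2871, 0, 2947, 0, 1, 43⟩),
    (⟨0, 1, 30, -11005, 14, 13219, 0⟩, ⟨2, 8827, 0, 9913, 5, 1, 48⟩),
    (⟨0, 1, 28, -11025, 12, 10495, 0⟩, ⟨2, 9968, 0, 11245, 5, 1, 55⟩),
    (⟨0, 1, 33, -103535, 14, 110531, 0⟩, ⟨2, 112800, 0, 78907, 6, 1, 52⟩),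
    (⟨0, 1, 34, -207271, 14, 219133, 0⟩, ⟨2, -195025, 0, -155845, 0, 1, 45⟩),
    (⟨0, 1, 32, -207828, 12, 200761, 0⟩, ⟨2, 243632, 0, 185703, 6, 1, 68⟩),
    (⟨0, 1, 38, -3356514, 14, 3548612, 0⟩, ⟨2, 3639750, 0, 2905890, 0, 1, 52⟩),
    (⟨0, 1, 38, -3356520, 14, 3580975, 0⟩, ⟨2, -4119022, 0, -2926928, 6, 1, 60⟩),
    (⟨0, 1, 27, 41, 12, -45, 0⟩, ⟨2, 39, 0, -51, 4, 1, 50⟩)]⟩,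
  ⟨2, 64, 625, 2097152, 1, 9, 7776, 117649, [
    (⟨0, 1, 24, -28928, 5, -21967, 0⟩, ⟨2, -23081, 0, -22958, 0, 1, 35⟩),
    (⟨0, 1, 39, -2366478, 14, 2672922, 0⟩, ⟨2, 3089635, 0, 3079846, 0, 1, 38⟩),
    (⟨0, 1, 32, -18758, 14, 23407, 0⟩, ⟨2, 24451, 0, 25102, 0, 1, 39⟩),
    (⟨0, 1, 27, -2352, 12, 2618, 0⟩, ⟨2, 2360, 0, 2422, 0, 1, 43⟩),
    (⟨0, 1, 30, -11006, 14, 13746, 0⟩, ⟨2, 10723, 0, 12041, 5, 1, 48⟩),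
    (⟨0, 1, 27, -5513, 12, 6153, 0⟩, ⟨2, 4103, 0, 4626, 5, 1, 54⟩),
    (⟨0, 1, 33, -103537, 14, 117202, 0⟩, ⟨2, 68508, 0, 95836, 5, 1, 51⟩),
    (⟨0, 1, 34, -207276, 14, 232748, 0⟩, ⟨2, -236909, 0, -189278, 0, 1, 45⟩),
    (⟨0, 1, 31, -103933, 12, 118839, 0⟩, ⟨2, 99027, 0, 75442, 6, 1, 67⟩),
    (⟨0, 1, 38, -3356941, 14, 3769483, 0⟩, ⟨2, 4149662, 0, 3313413, 0, 1, 52⟩),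
    (⟨0, 1, 38, -3356947, 14, 3797945, 0⟩, ⟨2, -2346235, 0, -3334846, 5, 1, 59⟩),
    (⟨0, 1, 26, 20, 12, -26, 0⟩, ⟨2, 16, 0, -21, 4, 1, 49⟩)]⟩,
  ⟨2, 64, 7776, 117649, 1, 9, 625, 2097152, [
    (⟨0, 1, 35, -108170, 10, 90518, 0⟩, ⟨2, -112018, 0, 69460, 5, 1, 37⟩),
    (⟨0, 1, 31, -3944531, 5, -2239584, 0⟩, ⟨2, 3712345, 0, 3575874, 0, 1, 31⟩),
    (⟨0, 1, 39, -38406760, 10, 34360921, 0⟩, ⟨2, 41268518, 0, 39705605, 0, 1, 31⟩),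
    (⟨0, 1, 40, -2409610, 15, -3539708, 0⟩, ⟨2, 3220610, 0, 3170755, 0, 1, 35⟩),
    (⟨0, 1, 27, -19550, 9, 30466, 0⟩, ⟨2, 22181, 0, 22015, 0, 1, 28⟩),
    (⟨0, 1, 24, -11169, 8, 8969, 0⟩, ⟨2, 10429, 0, 11140, 5, 1, 37⟩),
    (⟨0, 1, 38, -2857870, 14, -2097323, 0⟩, ⟨2, 4122082, 0, 2380953, 6, 1, 46⟩),
    (⟨0, 1, 31, -421446, 10, 344662, 0⟩, ⟨2, -487017, 0, -392281, 0, 1, 35⟩),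
    (⟨0, 1, 31, -421599, 10, 392573, 0⟩, ⟨2, 439081, 0, 310149, 6, 1, 43⟩),
    (⟨0, 1, 28, -52994, 10, 49417, 0⟩, ⟨2, 51880, 0, 37014, 6, 1, 40⟩),
    (⟨0, 1, 27, -53139, 9, 62385, 0⟩, ⟨2, 63520, 0, 47375, 6, 1, 47⟩),
    (⟨0, 1, 31, -424493, 10, 347157, 0⟩, ⟨2, -488032, 0, -397027, 0, 1, 35⟩)]⟩,
  ⟨2, 64, 7776, 2097152, 1, 9, 625, 117649, [
    (⟨0, 1, 33, -27244, 10, 23294, 0⟩, ⟨2, -27396, 0, 16983, 5, 1, 36⟩),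
    (⟨0, 1, 30, -1972632, 5, -1118968, 0⟩, ⟨2, 1882197, 0, 1812658, 0, 1, 30⟩),
    (⟨0, 1, 40, -76818320, 10, 68971238, 0⟩, ⟨2, 83760901, 0, 80573211, 0, 1, 32⟩),
    (⟨0, 1, 41, -4819953, 15, -5348243, 0⟩, ⟨2, 6538847, 0, 6436388, 0, 1, 36⟩),
    (⟨0, 1, 27, -19560, 9, 30853, 0⟩, ⟨2, 21818, 0, 21651, 0, 1, 28⟩),
    (⟨0, 1, 24, -11171, 8, 9084, 0⟩, ⟨2, 10275, 0, 10968, 5, 1, 37⟩),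
    (⟨0, 1, 40, -5716102, 15, -6337335, 0⟩, ⟨2, 8369315, 0, 4833240, 6, 1, 47⟩),
    (⟨0, 1, 31, -421500, 10, 346417, 0⟩, ⟨2, -490680, 0, -395298, 0, 1, 35⟩),
    (⟨0, 1, 30, -210826, 10, 196955, 0⟩, ⟨2, 220856, 0, 156029, 6, 1, 42⟩),
    (⟨0, 1, 28, -52995, 10, 49572, 0⟩, ⟨2, 52662, 0, 37569, 6, 1, 40⟩),
    (⟨0, 1, 28, -106289, 9, 125098, 0⟩, ⟨2, 126873, 0, 94631, 6, 1, 48⟩),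
    (⟨0, 1, 32, -849006, 10, 697776, 0⟩, ⟨2, -990876, 0, -805949, 0, 1, 36⟩)]⟩,
  ⟨2, 64, 117649, 2097152, 1, 9, 625, 7776, [
    (⟨0, 1, 31, -15326, 9, 8634, 0⟩, ⟨2, -11802, 0, 14565, 4, 1, 38⟩),
    (⟨0, 1, 32, -7930427, 5, -4380521, 0⟩, ⟨2, 8016933, 0, 7700350, 0, 1, 32⟩),
    (⟨0, 1, 42, -307558423, 10, 290936455, 0⟩, ⟨2, 329478156, 0, 316036637, 0, 1, 34⟩),
    (⟨0, 1, 39, -4834788, 13, 7383759, 0⟩, ⟨2, 8271757, 0, 8118659, 0, 1, 36⟩),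
    (⟨0, 1, 30, -156609, 9, 250254, 0⟩, ⟨2, 138862, 0, 137368, 0, 1, 31⟩),
    (⟨0, 1, 28, -178874, 8, 147451, 0⟩, ⟨2, 258226, 0, 137805, 6, 1, 42⟩),
    (⟨0, 1, 37, -5723569, 12, 4377607, 0⟩, ⟨2, 5292385, 0, 6095344, 5, 1, 46⟩),
    (⟨0, 1, 35, -6746055, 10, 5954159, 0⟩, ⟨2, -4396142, 1, -7085494, 0, 1, 39⟩),
    (⟨0, 1, 34, -3374121, 10, 3306838, 0⟩, ⟨2, 3927788, 0, 2773717, 6, 1, 46⟩),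
    (⟨0, 1, 31, -424769, 10, 416168, 0⟩, ⟨2, 265164, 0, 378837, 5, 1, 42⟩),
    (⟨0, 1, 31, -1703598, 8, 1058757, 0⟩, ⟨2, 1934911, 0, 1443573, 6, 1, 52⟩),
    (⟨0, 1, 34, -3404034, 10, 3004506, 0⟩, ⟨2, -2537471, 1, -4125338, 0, 1, 38⟩)]⟩,
  ⟨2, 625, 7776, 117649, 1, 9, 64, 2097152, [
    (⟨0, 1, 43, -320427571, 11, -428339428, 0⟩, ⟨2, 309992237, 1, 421312524, 0, 1, 32⟩),
    (⟨0, 1, 54, -41340928688, 15, -57217173484, 0⟩, ⟨2, 48546569201, 1, 65728375704, 0, 1, 39⟩),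
    (⟨0, 1, 38, -857928925, 5, 583381120, 0⟩, ⟨2, -932360671, 0, -615964732, 0, 1, 31⟩),
    (⟨0, 1, 35, -108387710, 5, 75905855, 0⟩, ⟨2, -99995420, 1, -131968325, 0, 1, 29⟩),
    (⟨0, 1, 36, -13773526, 10, -8661323, 0⟩, ⟨2, 11571442, 0, 8913684, 6, 1, 38⟩),
    (⟨0, 1, 37, -224488412, 7, 220098814, 0⟩, ⟨2, 222140469, 0, 218166056, 0, 1, 35⟩),
    (⟨0, 1, 34, -28163946, 7, 27615460, 0⟩, ⟨2, 25716821, 0, 25906661, 0, 1, 32⟩),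
    (⟨0, 1, 49, -7446529542, 14, -5156039084, 0⟩, ⟨2, 5428122232, 0, 4559540132, 6, 1, 47⟩),
    (⟨0, 1, 26, -471777, 5, 293619, 0⟩, ⟨2, 276417, 0, 283462, 5, 1, 32⟩),
    (⟨0, 1, 38, -58843798, 10, -40023341, 0⟩, ⟨2, 41379336, 0, 35610721, 6, 1, 40⟩),
    (⟨0, 1, 25, -238924, 5, 154645, 0⟩, ⟨2, 164903, 0, 169681, 5, 1, 31⟩),
    (⟨0, 1, 35, -368990, 11, -468348, 0⟩, ⟨2, -509372, 0, 264468, 5, 1, 32⟩)]⟩,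
  ⟨2, 625, 7776, 2097152, 1, 9, 64, 117649, [
    (⟨0, 1, 43, -320478215, 11, -420499292, 0⟩, ⟨2, 310542724, 1, 421977162, 0, 1, 32⟩),
    (⟨0, 1, 54, -41346776225, 15, -42797904234, 0⟩, ⟨2, 48619470335, 1, 65814422108, 0, 1, 39⟩),
    (⟨0, 1, 38, -857969549, 5, 583462592, 0⟩, ⟨2, -933260474, 0, -616438043, 0, 1, 31⟩),
    (⟨0, 1, 36, -216852669, 5, 152006995, 0⟩, ⟨2, -199310509, 1, -262977211, 0, 1, 30⟩),
    (⟨0, 1, 38, -27551117, 11, -33486273, 0⟩, ⟨2, 23177376, 0, 17851652, 6, 1, 39⟩),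
    (⟨0, 1, 37, -224493357, 7, 220206082, 0⟩, ⟨2, 222480003, 0, 218456705, 0, 1, 35⟩),
    (⟨0, 1, 34, -28167386, 7, 27631749, 0⟩, ⟨2, 25705787, 0, 25907615, 0, 1, 32⟩),
    (⟨0, 1, 51, -14893807298, 15, -15429717771, 0⟩, ⟨2, 10872705934, 0, 9131163862, 6, 1, 48⟩),
    (⟨0, 1, 26, -471805, 5, 293644, 0⟩, ⟨2, 276236, 0, 283299, 5, 1, 32⟩),
    (⟨0, 1, 39, -117691678, 10, -78588999, 0⟩, ⟨2, 82887610, 0, 71315853, 6, 1, 41⟩),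
    (⟨0, 1, 24, -119474, 5, 77350, 0⟩, ⟨2, 82433, 0, 84825, 5, 1, 30⟩),
    (⟨0, 1, 35, -369374, 11, -454352, 0⟩, ⟨2, -510111, 0, 264779, 5, 1, 32⟩)]⟩,
  ⟨2, 625, 117649, 2097152, 1, 9, 64, 7776, [
    (⟨0, 1, 47, -5140286476, 11, -4780122120, 0⟩, ⟨2, 5008879046, 1, 6788753775, 0, 1, 36⟩),
    (⟨0, 1, 53, -82937534969, 13, 128973989715, 0⟩, ⟨2, 99500004102, 1, 134301198327, 0, 1, 40⟩),
    (⟨0, 1, 42, -13754108778, 5, 9398784662, 0⟩, ⟨2, -14869183087, 0, -9791201279, 0, 1, 35⟩),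
    (⟨0, 1, 39, -1735830479, 5, 1217978496, 0⟩, ⟨2, -1616284121, 1, -2126261038, 0, 1, 33⟩),
    (⟨0, 1, 44, -882379870, 12, -1047198811, 0⟩, ⟨2, 760123424, 0, 583032469, 6, 1, 44⟩),
    (⟨0, 1, 40, -1797193175, 7, 1775157984, 0⟩, ⟨2, 1807987961, 0, 1774252424, 0, 1, 38⟩),
    (⟨0, 1, 37, -225401305, 7, 222654196, 0⟩, ⟨2, 211304065, 0, 212029717, 0, 1, 35⟩),
    (⟨0, 1, 48, -14908848467, 12, 11598698568, 0⟩, ⟨2, 11123672273, 0, 9314849114, 6, 1, 48⟩),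
    (⟨0, 1, 29, -3778397, 5, 2359907, 0⟩, ⟨2, 2192117, 0, 2248284, 5, 1, 35⟩),
    (⟨0, 1, 43, -943343391, 11, -895753795, 0⟩, ⟨2, 677247948, 0, 581991699, 6, 1, 44⟩),
    (⟨0, 1, 28, -1914365, 5, 1244151, 0⟩, ⟨2, 1313572, 0, 1352286, 5, 1, 34⟩),
    (⟨0, 1, 41, -11944175, 12, -15490163, 0⟩, ⟨2, -16653868, 0, 8627443, 5, 1, 37⟩)]⟩,
  ⟨2, 7776, 117649, 2097152, 1, 9, 64, 625, [
    (⟨0, 1, 45, -5329500514, 9, 6086202737, 0⟩, ⟨2, 6678090467, 0, 4367854485, 0, 1, 35⟩),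
    (⟨0, 1, 45, -5331906739, 9, 6178609190, 0⟩, ⟨2, 6769812743, 0, 4426566835, 0, 1, 35⟩),
    (⟨0, 1, 38, -875367326, 5, 624087134, 0⟩, ⟨2, -1003283968, 0, -636343932, 0, 1, 31⟩),
    (⟨0, 1, 41, -7010631095, 5, 5012846737, 0⟩, ⟨2, -7864926627, 0, -4987533914, 0, 1, 34⟩),
    (⟨0, 1, 38, -222251622, 8, 161106582, 0⟩, ⟨2, 256260129, 0, 187620322, 6, 1, 42⟩),
    (⟨0, 1, 39, -904963178, 7, 969574187, 0⟩, ⟨2, 571838731, 0, 552174035, 0, 1, 36⟩),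
    (⟨0, 1, 40, -1810551961, 7, 1939836193, 0⟩, ⟨2, 1139105403, 0, 1101462927, 0, 1, 37⟩),
    (⟨0, 1, 40, -954842873, 8, 559115787, 0⟩, ⟨2, 909777678, 0, 754226928, 6, 1, 44⟩),
    (⟨0, 1, 33, -61748076, 5, 40966315, 0⟩, ⟨2, 34545382, 0, 35602861, 5, 1, 39⟩),
    (⟨0, 1, 39, -477819630, 8, 275887842, 0⟩, ⟨2, 454169754, 0, 377106356, 6, 1, 43⟩),
    (⟨0, 1, 31, -15452158, 5, 10273003, 0⟩, ⟨2, 8741838, 0, 9014792, 5, 1, 37⟩),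
    (⟨0, 1, 37, -13430757, 8, 9703841, 0⟩, ⟨2, -11442726, 0, 11587680, 4, 1, 36⟩)]⟩,
  ⟨9, 64, 625, 7776, 1, 2, 117649, 2097152, [
    (⟨0, 1, 43, -22209598, 18, 26296586, 0⟩, ⟨2, 31904871, 0, 23630228, 0, 1, 76⟩),
    (⟨0, 1, 37, -22199404, 12, -33103107, 0⟩, ⟨2, 22008185, 1, 32658876, 0, 1, 94⟩),
    (⟨0, 1, 46, -178830908, 18, 210538806, 0⟩, ⟨2, 257889901, 0, 195123293, 0, 1, 79⟩),
    (⟨0, 1, 46, -178841184, 18, 210434018, 0⟩, ⟨2, 153370551, 0, 149464819, 0, 1, 75⟩),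
    (⟨0, 1, 40, -178773104, 12, -249963970, 0⟩, ⟨2, 199532711, 0, 151978478, 0, 1, 103⟩),
    (⟨0, 1, 47, -357901605, 18, 421126016, 0⟩, ⟨2, 285210164, 0, 277894586, 0, 1, 80⟩),
    (⟨0, 1, 46, -178950805, 18, 210668980, 0⟩, ⟨2, 240822796, 0, 182614654, 0, 1, 83⟩),
    (⟨0, 1, 56, 29574065990, 17, -17407334247, 0⟩, ⟨2, 28212529570, 0, 28211766050, 0, 1, 65⟩),
    (⟨0, 1, 33, 6947496, 6, 7332038, 0⟩, ⟨2, 4563940, 0, 4563825, 0, 1, 66⟩),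
    (⟨0, 1, 50, 209258882, 18, -247762577, 0⟩, ⟨2, 254022340, 0, 254011481, 0, 1, 65⟩),
    (⟨0, 1, 36, 1621888, 11, 1213614, 0⟩, ⟨2, 1352535, 0, 1352479, 0, 1, 75⟩),
    (⟨0, 1, 35, 26172, 11, 18273, 0⟩, ⟨2, 26915, 0, 26950, 0, 1, 79⟩)]⟩,
  ⟨9, 64, 625, 117649, 1, 2, 7776, 2097152, [
    (⟨0, 1, 40, -44424929, 14, 53427780, 0⟩, ⟨2, -38116217, 1, -56465169, 0, 1, 63⟩),
    (⟨0, 1, 38, -44436704, 12, 42366499, 0⟩, ⟨2, -44147764, 1, -65433006, 0, 1, 70⟩),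
    (⟨0, 1, 43, -357710482, 14, 382388375, 0⟩, ⟨2, -325216720, 1, -492179622, 0, 1, 66⟩),
    (⟨0, 1, 43, -357725937, 14, 378608479, 0⟩, ⟨2, -397004355, 0, -386975037, 0, 1, 62⟩),
    (⟨0, 1, 41, -357850426, 12, 346118387, 0⟩, ⟨2, -292172407, 1, -444661276, 0, 1, 80⟩),
    (⟨0, 1, 42, -178974277, 14, 189422145, 0⟩, ⟨2, 234716568, 0, 228707966, 0, 1, 64⟩),
    (⟨0, 1, 41, -89487211, 14, 95565146, 0⟩, ⟨2, 98228972, 0, 74490156, 0, 1, 66⟩),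
    (⟨0, 1, 49, 1842150008, 14, -1965343190, 0⟩, ⟨2, -1453642719, 0, -1453079671, 0, 1, 46⟩),
    (⟨0, 1, 34, 13846982, 6, 14493948, 0⟩, ⟨2, 11695796, 0, 11691286, 0, 1, 43⟩),
    (⟨0, 1, 42, 13013968, 14, -15630447, 0⟩, ⟨2, -9650442, 0, -9646555, 0, 1, 46⟩),
    (⟨0, 1, 37, 1613691, 12, -1543289, 0⟩, ⟨2, -1326932, 0, -1326398, 0, 1, 50⟩),
    (⟨0, 1, 36, 20667, 12, -22679, 0⟩, ⟨2, -21133, 0, -21153, 0, 1, 54⟩)]⟩,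
  ⟨9, 64, 625, 2097152, 1, 2, 7776, 117649, [
    (⟨0, 1, 39, -22212583, 14, 27772955, 0⟩, ⟨2, -23155338, 0, -17150956, 0, 1, 61⟩),
    (⟨0, 1, 37, -22219648, 12, 24851274, 0⟩, ⟨2, -18157044, 1, -26909405, 0, 1, 69⟩),
    (⟨0, 1, 43, -357712637, 14, 405388753, 0⟩, ⟨2, -395081313, 0, -298952237, 0, 1, 65⟩),
    (⟨0, 1, 43, -357728160, 14, 402071074, 0⟩, ⟨2, -482242966, 0, -470048344, 0, 1, 62⟩),
    (⟨0, 1, 41, -357873116, 12, 409896093, 0⟩, ⟨2, -474835788, 0, -361305848, 0, 1, 80⟩),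
    (⟨0, 1, 42, -178976352, 14, 201161824, 0⟩, ⟨2, 267616357, 0, 260769688, 0, 1, 64⟩),
    (⟨0, 1, 41, -89488241, 14, 101332065, 0⟩, ⟨2, 111914723, 0, 84869876, 0, 1, 66⟩),
    (⟨0, 1, 49, 1841743850, 14, -2084432744, 0⟩, ⟨2, -1765083242, 0, -1764357093, 0, 1, 46⟩),
    (⟨0, 1, 34, 13843752, 6, 14482196, 0⟩, ⟨2, 14284869, 0, 14279017, 0, 1, 43⟩),
    (⟨0, 1, 42, 13011505, 14, -16256083, 0⟩, ⟨2, -11730432, 0, -11725424, 0, 1, 46⟩),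
    (⟨0, 1, 37, 1612919, 12, -1808705, 0⟩, ⟨2, -1091490, 0, -1091025, 0, 1, 50⟩),
    (⟨0, 1, 36, 20265, 12, -26330, 0⟩, ⟨2, -17685, 0, -17701, 0, 1, 54⟩)]⟩,
  ⟨9, 64, 7776, 117649, 1, 2, 625, 2097152, [
    (⟨0, 1, 45, -111067071, 10, 93689455, 0⟩, ⟨2, 82417437, 0, 82133960, 0, 1, 42⟩),
    (⟨0, 1, 50, -22751301070, 15, -33367698749, 0⟩, ⟨2, -18810430499, 1, -27941541744, 0, 1, 61⟩),
    (⟨0, 1, 34, -44631803, 8, 36731973, 0⟩, ⟨2, -42878103, 1, -63135067, 0, 1, 52⟩),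
    (⟨0, 1, 40, -716727046, 10, 594193218, 0⟩, ⟨2, -999364545, 0, -975011700, 0, 1, 52⟩),
    (⟨0, 1, 40, -716845166, 10, 679918519, 0⟩, ⟨2, -655962541, 1, -993917109, 0, 1, 56⟩),
    (⟨0, 1, 36, -44816238, 10, 42579836, 0⟩, ⟨2, -39200745, 1, -59472845, 0, 1, 52⟩),
    (⟨0, 1, 37, -179599029, 9, 213057118, 0⟩, ⟨2, -148812608, 1, -226119414, 0, 1, 60⟩),
    (⟨0, 1, 40, -716998582, 10, 594429220, 0⟩, ⟨2, -1009706082, 0, -986305878, 0, 1, 52⟩),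
    (⟨0, 1, 50, 56587438594, 10, -51957297791, 0⟩, ⟨2, -43749251858, 0, -43539188995, 0, 1, 40⟩),
    (⟨0, 1, 41, 1682779601, 6, 1383908225, 0⟩, ⟨2, -1133596959, 0, -1128152957, 0, 1, 38⟩),
    (⟨0, 1, 50, 3144159607, 14, 2308701606, 0⟩, ⟨2, -2960315909, 0, -2946065968, 0, 1, 43⟩),
    (⟨0, 1, 37, 24663034, 8, -21028241, 0⟩, ⟨2, -20706197, 0, -20606441, 0, 1, 36⟩)]⟩,
  ⟨9, 64, 7776, 2097152, 1, 2, 625, 117649, [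
    (⟨0, 1, 43, -27973358, 10, 24111883, 0⟩, ⟨2, 23318935, 0, 23238174, 0, 1, 41⟩),
    (⟨0, 1, 50, -22751676639, 15, -25204021389, 0⟩, ⟨2, -19095858158, 1, -28364825992, 0, 1, 61⟩),
    (⟨0, 1, 34, -44634566, 8, 37223568, 0⟩, ⟨2, -42207644, 1, -62143251, 0, 1, 52⟩),
    (⟨0, 1, 40, -716735280, 10, 597061886, 0⟩, ⟨2, -1006947251, 0, -982430758, 0, 1, 52⟩),
    (⟨0, 1, 40, -716852515, 10, 682055846, 0⟩, ⟨2, -659883838, 1, -999879041, 0, 1, 56⟩),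
    (⟨0, 1, 36, -44816437, 10, 42703608, 0⟩, ⟨2, -39797447, 1, -60377520, 0, 1, 52⟩),
    (⟨0, 1, 37, -179601417, 9, 213608394, 0⟩, ⟨2, -148621222, 1, -225830342, 0, 1, 60⟩),
    (⟨0, 1, 40, -717002910, 10, 597295272, 0⟩, ⟨2, -1024977299, 0, -1001198130, 0, 1, 52⟩),
    (⟨0, 1, 50, 56574344880, 10, -52138653758, 0⟩, ⟨2, -44406645926, 0, -44192362877, 0, 1, 40⟩),
    (⟨0, 1, 41, 1682391912, 6, 1382792461, 0⟩, ⟨2, -1149605790, 0, -1144057368, 0, 1, 38⟩),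
    (⟨0, 1, 52, 6286844362, 15, 6978003439, 0⟩, ⟨2, -6010370456, 0, -5981294633, 0, 1, 44⟩),
    (⟨0, 1, 37, 24650674, 8, -21287288, 0⟩, ⟨2, -20381977, 0, -20283294, 0, 1, 36⟩)]⟩,
  ⟨9, 64, 117649, 2097152, 1, 2, 625, 7776, [
    (⟨0, 1, 40, -7873023, 9, 4478391, 0⟩, ⟨2, 5768653, 0, 5746625, 0, 1, 42⟩),
    (⟨0, 1, 46, -11379634472, 12, 8712066657, 0⟩, ⟨2, -12076122277, 0, -8965702428, 0, 1, 59⟩),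
    (⟨0, 1, 38, -714213800, 8, 604135686, 0⟩, ⟨2, -1059926199, 0, -780233770, 0, 1, 56⟩),
    (⟨0, 1, 43, -5734388491, 10, 5119974825, 0⟩, ⟨2, -4506943805, 0, -4397462607, 0, 1, 54⟩),
    (⟨0, 1, 43, -5735209341, 10, 5712775963, 0⟩, ⟨2, -5843789081, 0, -4427091207, 0, 1, 58⟩),
    (⟨0, 1, 42, -5748728455, 9, 7229602031, 0⟩, ⟨2, -4532233008, 1, -6886957185, 0, 1, 65⟩),
    (⟨0, 1, 38, -179293140, 10, 178418891, 0⟩, ⟨2, -201611495, 0, -152965068, 0, 1, 53⟩),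
    (⟨0, 1, 42, -2868576671, 10, 2561257248, 0⟩, ⟨2, -2628884896, 0, -2567650734, 0, 1, 53⟩),
    (⟨0, 1, 52, 225545040548, 10, -219499908532, 0⟩,
     ⟨2, -174642525673, 0, -173737165634, 0, 1, 42⟩),
    (⟨0, 1, 43, 6701027131, 6, 5384608981, 0⟩, ⟨2, -4906325376, 0, -4880885448, 0, 1, 40⟩),
    (⟨0, 1, 49, 6256188619, 12, -4807630450, 0⟩, ⟨2, -7603244763, 0, -7563736966, 0, 1, 44⟩),
    (⟨0, 1, 40, 196425146, 8, -171982499, 0⟩, ⟨2, -261939506, 0, -260577399, 0, 1, 40⟩)]⟩,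
  ⟨9, 625, 7776, 117649, 1, 2, 64, 2097152, [
    (⟨0, 1, 45, -11458898558, 11, -14337667687, 0⟩, ⟨2, -11968600606, 0, -9156947767, 0, 1, 49⟩),
    (⟨0, 1, 44, -92870903126, 7, 105131577226, 0⟩, ⟨2, 106918821190, 0, 106410843324, 0, 1, 50⟩),
    (⟨0, 1, 41, -11611246689, 7, 13151039887, 0⟩, ⟨2, 12424392238, 0, 12405011752, 0, 1, 47⟩),
    (⟨0, 1, 35, -370022377, 6, 504483913, 0⟩, ⟨2, -312603891, 1, -453377539, 0, 1, 45⟩),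
    (⟨0, 1, 34, -185391307, 6, 264938572, 0⟩, ⟨2, -195200401, 0, -141864244, 0, 1, 43⟩),
    (⟨0, 1, 59, -11792739572109, 15, -16318812088656, 0⟩,
     ⟨2, -12979059293871, 0, -10065135498110, 0, 1, 59⟩),
    (⟨0, 1, 48, -92151456297, 11, -123695813965, 0⟩, ⟨2, -102965025387, 0, -80126593736, 0, 1, 52⟩),
    (⟨0, 1, 54, 448415929475, 10, 297018679714, 0⟩, ⟨2, -523258175157, 0, -498725026717, 0, 1, 41⟩),
    (⟨0, 1, 63, 13919194527208, 14, 9626788439115, 0⟩,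
     ⟨2, -10644785124125, 0, -10145738730851, 0, 1, 45⟩),
    (⟨0, 1, 47, 217701329160, 4, -194871569850, 0⟩, ⟨2, 206055068033, 0, 196398664674, 0, 1, 38⟩),
    (⟨0, 1, 44, 26766717676, 4, -25215946964, 0⟩, ⟨2, 22455104485, 0, 21402803627, 0, 1, 35⟩),
    (⟨0, 1, 46, -779844048, 11, -983447836, 0⟩, ⟨2, 584094196, 0, 557268718, 0, 1, 37⟩)]⟩,
  ⟨9, 625, 7776, 2097152, 1, 2, 64, 117649, [
    (⟨0, 1, 45, -11459278410, 11, -13856099817, 0⟩, ⟨2, -11987948617, 0, -9171584840, 0, 1, 49⟩),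
    (⟨0, 1, 45, -185742661873, 7, 210330840956, 0⟩, ⟨2, 214152694591, 0, 213130513908, 0, 1, 51⟩),
    (⟨0, 1, 42, -23222730835, 7, 26311035496, 0⟩, ⟨2, 24839357493, 0, 24802137422, 0, 1, 48⟩),
    (⟨0, 1, 35, -370024044, 6, 504504401, 0⟩, ⟨2, -312379930, 1, -453054424, 0, 1, 45⟩),
    (⟨0, 1, 33, -92697025, 6, 132512618, 0⟩, ⟨2, -97579677, 0, -70917538, 0, 1, 42⟩),
    (⟨0, 1, 59, -11792927774407, 15, -12207306582140, 0⟩,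
     ⟨2, -12998774334416, 0, -10080184101728, 0, 1, 59⟩),
    (⟨0, 1, 49, -184305896838, 11, -242875686513, 0⟩,
     ⟨2, -206237651690, 0, -160487824397, 0, 1, 53⟩),
    (⟨0, 1, 54, 448209490584, 10, 291631798349, 0⟩, ⟨2, -524212211535, 0, -499622309691, 0, 1, 41⟩),
    (⟨0, 1, 66, 55652898688616, 15, 57623424001271, 0⟩,
     ⟨2, -42642943342250, 0, -40642788308717, 0, 1, 47⟩),
    (⟨0, 1, 46, 108796713805, 4, -97423023051, 0⟩, ⟨2, 103154102697, 0, 98317603288, 0, 1, 37⟩),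
    (⟨0, 1, 44, 26740338372, 4, -25237572071, 0⟩, ⟨2, 22393533873, 0, 21343605222, 0, 1, 35⟩),
    (⟨0, 1, 46, -780660550, 11, -954104317, 0⟩, ⟨2, 584819742, 0, 557947577, 0, 1, 37⟩)]⟩,
  ⟨9, 625, 117649, 2097152, 1, 2, 64, 7776, [
    (⟨0, 1, 51, -366851372932, 12, -432145829599, 0⟩,
     ⟨2, -392599014919, 0, -300213609781, 0, 1, 54⟩),
    (⟨0, 1, 47, -743037037296, 7, 845439198254, 0⟩, ⟨2, 869777376869, 0, 865591316469, 0, 1, 53⟩),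
    (⟨0, 1, 44, -92897026247, 7, 105747257586, 0⟩, ⟨2, 102007635138, 0, 101801082961, 0, 1, 50⟩),
    (⟨0, 1, 39, -5921394774, 6, 8106545467, 0⟩, ⟨2, -4946523064, 1, -7173782603, 0, 1, 49⟩),
    (⟨0, 1, 37, -1483477938, 6, 2130612487, 0⟩, ⟨2, -1554798964, 0, -1130035555, 0, 1, 46⟩),
    (⟨0, 1, 56, -11796817416831, 12, 9187258024219, 0⟩,
     ⟨2, -13298400714616, 0, -10308791625269, 0, 1, 59⟩),
    (⟨0, 1, 50, -368746634664, 11, -345293322529, 0⟩,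
     ⟨2, -422460263330, 0, -328709755855, 0, 1, 54⟩),
    (⟨0, 1, 57, 1781490590232, 11, 1665005517196, 0⟩,
     ⟨2, -2107251994093, 0, -2007680102872, 0, 1, 43⟩),
    (⟨0, 1, 62, 27576213664650, 12, -21645957654811, 0⟩,
     ⟨2, -21818051300956, 0, -20787189348137, 0, 1, 46⟩),
    (⟨0, 1, 49, 862227596670, 4, -781069206997, 0⟩, ⟨2, 826215172511, 0, 787193477377, 0, 1, 40⟩),
    (⟨0, 1, 48, 424700344283, 4, -402829989845, 0⟩, ⟨2, 364310293634, 0, 347104382783, 0, 1, 39⟩),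
    (⟨0, 1, 52, -25224573124, 12, -32503999131, 0⟩, ⟨2, 19131278481, 0, 18245605540, 0, 1, 42⟩)]⟩,
  ⟨9, 7776, 117649, 2097152, 1, 2, 64, 625, [
    (⟨0, 1, 48, -368441772878, 9, 539500116441, 0⟩, ⟨2, -518404723338, 0, -394255494058, 0, 1, 54⟩),
    (⟨0, 1, 46, -371900168051, 7, 448227704957, 0⟩, ⟨2, 546380894766, 0, 542911218056, 0, 1, 52⟩),
    (⟨0, 1, 48, -1487629176122, 7, 1792983601872, 0⟩,
     ⟨2, 2177685589965, 0, 2164226116517, 0, 1, 54⟩),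
    (⟨0, 1, 42, -95058809167, 5, 70038647848, 0⟩, ⟨2, -78694427070, 1, -114248795843, 0, 1, 53⟩),
    (⟨0, 1, 40, -23767960396, 5, 17558049846, 0⟩, ⟨2, -19997784684, 1, -29038854302, 0, 1, 51⟩),
    (⟨0, 1, 49, -740520155517, 9, 876932985585, 0⟩, ⟨2, -567166894284, 1, -878652848968, 0, 1, 55⟩),
    (⟨0, 1, 48, -370272050655, 9, 432160713980, 0⟩, ⟨2, -283880114329, 1, -439889209353, 0, 1, 54⟩),
    (⟨0, 1, 55, 1586633752849, 9, -2041175105408, 0⟩,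
     ⟨2, -1403422743569, 0, -1331203475687, 0, 1, 42⟩),
    (⟨0, 1, 57, 6330678065074, 9, -8275803963511, 0⟩,
     ⟨2, -5707437617887, 0, -5413738011032, 0, 1, 44⟩),
    (⟨0, 1, 46, 96455502414, 4, -98212913644, 0⟩, ⟨2, 118701578164, 0, 112596064583, 0, 1, 37⟩),
    (⟨0, 1, 49, 770167191431, 4, -788438083898, 0⟩, ⟨2, 930704151503, 0, 882832728522, 0, 1, 40⟩),
    (⟨0, 1, 47, -14057463577, 8, 10255911772, 0⟩, ⟨2, 13618477009, 0, 12930427425, 0, 1, 41⟩)]⟩,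
  ⟨64, 625, 7776, 117649, 1, 2, 9, 2097152, [
    (⟨0, 1, 69, -12115230196128334, 15, -16672643070335927, 0⟩,
     ⟨2, 10404251728206519, 0, 11473670579886884, 0, 1, 61⟩),
    (⟨0, 1, 59, -189178950102674, 11, -230984793633432, 0⟩,
     ⟨2, 161213362998103, 0, 178369652745102, 0, 1, 55⟩),
    (⟨0, 1, 53, -46816424972747, 7, -57937754520989, 0⟩,
     ⟨2, 35835112668119, 0, 41599053734084, 0, 1, 53⟩),
    (⟨0, 1, 50, -5855176924894, 7, -7034111114645, 0⟩,
     ⟨2, 4458309532269, 0, 5185760069840, 0, 1, 50⟩),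
    (⟨0, 1, 54, -5925024136760, 11, -7072757633697, 0⟩,
     ⟨2, 4527691346071, 0, 5232240240431, 0, 1, 50⟩),
    (⟨0, 1, 36, -7101066003, 3, 7078519237, 0⟩, ⟨2, 6925130159, 0, 5175975603, 0, 1, 38⟩),
    (⟨0, 1, 35, -3554191260, 3, 3553436096, 0⟩, ⟨2, 3512860687, 0, 2620346271, 0, 1, 37⟩),
    (⟨0, 1, 55, -41124566135582, 7, -46200514569571, 0⟩,
     ⟨0, 1, 48, 47171487956584, 2, 61427818254886, 0⟩),
    (⟨0, 1, 52, -5152536066977, 7, -5661313848111, 0⟩,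
     ⟨0, 1, 45, 5896481639177, 2, 7771956889933, 0⟩),
    (⟨0, 1, 61, -169549335052183, 11, -206643883101357, 0⟩,
     ⟨0, 1, 50, 188657899204612, 2, 188260079022436, 0⟩),
    (⟨0, 1, 72, -21745437470935831, 15, -29923214988063051, 0⟩,
     ⟨0, 1, 57, 24147999959101698, 2, 23664881591282307, 0⟩),
    (⟨0, 1, 57, -10763176018127, 11, -12843515958494, 0⟩,
     ⟨0, 1, 46, 11792092523906, 2, 13760632968416, 0⟩)]⟩,
  ⟨64, 625, 7776, 2097152, 1, 2, 9, 117649, [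
    (⟨0, 1, 69, -12115421594106092, 15, -12459175374495419, 0⟩,
     ⟨2, 10406247270431014, 0, 11475598532029073, 0, 1, 61⟩),
    (⟨0, 1, 59, -189182090541362, 11, -226614182127532, 0⟩,
     ⟨2, 161245760615444, 0, 178400614269825, 0, 1, 55⟩),
    (⟨0, 1, 53, -46817509657268, 7, -57837239771185, 0⟩,
     ⟨2, 35844133122801, 0, 41607483178781, 0, 1, 53⟩),
    (⟨0, 1, 50, -5855398242008, 7, -7016026782072, 0⟩,
     ⟨2, 4458797824871, 0, 5186385846588, 0, 1, 50⟩),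
    (⟨0, 1, 55, -11850413754376, 11, -13685065879665, 0⟩,
     ⟨2, 9055870052669, 0, 10465402122887, 0, 1, 51⟩),
    (⟨0, 1, 36, -7101116893, 3, 7078711263, 0⟩, ⟨2, 6924771639, 0, 5175748754, 0, 1, 38⟩),
    (⟨0, 1, 36, -7108447056, 3, 7107120752, 0⟩, ⟨2, 7025515517, 0, 5240558375, 0, 1, 38⟩),
    (⟨0, 1, 55, -41128200703367, 7, -46120905505903, 0⟩,
     ⟨0, 1, 48, 47170349445474, 2, 61409569920326, 0⟩),
    (⟨0, 1, 51, -2576665885060, 7, -2824124985184, 0⟩,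
     ⟨0, 1, 44, 2948170348807, 2, 3886235027197, 0⟩),
    (⟨0, 1, 61, -169561697695891, 11, -202725765923556, 0⟩,
     ⟨0, 1, 50, 188653356779455, 2, 188220556970044, 0⟩),
    (⟨0, 1, 73, -43493940066687326, 15, -44719771803194999, 0⟩,
     ⟨0, 1, 58, 48294837516643881, 2, 47320731678429009, 0⟩),
    (⟨0, 1, 58, -21529430386069, 11, -24860845362079, 0⟩,
     ⟨0, 1, 47, 23583620043397, 2, 27521381725186, 0⟩)]⟩,
  ⟨64, 625, 117649, 2097152, 1, 2, 9, 7776, [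
    (⟨0, 1, 66, -12119422199062131, 12, 9470322693904417, 0⟩,
     ⟨2, 10436397860993157, 0, 11504661054969589, 0, 1, 61⟩),
    (⟨0, 1, 61, -756936991747605, 11, -635797734048812, 0⟩,
     ⟨2, 646374574460530, 0, 715090106330177, 0, 1, 57⟩),
    (⟨0, 1, 56, -374693926997079, 7, -449040538779458, 0⟩,
     ⟨2, 287682883506152, 0, 333769052840549, 0, 1, 56⟩),
    (⟨0, 1, 53, -46859091170347, 7, -54648457392002, 0⟩,
     ⟨2, 35807494518899, 0, 41618763058101, 0, 1, 53⟩),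
    (⟨0, 1, 61, -379361452620545, 12, -435587436044977, 0⟩,
     ⟨2, 291058441842333, 0, 336029558206891, 0, 1, 56⟩),
    (⟨0, 1, 40, -113625485723, 3, 113288933759, 0⟩, ⟨2, 110639445128, 0, 82709911448, 0, 1, 42⟩),
    (⟨0, 1, 39, -56875063812, 3, 56885845473, 0⟩, ⟨2, 56175713170, 0, 41905907399, 0, 1, 41⟩),
    (⟨0, 1, 57, -164776775732925, 7, -179258263208238, 0⟩,
     ⟨0, 1, 50, 188613396220713, 2, 244895292148468, 0⟩),
    (⟨0, 1, 55, -41280289875987, 7, -43995975343067, 0⟩,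
     ⟨0, 1, 48, 47153679605869, 2, 61898959311600, 0⟩),
    (⟨0, 1, 63, -679128939928156, 11, -568427302484899, 0⟩,
     ⟨0, 1, 52, 754342115716769, 2, 751908441273802, 0⟩),
    (⟨0, 1, 71, -43557920689262161, 13, 68019219820445769, 0⟩,
     ⟨0, 1, 58, 48277435856104855, 2, 47183522388873318, 0⟩),
    (⟨0, 1, 63, -345025603559026, 12, -399427859836812, 0⟩,
     ⟨0, 1, 51, 377201516216519, 2, 438164220295462, 0⟩)]⟩,
  ⟨64, 7776, 117649, 2097152, 1, 2, 9, 625, [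
    (⟨0, 1, 61, -3040488763595433, 9, 3766295167876063, 0⟩,
     ⟨2, 2680783365483931, 0, 2952015711780301, 0, 1, 59⟩),
    (⟨0, 1, 59, -760084289963712, 9, 924627327273083, 0⟩,
     ⟨2, 669739777502298, 0, 737699867300669, 0, 1, 57⟩),
    (⟨0, 1, 51, -11761532853909, 7, -9342262024084, 0⟩,
     ⟨2, 9368261650624, 0, 10795569417526, 0, 1, 51⟩),
    (⟨0, 1, 56, -376390401922436, 7, -297537878593511, 0⟩,
     ⟨2, 299641739427380, 0, 345363123770226, 0, 1, 56⟩),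
    (⟨0, 1, 56, -190551655128298, 8, 151065515190224, 0⟩,
     ⟨2, 154226999470168, 0, 175619000713623, 0, 1, 55⟩),
    (⟨0, 1, 44, -1821554167082, 3, 1826329207028, 0⟩,
     ⟨2, 1767101074034, 0, 1321185427944, 0, 1, 46⟩),
    (⟨0, 1, 42, -455444424489, 3, 456795808582, 0⟩, ⟨2, 442543874800, 0, 330795219007, 0, 1, 44⟩),
    (⟨0, 1, 57, -83844945524169, 8, -119750371092901, 0⟩,
     ⟨0, 1, 49, 93889808595757, 2, 117288968137501, 0⟩),
    (⟨0, 1, 59, -335467465443039, 8, -477118300654588, 0⟩,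
     ⟨0, 1, 51, 375559551618291, 2, 469783995043967, 0⟩),
    (⟨0, 1, 63, -2767014311680591, 9, 3336684450822295, 0⟩,
     ⟨0, 1, 54, 3004044314536670, 2, 2902833567647444, 0⟩),
    (⟨0, 1, 63, -2767446158837939, 9, 3398320603146668, 0⟩,
     ⟨0, 1, 54, 3004042131654026, 2, 2898512027935124, 0⟩),
    (⟨0, 1, 61, -703196157744603, 9, 1114446274900916, 0⟩,
     ⟨0, 1, 52, 751057895875870, 2, 818406136274540, 0⟩)]⟩,
  ⟨625, 7776, 117649, 2097152, 1, 2, 9, 64, [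
    (⟨0, 1, 51, -49174020239524, 5, 40874563952797, 0⟩,
     ⟨2, 63538611529575, 0, 65766437343531, 0, 1, 53⟩),
    (⟨0, 1, 52, -98351690150193, 5, 81824052358571, 0⟩,
     ⟨2, 127102544964222, 0, 131549127793430, 0, 1, 54⟩),
    (⟨0, 1, 53, -196800708497857, 5, 165576957962347, 0⟩,
     ⟨2, 254707786179126, 0, 263421672657798, 0, 1, 55⟩),
    (⟨0, 1, 53, -97839728810207, 6, 123127114642022, 0⟩,
     ⟨2, 106856847991247, 0, 118630168318254, 0, 1, 54⟩),
    (⟨0, 1, 53, -97839571511461, 6, 123116134922548, 0⟩,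
     ⟨2, 106853443958760, 0, 118627994992131, 0, 1, 54⟩),
    (⟨0, 1, 47, -14600113625123, 3, 14721979265617, 0⟩,
     ⟨2, 10645886987693, 1, 16433750649325, 0, 1, 50⟩),
    (⟨0, 1, 47, -14600157573603, 3, 14722140501937, 0⟩,
     ⟨2, 10646400303613, 1, 16434475711396, 0, 1, 50⟩),
    (⟨0, 1, 57, -394634869038858, 6, 452398576644669, 0⟩,
     ⟨0, 1, 51, 359695386689396, 2, 340384907469485, 0⟩),
    (⟨0, 1, 57, -394637281050664, 6, 452438090141156, 0⟩,
     ⟨0, 1, 51, 359695368208697, 2, 340358489317931, 0⟩),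
    (⟨0, 1, 55, -201746962434024, 5, 166787431167523, 0⟩,
     ⟨0, 1, 51, 179792579066870, 3, 183452582083022, 0⟩),
    (⟨0, 1, 55, -201792447597956, 5, 167026790353422, 0⟩,
     ⟨0, 1, 51, 179792623749468, 3, 183572844647228, 0⟩),
    (⟨0, 1, 56, -404825040169100, 5, 340468709047291, 0⟩,
     ⟨0, 1, 52, 359586536786333, 3, 370624134991647, 0⟩)]⟩]

theorem splits_distinct : splits.all fun s =>
    decide [s.a₁, s.a₂, s.a₃, s.a₄, s.b₁, s.b₂, s.b₃, s.b₄].Nodup := by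
  decide +kernel

theorem splits_cover : ∀ A ∈ Finset.powersetCard 4
      ({1, 2, 9, 64, 625, 7776, 117649, 2097152} : Finset ℕ),
    ∃ s ∈ splits, A = {s.a₁, s.a₂, s.a₃, s.a₄} ∧
      ({1, 2, 9, 64, 625, 7776, 117649, 2097152} : Finset ℕ) \ A = {s.b₁, s.b₂, s.b₃, s.b₄} := by
  decide +kernel

theorem splits_lowerTest : splits.all Split.lowerTest := by
  decide +kernel

theorem splits_upperTest : splits.all Split.upperTest := by
  decide +kernel

namespace Split

variable {s : Split}

theorem setOf_isSol (hd : s.Distinct) (hl : s.lowerTest) (hu : s.upperTest) :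
    {p | s.IsSol p}.Finite ∧ {p | s.IsSol p}.ncard = 12 ∧
      ∀ p ∈ {p | s.IsSol p}, conjStable5 p.1 ∧ conjStable5 p.2 := by
  obtain ⟨f, hf, h⟩ := exists_of_lowerTest hd.distinctB hl
  have heq : {p | s.IsSol p} = Set.range f := by
    refine Set.Subset.antisymm (fun p hp => ?_) ?_
    · by_contra hpf
      refine not_isSol_of_upperTest hd hu (f := Fin.cons p f)
        (Fin.cons_injective_iff.2 ⟨hpf, hf⟩) fun i => ?_
      exact Fin.cases hp (fun i => (h i).1) i
    · rintro _ ⟨i, rfl⟩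
      exact (h i).1
  rw [heq]
  refine ⟨Set.finite_range f, ?_, ?_⟩
  · rw [← Set.image_univ, Set.ncard_image_of_injective _ hf, Set.ncard_univ, Nat.card_fin]
  · rintro _ ⟨i, rfl⟩
    exact (h i).2

end Split

/-- For `S = {1, 2, 3², 4³, 5⁴, 6⁵, 7⁶, 8⁷}` and every 4-element subset `A ⊆ S`, with
`B = S \ A`: the set of flags `E₂ ⊂ E₃` in `ℂ⁵` with `E₂ ∩ F₃(a) ≠ 0` for all `a ∈ A`
and `E₃ ∩ F₂(b) ≠ 0` for all `b ∈ B` has exactly twelve elements, all of them real. -/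
theorem stmt_7 (A : Finset ℕ)
    (hA : A ⊆ ({1, 2, 9, 64, 625, 7776, 117649, 2097152} : Finset ℕ))
    (hcard : A.card = 4) :
    {p : Submodule ℂ (Fin 5 → ℂ) × Submodule ℂ (Fin 5 → ℂ) |
        Module.finrank ℂ p.1 = 2 ∧ Module.finrank ℂ p.2 = 3 ∧ p.1 ≤ p.2 ∧
        (∀ a ∈ A, p.1 ⊓ oscF5 3 (a : ℂ) ≠ ⊥) ∧
        (∀ b ∈ ({1, 2, 9, 64, 625, 7776, 117649, 2097152} : Finset ℕ) \ A,
          p.2 ⊓ oscF5 2 (b : ℂ) ≠ ⊥)}.Finite ∧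
      {p : Submodule ℂ (Fin 5 → ℂ) × Submodule ℂ (Fin 5 → ℂ) |
        Module.finrank ℂ p.1 = 2 ∧ Module.finrank ℂ p.2 = 3 ∧ p.1 ≤ p.2 ∧
        (∀ a ∈ A, p.1 ⊓ oscF5 3 (a : ℂ) ≠ ⊥) ∧
        (∀ b ∈ ({1, 2, 9, 64, 625, 7776, 117649, 2097152} : Finset ℕ) \ A,
          p.2 ⊓ oscF5 2 (b : ℂ) ≠ ⊥)}.ncard = 12 ∧
      ∀ p ∈ {p : Submodule ℂ (Fin 5 → ℂ) × Submodule ℂ (Fin 5 → ℂ) |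
        Module.finrank ℂ p.1 = 2 ∧ Module.finrank ℂ p.2 = 3 ∧ p.1 ≤ p.2 ∧
        (∀ a ∈ A, p.1 ⊓ oscF5 3 (a : ℂ) ≠ ⊥) ∧
        (∀ b ∈ ({1, 2, 9, 64, 625, 7776, 117649, 2097152} : Finset ℕ) \ A,
          p.2 ⊓ oscF5 2 (b : ℂ) ≠ ⊥)},
        conjStable5 p.1 ∧ conjStable5 p.2 := by
  obtain ⟨s, hs, hA, hB⟩ := splits_cover A (Finset.mem_powersetCard.2 ⟨hA, hcard⟩)
  have hd : [s.a₁, s.a₂, s.a₃, s.a₄, s.b₁, s.b₂, s.b₃, s.b₄].Nodup :=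
    of_decide_eq_true (List.all_eq_true.1 splits_distinct s hs)
  have h := Split.setOf_isSol hd (List.all_eq_true.1 splits_lowerTest s hs)
    (List.all_eq_true.1 splits_upperTest s hs)
  rw [hB, hA]
  simpa only [Split.IsSol, ← List.mem_toFinset, List.toFinset_cons, List.toFinset_nil,
    insert_empty_eq] using h
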